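/- The number α₈ = √17 · ln((√17 − 1)/(√17 + 1)) has non-quadraticity measure at most 10.9057; that is, for every real κ > 10.9057, there exist only finitely many real numbers β that are roots of irreducible integer polynomials of degree at most 2 and satisfy |α₈ − β| < H(β)^(−κ), where H(β) denotes the largest absolute value of the coefficients of the irreducible integer polynomial having β as a root. -/

import Mathlib

/-- The height of an integer polynomial: the largest absolute value of its coefficients. -/
def polyHeight (P : Polynomial ℤ) : ℕ :=
  P.support.sup fun i => (P.coeff i).natAbs

namespace NQ
open MeasureTheory Filter Topology Complex

lemma pnt_F : ∃ F : ℂ → ℂ, ContinuousOn F {s | 1 ≤ s.re} ∧ ∀ s : ℂ, 1 < s.re →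
    LSeries (fun n => ((ArithmeticFunction.vonMangoldt n : ℝ) : ℂ)) s = F s + 1 / (s - 1) := by
  refine ⟨_, ArithmeticFunction.vonMangoldt.continuousOn_LFunctionResidueClassAux (q := 1) (1 : ZMod 1), ?_⟩
  intro s hs
  have h := ArithmeticFunction.vonMangoldt.eqOn_LFunctionResidueClassAux (q := 1) (a := 1) isUnit_one hs
  rw [h]
  have h2 : (fun n => ((ArithmeticFunction.vonMangoldt.residueClass (1 : ZMod 1) n : ℝ) : ℂ))
      = fun n => ((ArithmeticFunction.vonMangoldt n : ℝ) : ℂ) := by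
    funext n
    unfold ArithmeticFunction.vonMangoldt.residueClass
    rw [Set.indicator_of_mem]
    simp only [Set.mem_setOf_eq]
    exact Subsingleton.elim _ _
  rw [h2]
  simp

/-- the Chebyshev deviation function -/
noncomputable def fP (t : ℝ) : ℝ :=
  (Set.Ioi (0 : ℝ)).indicator (fun t => Chebyshev.psi (Real.exp t) * Real.exp (-t) - 1) t

lemma fP_bound (t : ℝ) : |fP t| ≤ 6 := by
  unfold fP
  by_cases h : t ∈ Set.Ioi (0:ℝ)
  · rw [Set.indicator_of_mem h]
    have h1 := Chebyshev.psi_le_const_mul_self (Real.exp_pos t).le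
    have h0 := Chebyshev.psi_nonneg (Real.exp t)
    have h4 : Real.log 4 < 1.4 := by
      rw [show (4:ℝ) = 2 ^ 2 by norm_num, Real.log_pow]
      have := Real.log_two_lt_d9
      push_cast; linarith
    have h5 : Chebyshev.psi (Real.exp t) * Real.exp (-t) ≤ Real.log 4 + 4 := by
      calc _ ≤ (Real.log 4 + 4) * Real.exp t * Real.exp (-t) :=
            mul_le_mul_of_nonneg_right h1 (Real.exp_pos _).le
        _ = _ := by rw [mul_assoc, ← Real.exp_add]; simp
    have h6 : 0 ≤ Chebyshev.psi (Real.exp t) * Real.exp (-t) := by positivity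
    rw [abs_le]; constructor <;> linarith
  · rw [Set.indicator_of_notMem h]; norm_num

lemma fP_meas : Measurable fP := by
  unfold fP
  apply Measurable.indicator _ measurableSet_Ioi
  exact ((Chebyshev.psi_mono.measurable.comp Real.measurable_exp).mul
    (Real.measurable_exp.comp measurable_neg)).sub_const 1

lemma integrable_fP_exp {z : ℂ} (hz : 0 < z.re) :
    IntegrableOn (fun t : ℝ => (fP t : ℂ) * cexp (-z * t)) (Set.Ioi 0) := by
  have h1 : IntegrableOn (fun t : ℝ => cexp (-z * t)) (Set.Ioi 0) :=
    integrableOn_exp_mul_complex_Ioi (by simpa using hz) 0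
  refine Integrable.bdd_mul (c := 6) h1 ?_ ?_
  · exact (Complex.measurable_ofReal.comp fP_meas).aestronglyMeasurable
  · exact Eventually.of_forall fun t => by simpa using fP_bound t

lemma psi_laplace {z : ℂ} (hz : 0 < z.re) :
    LSeries (fun n => ((ArithmeticFunction.vonMangoldt n : ℝ) : ℂ)) (1 + z) =
     (1 + z) * ∫ t in Set.Ioi (0:ℝ), ((fP t : ℂ) + 1) * cexp (-z * t) := by
  rw [LSeries_eq_mul_integral_of_nonneg (fun n => ArithmeticFunction.vonMangoldt n) (r := 1)
    zero_le_one (by simpa using hz) _ (fun n => ArithmeticFunction.vonMangoldt_nonneg)]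
  · congr 1
    have himg : Real.exp '' Set.Ioi 0 = Set.Ioi 1 := by
      ext y; constructor
      · rintro ⟨x, hx, rfl⟩; simpa using hx
      · intro hy
        have : (1:ℝ) < y := hy
        exact ⟨Real.log y, Real.log_pos this, Real.exp_log (by linarith)⟩
    rw [← himg, integral_image_eq_integral_abs_deriv_smul measurableSet_Ioi
      (fun x _ => (Real.hasDerivAt_exp x).hasDerivWithinAt) Real.exp_injective.injOn]
    refine setIntegral_congr_fun measurableSet_Ioi fun t ht => ?_
    have hs : (∑ k ∈ Finset.Icc 1 ⌊Real.exp t⌋₊, ((ArithmeticFunction.vonMangoldt k : ℝ) : ℂ))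
        = (Chebyshev.psi (Real.exp t) : ℂ) := by
      rw [Chebyshev.psi]; push_cast
      rfl
    have hc : ((Real.exp t : ℝ) : ℂ) ^ (-(1 + z + 1)) = cexp (-(1+z+1) * t) := by
      rw [Complex.ofReal_exp, Complex.cpow_def_of_ne_zero (Complex.exp_ne_zero _), 
        ← Complex.ofReal_exp, ← Complex.ofReal_log (Real.exp_pos t).le, Real.log_exp, mul_comm]
    simp only [hs, hc, fP, Set.indicator_of_mem ht, Complex.real_smul, abs_of_pos (Real.exp_pos t)]
    push_cast
    rw [sub_add_cancel]
    have : cexp t * (Chebyshev.psi (Real.exp t) * cexp (-(1+z+1)*t)) = 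
      Chebyshev.psi (Real.exp t) * (cexp t * cexp (-(1+z+1)*t)) := by ring
    rw [this, ← Complex.exp_add, mul_assoc, ← Complex.exp_add]
    congr 2; ring
  · simp only [Real.rpow_one]
    refine Asymptotics.IsBigO.of_bound (Real.log 4 + 4) (Eventually.of_forall fun n => ?_)
    have h1 := Chebyshev.psi_le_const_mul_self (x := (n:ℝ)) (by positivity)
    have h0 := Chebyshev.psi_nonneg (n:ℝ)
    have : Chebyshev.psi n = ∑ k ∈ Finset.Icc 1 n, ArithmeticFunction.vonMangoldt k := by
      rw [Chebyshev.psi, Nat.floor_natCast]; rfl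
    rw [← this, Real.norm_of_nonneg h0, Real.norm_of_nonneg (by positivity)]
    exact h1

lemma pnt_G : ∃ G : ℂ → ℂ, ContinuousOn G {z | 0 ≤ z.re} ∧ ∀ z : ℂ, 0 < z.re →
    ∫ t in Set.Ioi (0:ℝ), (fP t : ℂ) * cexp (-z * t) = G z := by
  obtain ⟨F, hF, hF2⟩ := pnt_F
  refine ⟨fun z => (F (1 + z) - 1) / (1 + z), ?_, ?_⟩
  · refine ContinuousOn.div ?_ (by fun_prop) ?_
    · refine ContinuousOn.sub ?_ continuousOn_const
      exact hF.comp (by fun_prop) (fun z hz => by simpa using hz)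
    · intro z hz h
      have : (1 + z).re = 0 := by rw [h]; simp
      simp at this hz; linarith
  · intro z hz
    have h1 := psi_laplace hz
    rw [hF2 _ (by simpa using hz)] at h1
    have hi := integrable_fP_exp hz
    have he : IntegrableOn (fun t : ℝ => cexp (-z * t)) (Set.Ioi 0) :=
      integrableOn_exp_mul_complex_Ioi (by simpa using hz) 0
    have h2 : ∫ t in Set.Ioi (0:ℝ), ((fP t : ℂ) + 1) * cexp (-z * t) =
       (∫ t in Set.Ioi (0:ℝ), (fP t : ℂ) * cexp (-z * t)) + 1 / z := by
      simp only [add_mul, one_mul]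
      rw [integral_add hi he, integral_exp_mul_complex_Ioi (by simpa using hz)]
      simp [neg_div_neg_eq]
    rw [h2] at h1
    have hz0 : z ≠ 0 := by rintro rfl; simp at hz
    have hz1 : 1 + z ≠ 0 := by
      intro h
      have : (1 + z).re = 0 := by rw [h]; simp
      simp at this; linarith
    rw [add_sub_cancel_left] at h1
    rw [eq_div_iff hz1]
    have h3 : F (1+z) = (1+z) * ((∫ t in Set.Ioi (0:ℝ), (fP t : ℂ) * cexp (-z * t)) + 1 / z) - 1 / z := by
      rw [← h1]; ring
    rw [h3]; field_simp; ring
end NQ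

namespace NQ
open MeasureTheory Filter Topology Complex

/-- Fejer kernel -/
noncomputable def fK (R v : ℝ) : ℝ := ∫ u in (0:ℝ)..R, (1 - u / R) * Real.cos (u * v)

lemma fK_zero {R : ℝ} (hR : 0 < R) : fK R 0 = R / 2 := by
  unfold fK
  simp only [mul_zero, Real.cos_zero, mul_one]
  rw [intervalIntegral.integral_sub (by simp) (by apply Continuous.intervalIntegrable; fun_prop)]
  rw [intervalIntegral.integral_div, integral_id]
  simp; field_simp; ring

lemma fK_eq {R v : ℝ} (hR : 0 < R) (hv : v ≠ 0) : fK R v = (1 - Real.cos (R * v)) / (R * v ^ 2) := by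
  unfold fK
  have : ∀ u ∈ Set.uIcc 0 R, HasDerivAt
     (fun u => (1 - u / R) * (Real.sin (u * v) / v) - Real.cos (u * v) / (R * v ^ 2))
     ((1 - u / R) * Real.cos (u * v)) u := by
    intro u _
    have h1 : HasDerivAt (fun u : ℝ => u * v) v u := by simpa using (hasDerivAt_id u).mul_const v
    have h2 := (((hasDerivAt_id u).div_const R).const_sub 1).mul (h1.sin.div_const v)
    have h3 := h1.cos.div_const (R * v ^ 2)
    refine (h2.sub h3).congr_deriv ?_
    simp only [id]
    field_simp
    ring
  rw [intervalIntegral.integral_eq_sub_of_hasDerivAt this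
    (by apply Continuous.intervalIntegrable; fun_prop)]
  simp [div_self hR.ne']
  ring

lemma fK_nonneg {R : ℝ} (hR : 0 < R) (v : ℝ) : 0 ≤ fK R v := by
  by_cases hv : v = 0
  · subst hv; rw [fK_zero hR]; positivity
  · rw [fK_eq hR hv]
    have := Real.cos_le_one (R * v)
    apply div_nonneg (by linarith) (by positivity)

lemma fK_le1 {R : ℝ} (hR : 0 < R) (v : ℝ) : fK R v ≤ R / 2 := by
  by_cases hv : v = 0
  · subst hv; rw [fK_zero hR]
  · rw [fK_eq hR hv, div_le_iff₀ (by positivity)]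
    have := Real.one_sub_sq_div_two_le_cos (x := R * v)
    nlinarith

lemma fK_le2 {R : ℝ} (hR : 0 < R) (v : ℝ) : fK R v * (R * v ^ 2) ≤ 2 := by
  by_cases hv : v = 0
  · subst hv; simp
  · rw [fK_eq hR hv, div_mul_cancel₀ _ (by positivity)]
    have := Real.neg_one_le_cos (R * v)
    linarith

lemma fK_le3 {R : ℝ} (hR : 0 < R) (v : ℝ) : fK R v ≤ (R / 2 + 2 / R) * (1 + v ^ 2)⁻¹ := by
  rw [← div_eq_mul_inv, le_div_iff₀ (by positivity)]
  have h1 := fK_le1 hR v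
  have h2 := fK_le2 hR v
  have : fK R v * v ^ 2 ≤ 2 / R := by
    rw [le_div_iff₀ hR]; linarith
  linarith

lemma fK_ge {R : ℝ} (hR : 0 < R) {v : ℝ} (hv : |R * v| ≤ 1) : R / 5 ≤ fK R v := by
  by_cases hv0 : v = 0
  · subst hv0; rw [fK_zero hR]; linarith
  · rw [fK_eq hR hv0, le_div_iff₀ (by positivity)]
    have h1 := Real.cos_le_one_sub_mul_cos_sq (x := R * v) (hv.trans (by linarith [Real.pi_gt_three]))
    have hpi : 1 / 5 ≤ 2 / Real.pi ^ 2 := by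
      rw [div_le_div_iff₀ (by norm_num) (by positivity)]
      nlinarith [Real.pi_lt_d2, Real.pi_pos]
    have : 1 / 5 * (R * v) ^ 2 ≤ 2 / Real.pi ^ 2 * (R * v) ^ 2 := by gcongr
    nlinarith

lemma fK_cont (R : ℝ) : Continuous (fK R) := by
  unfold fK
  apply intervalIntegral.continuous_parametric_intervalIntegral_of_continuous'
  fun_prop

lemma fK_integrable {R : ℝ} (hR : 0 < R) (y : ℝ) : Integrable (fun t => fK R (y - t)) := by
  have : Integrable (fK R) := by
    refine Integrable.mono' (integrable_inv_one_add_sq.const_mul (R / 2 + 2 / R))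
      (fK_cont R).aestronglyMeasurable (Eventually.of_forall fun v => ?_)
    rw [Real.norm_of_nonneg (fK_nonneg hR v)]
    exact fK_le3 hR v
  exact this.comp_sub_left y

lemma fejer_id {G : ℂ → ℂ} (hG2 : ∀ z : ℂ, 0 < z.re →
    ∫ t in Set.Ioi (0:ℝ), (fP t : ℂ) * cexp (-z * t) = G z) {R ε : ℝ} (hR : 0 < R) (hε : 0 < ε)
    (y : ℝ) :
    ∫ t in Set.Ioi (0:ℝ), fP t * Real.exp (-(ε * t)) * fK R (y - t) =
      ∫ u in (0:ℝ)..R, (1 - u / R) * (cexp (I * (u * y : ℝ)) * G (ε + I * u)).re := by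
  have e1 : ∀ t, fP t * Real.exp (-(ε * t)) * fK R (y - t) =
      ∫ u in Set.Ioc 0 R, fP t * Real.exp (-(ε * t)) * ((1 - u / R) * Real.cos (u * (y - t))) := by
    intro t
    rw [fK, intervalIntegral.integral_of_le hR.le, integral_const_mul]
  simp_rw [e1]
  rw [integral_integral_swap, intervalIntegral.integral_of_le hR.le]
  · refine setIntegral_congr_fun measurableSet_Ioc fun u hu => ?_
    have hz : 0 < ((ε : ℂ) + I * u).re := by simpa using hε
    rw [← hG2 _ hz, ← integral_const_mul]
    have hint := (integrable_fP_exp hz).const_mul (cexp (I * (u * y : ℝ)))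
    have := integral_re hint
    simp only [RCLike.re_eq_complex_re] at this
    rw [← this, ← integral_const_mul]
    refine setIntegral_congr_fun measurableSet_Ioi fun t ht => ?_
    have : cexp (I * (u * y : ℝ)) * (fP t * cexp (-(ε + I * u) * t)) = 
       ((fP t * Real.exp (-(ε * t)) : ℝ) : ℂ) * cexp ((u * (y - t) : ℝ) * I) := by
      push_cast
      rw [mul_left_comm, ← Complex.exp_add, mul_assoc, ← Complex.exp_add]
      congr 2; ring
    rw [this, Complex.re_ofReal_mul, Complex.exp_ofReal_mul_I_re]
    ring
  · have hb : Integrable (Function.uncurry fun (t u : ℝ) => Real.exp (-(ε * t)) * (1:ℝ))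
      ((volume.restrict (Set.Ioi 0)).prod (volume.restrict (Set.Ioc 0 R))) := by
      refine Integrable.mul_prod (f := fun t : ℝ => Real.exp (-(ε * t))) (g := fun _ : ℝ => (1:ℝ)) ?_ ?_
      · have := exp_neg_integrableOn_Ioi 0 hε
        simpa [IntegrableOn] using this
      · exact integrable_const 1
    refine (hb.const_mul (6 * 1)).mono' ?_ ?_
    · apply Measurable.aestronglyMeasurable
      have := fP_meas
      unfold Function.uncurry
      fun_prop
    · have : ∀ᵐ p : ℝ × ℝ ∂((volume.restrict (Set.Ioi 0)).prod (volume.restrict (Set.Ioc 0 R))),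
        p ∈ (Set.Ioi (0:ℝ)) ×ˢ (Set.Ioc (0:ℝ) R) := by
        rw [Measure.prod_restrict]
        exact ae_restrict_mem (measurableSet_Ioi.prod measurableSet_Ioc)
      filter_upwards [this] with p hp
      obtain ⟨h1, h2⟩ := hp
      simp only [Set.mem_Ioi, Set.mem_Ioc] at h1 h2
      simp only [Function.uncurry]
      rw [norm_mul, norm_mul, Real.norm_of_nonneg (Real.exp_pos _).le]
      have a1 := fP_bound p.1
      have a2 : ‖(1 - p.2 / R) * Real.cos (p.2 * (y - p.1))‖ ≤ 1 := by
        rw [norm_mul, Real.norm_eq_abs, Real.norm_eq_abs]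
        have b1 : |1 - p.2 / R| ≤ 1 := by
          have : p.2 / R ≤ 1 := by rw [div_le_one hR]; exact h2.2
          have : 0 ≤ p.2 / R := div_nonneg h2.1.le hR.le
          rw [abs_le]; constructor <;> linarith
        exact mul_le_one₀ b1 (abs_nonneg _) (Real.abs_cos_le_one _)
      rw [Real.norm_eq_abs]
      have := Real.exp_pos (-(ε * p.1))
      calc |fP p.1| * Real.exp (-(ε * p.1)) * _ ≤ 6 * Real.exp (-(ε * p.1)) * 1 := by gcongr
        _ = _ := by ring

lemma fejer_id0 {G : ℂ → ℂ} (hG : ContinuousOn G {z | 0 ≤ z.re}) (hG2 : ∀ z : ℂ, 0 < z.re →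
    ∫ t in Set.Ioi (0:ℝ), (fP t : ℂ) * cexp (-z * t) = G z) {R : ℝ} (hR : 0 < R)
    (y : ℝ) :
    ∫ t in Set.Ioi (0:ℝ), fP t * fK R (y - t) =
      ∫ u in (0:ℝ)..R, (1 - u / R) * (cexp (I * (u * y : ℝ)) * G (I * u)).re := by
  have l1 : Tendsto (fun ε : ℝ => ∫ t in Set.Ioi (0:ℝ), fP t * Real.exp (-(ε * t)) * fK R (y - t))
      (𝓝[>] 0) (𝓝 (∫ t in Set.Ioi (0:ℝ), fP t * fK R (y - t))) := by
    refine tendsto_integral_filter_of_dominated_convergence (fun t => 6 * fK R (y - t)) ?_ ?_ ?_ ?_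
    · refine Eventually.of_forall fun ε => Measurable.aestronglyMeasurable ?_
      have := fP_meas
      have := (fK_cont R).measurable
      fun_prop
    · filter_upwards [self_mem_nhdsWithin] with ε hε
      filter_upwards [ae_restrict_mem measurableSet_Ioi] with t ht
      have hε' : 0 < ε := hε
      have ht' : 0 < t := ht
      rw [norm_mul, norm_mul, Real.norm_of_nonneg (fK_nonneg hR _), Real.norm_of_nonneg (Real.exp_pos _).le]
      have h1 := fP_bound t
      have h2 : Real.exp (-(ε * t)) ≤ 1 := by
        rw [Real.exp_le_one_iff]; nlinarith
      have := fK_nonneg hR (y - t)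
      rw [Real.norm_eq_abs]
      calc |fP t| * Real.exp (-(ε * t)) * fK R (y - t) ≤ 6 * 1 * fK R (y - t) := by gcongr
        _ = _ := by ring
    · exact ((fK_integrable hR y).const_mul 6).integrableOn
    · refine Eventually.of_forall fun t => ?_
      have : Continuous fun ε : ℝ => fP t * Real.exp (-(ε * t)) * fK R (y - t) := by fun_prop
      have := (this.tendsto 0).mono_left (nhdsWithin_le_nhds (s := Set.Ioi 0))
      simpa using this
  have hcomp : IsCompact (Set.Icc (0:ℝ) 1 ×ˢ Set.Icc (0:ℝ) R) := isCompact_Icc.prod isCompact_Icc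
  have hmap : ContinuousOn (fun p : ℝ × ℝ => G (p.1 + I * p.2)) (Set.Icc (0:ℝ) 1 ×ˢ Set.Icc (0:ℝ) R) := by
    refine hG.comp (by fun_prop) ?_
    rintro ⟨a, b⟩ ⟨h1, h2⟩
    simpa using h1.1
  obtain ⟨C, hC⟩ := hcomp.exists_bound_of_continuousOn hmap
  have l2 : Tendsto (fun ε : ℝ => ∫ u in (0:ℝ)..R, (1 - u / R) * (cexp (I * (u * y : ℝ)) * G (ε + I * u)).re)
      (𝓝[>] 0) (𝓝 (∫ u in (0:ℝ)..R, (1 - u / R) * (cexp (I * (u * y : ℝ)) * G (I * u)).re)) := by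
    have hev : ∀ᶠ ε : ℝ in 𝓝[>] 0, ε ∈ Set.Icc (0:ℝ) 1 := by
      filter_upwards [Ioo_mem_nhdsGT (show (0:ℝ) < 1 by norm_num)] with ε hε using ⟨hε.1.le, hε.2.le⟩
    simp_rw [intervalIntegral.integral_of_le hR.le]
    refine tendsto_integral_filter_of_dominated_convergence (fun t => C) ?_ ?_ ?_ ?_
    · filter_upwards [hev] with ε hε
      refine ContinuousOn.aestronglyMeasurable ?_ measurableSet_Ioc
      refine ContinuousOn.mul (by fun_prop) ?_
      refine Complex.continuous_re.comp_continuousOn (ContinuousOn.mul (by fun_prop) ?_)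
      refine hG.comp (by fun_prop) ?_
      intro u hu; simpa using hε.1
    · filter_upwards [hev] with ε hε
      filter_upwards [ae_restrict_mem measurableSet_Ioc] with u hu
      have h := hC (ε, u) ⟨hε, hu.1.le, hu.2⟩
      rw [norm_mul]
      have b1 : ‖1 - u / R‖ ≤ 1 := by
        have : u / R ≤ 1 := by rw [div_le_one hR]; exact hu.2
        have : 0 ≤ u / R := div_nonneg hu.1.le hR.le
        rw [Real.norm_eq_abs, abs_le]; constructor <;> linarith
      have b2 : ‖(cexp (I * (u * y : ℝ)) * G (ε + I * u)).re‖ ≤ C := by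
        refine (Complex.abs_re_le_norm _).trans ?_
        rw [norm_mul, mul_comm I, Complex.norm_exp_ofReal_mul_I, one_mul]; exact h
      calc _ ≤ 1 * C := mul_le_mul b1 b2 (norm_nonneg _) zero_le_one
        _ = C := one_mul C
    · exact integrable_const C
    · filter_upwards [ae_restrict_mem measurableSet_Ioc] with u hu
      have c1 : ContinuousOn (fun ε : ℝ => (1 - u / R) * (cexp (I * (u * y : ℝ)) * G (ε + I * u)).re) (Set.Ici 0) := by
        refine ContinuousOn.mul (by fun_prop) ?_
        refine Complex.continuous_re.comp_continuousOn (ContinuousOn.mul (by fun_prop) ?_)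
        refine hG.comp (by fun_prop) ?_
        intro ε hε; simpa using hε
      have := (c1 0 (by simp)).mono_left (nhdsWithin_mono 0 Set.Ioi_subset_Ici_self)
      simpa using this
  refine tendsto_nhds_unique l1 (l2.congr' ?_)
  filter_upwards [self_mem_nhdsWithin] with ε hε
  exact (fejer_id hG2 hR hε y).symm

lemma fejer_lim {R : ℝ} (hR : 0 < R) :
    Tendsto (fun y : ℝ => ∫ t in Set.Ioi (0:ℝ), fP t * fK R (y - t)) atTop (𝓝 0) := by
  obtain ⟨G, hG, hG2⟩ := pnt_G
  simp_rw [fejer_id0 hG hG2 hR]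
  let h : ℝ → ℂ := (Set.Ioc 0 R).indicator (fun u => ((1 - u / R : ℝ) : ℂ) * G (I * u))
  have hrl := Real.tendsto_integral_exp_smul_cocompact h
  have hc : Tendsto (fun y : ℝ => -(y / (2 * Real.pi))) atTop (cocompact ℝ) := by
    have : Tendsto (fun y : ℝ => -(y / (2 * Real.pi))) atTop atBot := by
      apply tendsto_neg_atTop_atBot.comp
      exact tendsto_id.atTop_div_const (by positivity)
    exact this.mono_right atBot_le_cocompact
  have h3 := (Complex.continuous_re.tendsto 0).comp (hrl.comp hc)
  simp only [Complex.zero_re] at h3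
  refine h3.congr fun y => ?_
  simp only [Function.comp]
  have hcont : ContinuousOn (fun u : ℝ => ((1 - u / R : ℝ) : ℂ) * (cexp (I * (u * y : ℝ)) * G (I * u))) (Set.Icc 0 R) := by
    refine ContinuousOn.mul (by fun_prop) (ContinuousOn.mul (by fun_prop) ?_)
    refine hG.comp (by fun_prop) ?_
    intro ε hε; simp
  have hint : Integrable (fun u : ℝ => ((1 - u / R : ℝ) : ℂ) * (cexp (I * (u * y : ℝ)) * G (I * u))) (volume.restrict (Set.Ioc 0 R)) :=
    (hcont.integrableOn_compact isCompact_Icc).mono_set Set.Ioc_subset_Icc_self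
  have h4 := integral_re hint
  simp only [RCLike.re_eq_complex_re, Complex.re_ofReal_mul] at h4
  rw [intervalIntegral.integral_of_le hR.le, h4]
  congr 1
  rw [← integral_indicator measurableSet_Ioc]
  congr 1
  funext u
  by_cases hu : u ∈ Set.Ioc 0 R
  · simp only [h, Set.indicator_of_mem hu]
    rw [Circle.smul_def, Real.fourierChar_apply, smul_eq_mul, ← mul_assoc, mul_comm (cexp _), mul_assoc]
    congr 3
    have : (Real.pi : ℂ) ≠ 0 := by exact_mod_cast Real.pi_ne_zero
    push_cast
    field_simp
  · simp only [h, Set.indicator_of_notMem hu, smul_zero]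
end NQ

namespace NQ
open MeasureTheory Filter Topology

/-- abstract Tauberian step -/
lemma taub_step (g : ℝ → ℝ) (hgm : Measurable g) (hgb : ∀ t, |g t| ≤ 6)
    (hlim : ∀ R : ℝ, 0 < R → Tendsto (fun y : ℝ => ∫ t in Set.Ioi (0:ℝ), g t * fK R (y - t)) atTop (𝓝 0))
    {η d : ℝ} (hη : 0 < η) (hd : 0 < d) :
    ∀ᶠ y in atTop, ¬ (∀ t, |t - y| ≤ d → η ≤ g t) := by
  -- choose R
  set R : ℝ := 600 / (η * d) + 1 / d + 1 with hRdef
  have hR : 0 < R := by positivity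
  have hRd : 1 ≤ R * d := by
    have : R * d = 600 / η + 1 + d := by rw [hRdef]; field_simp
    rw [this]; have : 0 < 600 / η := by positivity
    linarith
  have hRη : 600 ≤ R * (η * d) := by
    have : R * (η * d) = 600 + η + η * d := by rw [hRdef]; field_simp
    rw [this]; nlinarith [mul_pos hη hd]
  have hev := (hlim R hR).eventually (gt_mem_nhds (show (0:ℝ) < η / 10 by positivity))
  filter_upwards [hev, eventually_ge_atTop (1 / R)] with y hy hyR hall
  -- pointwise lower bound
  let φ1 : ℝ → ℝ := (Set.Ioc (y - 1 / R) (y + 1 / R)).indicator (fun _ => η * (R / 5))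
  let φ2 : ℝ → ℝ := fun t => (24 / (R * d ^ 2)) * (1 + ((t - y) / d) ^ 2)⁻¹
  have i1 : Integrable φ1 := by
    apply IntegrableOn.integrable_indicator _ measurableSet_Ioc
    exact integrableOn_const (by simp)
  have hbase : Integrable (fun t : ℝ => (1 + ((t - y) / d) ^ 2)⁻¹) := by
    have := (integrable_inv_one_add_sq.comp_div hd.ne').comp_sub_right y
    exact this
  have i2 : Integrable φ2 := hbase.const_mul _
  have i3 : Integrable (fun t => g t * fK R (y - t)) := by
    refine (fK_integrable hR y).bdd_mul (c := 6) hgm.aestronglyMeasurable ?_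
    exact Eventually.of_forall fun t => hgb t
  have hpt : ∀ t, φ1 t - φ2 t ≤ g t * fK R (y - t) := by
    intro t
    have hK0 := fK_nonneg hR (y - t)
    have hφ2 : 0 ≤ φ2 t := by positivity
    by_cases ht : |t - y| ≤ d
    · have hg := hall t ht
      have : φ1 t ≤ η * fK R (y - t) := by
        by_cases h1 : t ∈ Set.Ioc (y - 1 / R) (y + 1 / R)
        · simp only [φ1, Set.indicator_of_mem h1]
          have : R / 5 ≤ fK R (y - t) := by
            apply fK_ge hR
            rw [abs_mul, abs_of_pos hR, ← le_div_iff₀' hR, abs_le]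
            constructor <;> linarith [h1.1, h1.2]
          gcongr
        · simp only [φ1, Set.indicator_of_notMem h1]; positivity
      nlinarith [mul_le_mul_of_nonneg_right hg hK0]
    · push Not at ht
      have h1 : t ∉ Set.Ioc (y - 1 / R) (y + 1 / R) := by
        intro h
        have h1R : 1 / R ≤ d := by rw [div_le_iff₀ hR]; linarith
        have : |t - y| ≤ 1 / R := by rw [abs_le]; constructor <;> linarith [h.1, h.2]
        linarith
      have e1 : φ1 t = 0 := by simp only [φ1, Set.indicator_of_notMem h1]
      have hk2 := fK_le2 hR (y - t)
      have hsq : d ^ 2 < (t - y) ^ 2 := by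
        rw [← sq_abs (t - y)]; gcongr
      have hpos : 0 < (t - y) ^ 2 := lt_trans (by positivity) hsq
      have hφ : 12 / (R * (t - y) ^ 2) ≤ φ2 t := by
        simp only [φ2]
        rw [← div_eq_mul_inv, div_div, div_le_div_iff₀ (by positivity) (by positivity)]
        have : R * d ^ 2 * (1 + ((t - y) / d) ^ 2) = R * (d ^ 2 + (t - y) ^ 2) := by field_simp
        rw [this]; nlinarith
      have hk3 : fK R (y - t) ≤ 2 / (R * (t - y) ^ 2) := by
        rw [le_div_iff₀ (by positivity)]; rw [show (t - y) ^ 2 = (y - t) ^ 2 by ring]; exact hk2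
      have hg6 := (abs_le.mp (hgb t)).1
      have : -6 * fK R (y - t) ≤ g t * fK R (y - t) := mul_le_mul_of_nonneg_right hg6 hK0
      have : 6 * (2 / (R * (t - y) ^ 2)) = 12 / (R * (t - y) ^ 2) := by ring
      rw [e1]; linarith
  have hint : ∫ t in Set.Ioi (0:ℝ), (φ1 t - φ2 t) ≤ ∫ t in Set.Ioi (0:ℝ), g t * fK R (y - t) :=
    setIntegral_mono (i1.sub i2).integrableOn i3.integrableOn hpt
  rw [integral_sub i1.integrableOn i2.integrableOn] at hint
  have v1 : ∫ t in Set.Ioi (0:ℝ), φ1 t = 2 / 5 * η := by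
    simp only [φ1]
    rw [setIntegral_indicator measurableSet_Ioc]
    have : Set.Ioi (0:ℝ) ∩ Set.Ioc (y - 1 / R) (y + 1 / R) = Set.Ioc (y - 1 / R) (y + 1 / R) := by
      apply Set.inter_eq_right.mpr
      intro t ht
      have := ht.1
      simp only [Set.mem_Ioi]; linarith
    rw [this, setIntegral_const, Real.volume_real_Ioc_of_le (by have : 0 < 1 / R := by positivity
                                                                linarith)]
    rw [smul_eq_mul]; field_simp; ring
  have v2 : ∫ t in Set.Ioi (0:ℝ), φ2 t ≤ 96 / (R * d) := by
    have a1 : ∫ t in Set.Ioi (0:ℝ), φ2 t ≤ ∫ t, φ2 t := by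
      apply setIntegral_le_integral i2
      exact Eventually.of_forall fun t => by simp only [φ2, Pi.zero_apply]; positivity
    refine a1.trans ?_
    simp only [φ2]
    rw [integral_const_mul]
    have : ∫ t : ℝ, (1 + ((t - y) / d) ^ 2)⁻¹ = d * Real.pi := by
      rw [integral_sub_right_eq_self (fun t : ℝ => (1 + (t / d) ^ 2)⁻¹) y]
      rw [Measure.integral_comp_div (fun t : ℝ => (1 + t ^ 2)⁻¹) d, integral_univ_inv_one_add_sq,
        abs_of_pos hd, smul_eq_mul]
    rw [this]
    have : 24 / (R * d ^ 2) * (d * Real.pi) = 24 * Real.pi / (R * d) := by field_simp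
    rw [this]
    gcongr
    linarith [Real.pi_le_four]
  have v3 : 96 / (R * d) ≤ 0.16 * η := by
    rw [div_le_iff₀ (by positivity)]; nlinarith
  rw [v1] at hint
  linarith

lemma fP_of_pos {t : ℝ} (ht : 0 < t) : fP t = Chebyshev.psi (Real.exp t) * Real.exp (-t) - 1 := by
  unfold fP; rw [Set.indicator_of_mem (by simpa using ht)]

lemma fP_tendsto : Tendsto fP atTop (𝓝 0) := by
  rw [Metric.tendsto_nhds]
  -- upper and lower
  have key : ∀ η : ℝ, 0 < η → η < 1 → ∀ᶠ t in atTop, |fP t| < η := by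
    intro η hη hη1
    obtain ⟨d, hd, hd1, hd2⟩ : ∃ d : ℝ, 0 < d ∧ 1 + η / 2 ≤ (1 + η) * Real.exp (-(2 * d)) ∧
        (1 - η) * Real.exp (2 * d) ≤ 1 - η / 2 := by
      have c1 : Tendsto (fun d : ℝ => (1 + η) * Real.exp (-(2 * d))) (𝓝[>] 0) (𝓝 (1 + η)) := by
        have : Continuous fun d : ℝ => (1 + η) * Real.exp (-(2 * d)) := by fun_prop
        simpa using (this.tendsto 0).mono_left (nhdsWithin_le_nhds (s := Set.Ioi 0))
      have c2 : Tendsto (fun d : ℝ => (1 - η) * Real.exp (2 * d)) (𝓝[>] 0) (𝓝 (1 - η)) := by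
        have : Continuous fun d : ℝ => (1 - η) * Real.exp (2 * d) := by fun_prop
        simpa using (this.tendsto 0).mono_left (nhdsWithin_le_nhds (s := Set.Ioi 0))
      have e1 := c1.eventually (lt_mem_nhds (show 1 + η / 2 < 1 + η by linarith))
      have e2 := c2.eventually (gt_mem_nhds (show 1 - η < 1 - η / 2 by linarith))
      obtain ⟨d, h1, h2, h3⟩ := (e1.and (e2.and self_mem_nhdsWithin)).exists
      exact ⟨d, h3, h1.le, h2.le⟩
    have s1 := taub_step fP fP_meas fP_bound (fun R hR => fejer_lim hR) (half_pos hη) hd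
    have s2 := taub_step (fun t => - fP t) fP_meas.neg (fun t => by rw [abs_neg]; exact fP_bound t)
      (fun R hR => by
        have := (fejer_lim hR).neg
        rw [neg_zero] at this
        refine this.congr fun y => ?_
        rw [← integral_neg]; congr 1; funext t; ring) (half_pos hη) hd
    have s1' := (tendsto_atTop_add_const_right atTop d tendsto_id).eventually s1
    have s2' := (tendsto_atTop_add_const_right atTop (-d) tendsto_id).eventually s2
    filter_upwards [s1', s2', eventually_gt_atTop (2 * d)] with y h1 h2 hy
    simp only [id] at h1 h2
    have hy0 : 0 < y := by linarith
    rw [abs_lt]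
    constructor
    · by_contra hcon
      push Not at hcon
      apply h2
      intro t ht
      rw [abs_le] at ht
      have ht0 : 0 < t := by linarith
      have hm := Chebyshev.psi_mono (Real.exp_le_exp.mpr (show t ≤ y by linarith))
      rw [fP_of_pos hy0] at hcon
      rw [fP_of_pos ht0]
      have e : Chebyshev.psi (Real.exp y) * Real.exp (-y) ≤ 1 - η := by linarith
      have : Chebyshev.psi (Real.exp t) * Real.exp (-t) ≤ (1 - η) * Real.exp (2 * d) := by
        calc Chebyshev.psi (Real.exp t) * Real.exp (-t) ≤ Chebyshev.psi (Real.exp y) * Real.exp (-y + 2 * d) := by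
              have := Chebyshev.psi_nonneg (Real.exp y)
              gcongr; linarith
          _ = Chebyshev.psi (Real.exp y) * Real.exp (-y) * Real.exp (2 * d) := by rw [Real.exp_add]; ring
          _ ≤ _ := by gcongr
      linarith
    · by_contra hcon
      push Not at hcon
      apply h1
      intro t ht
      rw [abs_le] at ht
      have ht0 : 0 < t := by linarith
      have hm := Chebyshev.psi_mono (Real.exp_le_exp.mpr (show y ≤ t by linarith))
      rw [fP_of_pos hy0] at hcon
      rw [fP_of_pos ht0]
      have e : 1 + η ≤ Chebyshev.psi (Real.exp y) * Real.exp (-y) := by linarith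
      have : (1 + η) * Real.exp (-(2 * d)) ≤ Chebyshev.psi (Real.exp t) * Real.exp (-t) := by
        calc (1 + η) * Real.exp (-(2 * d)) ≤ Chebyshev.psi (Real.exp y) * Real.exp (-y) * Real.exp (-(2 * d)) := by gcongr
          _ = Chebyshev.psi (Real.exp y) * Real.exp (-y + -(2 * d)) := by rw [Real.exp_add]; ring
          _ ≤ _ := by
              have := Chebyshev.psi_nonneg (Real.exp y)
              gcongr; linarith
      linarith
  intro ε hε
  have := key (min ε (1/2)) (by positivity) (lt_of_le_of_lt (min_le_right _ _) (by norm_num))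
  filter_upwards [this] with t ht
  rw [Real.dist_eq, sub_zero]
  exact lt_of_lt_of_le ht (min_le_left _ _)

theorem pnt_psi : Tendsto (fun x : ℝ => Chebyshev.psi x / x) atTop (𝓝 1) := by
  have h := (fP_tendsto.comp Real.tendsto_log_atTop).add_const 1
  rw [zero_add] at h
  refine h.congr' ?_
  filter_upwards [eventually_gt_atTop 1] with x hx
  have hx0 : 0 < x := by linarith
  simp only [Function.comp]
  rw [fP_of_pos (Real.log_pos hx), Real.exp_log hx0, Real.exp_neg, Real.exp_log hx0]
  rw [sub_add_cancel, div_eq_mul_inv]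

theorem pnt_theta : Tendsto (fun x : ℝ => Chebyshev.theta x / x) atTop (𝓝 1) := by
  have h1 : Tendsto (fun x : ℝ => (Chebyshev.psi x - Chebyshev.theta x) / x) atTop (𝓝 0) := by
    have h := Chebyshev.isBigO_psi_sub_theta_sqrt
    have h2 : (fun x : ℝ => Real.sqrt x) =o[atTop] fun x => x := by
      rw [Asymptotics.isLittleO_iff_tendsto' (by
        filter_upwards [eventually_gt_atTop 0] with x hx h; linarith)]
      have := (tendsto_inv_atTop_zero.comp Real.tendsto_sqrt_atTop)
      refine this.congr fun x => ?_
      simp only [Function.comp]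
      rw [Real.sqrt_div_self', one_div]
    exact (h.trans_isLittleO h2).tendsto_div_nhds_zero
  have := pnt_psi.sub h1
  rw [sub_zero] at this
  refine this.congr fun x => ?_
  ring
end NQ

namespace NQ
open Polynomial Finset

/-- the parameters 9, 11, 13 -/
def aa : Fin 3 → ℕ := ![9, 11, 13]

noncomputable def idx (n : ℕ) : Finset ((_ : Fin 3) × ℤ) :=
  Finset.univ.sigma (fun i => Finset.Ico (-((aa i * n : ℕ) : ℤ)) ((aa i * n : ℕ) : ℤ))

/-- numerator polynomial -/
noncomputable def WP (n : ℕ) : ℤ[X] := ∏ e ∈ idx n, (X - C e.2)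

def gain (n p : ℕ) : Prop := p ≤ 22 * n ∧ ∃ i j : Fin 3, Odd (2 * aa i * n / p + 2 * aa j * n / p) ∧
  (2 * aa i * n / p + 2 * aa j * n / p + 1) * p ≤ 2 * (aa i + aa j) * n

open Classical in
noncomputable def gainSet (n : ℕ) : Finset ℕ := (Nat.primesLE (22 * n)).filter (gain n)

noncomputable def PiN (n : ℕ) : ℕ := ∏ p ∈ gainSet n, p

noncomputable def DD (n : ℕ) : ℕ := Nat.lcmUpto (26 * n) * (Nat.lcmUpto (22 * n) / PiN n)

lemma mem_gainSet {n p : ℕ} : p ∈ gainSet n ↔ p.Prime ∧ gain n p := by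
  classical
  unfold gainSet
  rw [Finset.mem_filter, Nat.mem_primesLE]
  constructor
  · rintro ⟨⟨h1, h2⟩, h3⟩; exact ⟨h2, h3⟩
  · rintro ⟨h2, h3⟩; exact ⟨⟨h3.1, h2⟩, h3⟩

lemma PiN_dvd (n : ℕ) : PiN n ∣ Nat.lcmUpto (22 * n) := by
  apply Finset.prod_primes_dvd
  · intro p hp; exact (mem_gainSet.mp hp).1.prime
  · intro p hp
    have h := mem_gainSet.mp hp
    rw [Nat.lcmUpto]
    exact Finset.dvd_lcm (f := id) (Finset.mem_Icc.mpr ⟨h.1.one_lt.le, h.2.1⟩)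

lemma PiN_ne (n : ℕ) : PiN n ≠ 0 := by
  unfold PiN; rw [Finset.prod_ne_zero_iff]
  intro p hp; exact (mem_gainSet.mp hp).1.ne_zero

lemma DD_mul (n : ℕ) : DD n * PiN n = Nat.lcmUpto (26 * n) * Nat.lcmUpto (22 * n) := by
  rw [DD, mul_assoc, Nat.div_mul_cancel (PiN_dvd n)]

lemma DD_ne (n : ℕ) : DD n ≠ 0 := by
  intro h
  have := DD_mul n
  rw [h, zero_mul] at this
  exact mul_ne_zero (Nat.lcmUpto_ne_zero _) (Nat.lcmUpto_ne_zero _) this.symm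

open Classical in
lemma PiN_fact (n : ℕ) {p : ℕ} (hp : p.Prime) :
    (PiN n).factorization p = if gain n p then 1 else 0 := by
  unfold PiN
  rw [Nat.factorization_prod (fun q hq => (mem_gainSet.mp hq).1.ne_zero)]
  rw [Finsupp.finsetSum_apply]
  have : ∀ q ∈ gainSet n, q.factorization p = if q = p then 1 else 0 := by
    intro q hq
    rw [(mem_gainSet.mp hq).1.factorization]
    simp [Finsupp.single_apply]
  rw [Finset.sum_congr rfl this, Finset.sum_ite_eq']
  simp [mem_gainSet, hp]

open Classical in
lemma DD_fact (n : ℕ) {p : ℕ} (hp : p.Prime) :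
    (DD n).factorization p + (if gain n p then 1 else 0) = p.log (26 * n) + p.log (22 * n) := by
  have h := congrArg (fun m => m.factorization p) (DD_mul n)
  simp only [Nat.factorization_mul (DD_ne n) (PiN_ne n),
    Nat.factorization_mul (Nat.lcmUpto_ne_zero _) (Nat.lcmUpto_ne_zero _), Finsupp.add_apply,
    Nat.factorization_lcmUpto _ hp, PiN_fact n hp] at h
  exact h

lemma log_card {p m b : ℕ} (hp : 1 < p) (hb : p.log m < b) :
    p.log m = ∑ l ∈ Ico 1 b, (if p ^ l ≤ m then 1 else 0) := by
  rw [← Finset.card_filter]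
  have : (Ico 1 b).filter (fun l => p ^ l ≤ m) = Ico 1 (p.log m + 1) := by
    ext l
    simp only [mem_filter, mem_Ico]
    constructor
    · rintro ⟨⟨h1, h2⟩, h3⟩
      exact ⟨h1, Nat.lt_succ_of_le (Nat.le_log_of_pow_le hp h3)⟩
    · rintro ⟨h1, h2⟩
      refine ⟨⟨h1, by omega⟩, ?_⟩
      have hm : m ≠ 0 := by rintro rfl; simp at h2; omega
      exact Nat.pow_le_of_le_log hm (by omega)
  rw [this]; simp

/-- number of multiples in a block -/
lemma block_card (N : ℕ) (t : ℤ) {q : ℕ} (hq : 0 < q) :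
    ((((Finset.Ico (-(N:ℤ)) (N:ℤ)).filter (fun k => (q:ℤ) ∣ t - k)).card : ℕ) : ℤ)
      = (t + N) / q - (t - N) / q := by
  have h1 : ((Finset.Ico (-(N:ℤ)) (N:ℤ)).filter (fun k => (q:ℤ) ∣ t - k)).card
      = ((Finset.Ioc (t - N) (t + N)).filter (fun x => (q:ℤ) ∣ x)).card := by
    apply Finset.card_bij (fun k _ => t - k)
    · intro k hk; simp only [mem_filter, mem_Ico, mem_Ioc] at hk ⊢
      exact ⟨⟨by omega, by omega⟩, hk.2⟩
    · intro k _ k' _ h; omega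
    · intro x hx; simp only [mem_filter, mem_Ioc] at hx
      exact ⟨t - x, by simp only [mem_filter, mem_Ico]; exact ⟨⟨by omega, by omega⟩, by simpa using hx.2⟩, by ring⟩
  have hq' : (0:ℤ) < q := by exact_mod_cast hq
  rw [h1, Int.Ioc_filter_dvd_card _ _ hq']
  have e1 : ∀ z : ℤ, ⌊((z : ℤ) : ℚ) / ((q : ℤ) : ℚ)⌋ = z / q := by
    intro z; exact_mod_cast Rat.floor_intCast_div_natCast z q
  rw [e1, e1, max_eq_left]
  have := Int.ediv_le_ediv hq' (show t - N ≤ t + N by omega)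
  omega

lemma block_ge (N : ℕ) (t : ℤ) {q : ℕ} (hq : 0 < q) :
    ((2 * N / q : ℕ) : ℤ) ≤ (t + N) / q - (t - N) / q := by
  have hq' : (0:ℤ) < q := by exact_mod_cast hq
  push_cast
  rw [le_sub_iff_add_le, Int.le_ediv_iff_mul_le hq', add_mul]
  have h1 := Int.ediv_mul_le (2 * (N:ℤ)) hq'.ne'
  have h2 := Int.ediv_mul_le (t - (N:ℤ)) hq'.ne'
  linarith

/-- gain lemma -/
lemma gain_ge (M N : ℕ) (t : ℤ) {q : ℕ} (hq : 0 < q) (hodd : Odd (2 * M / q + 2 * N / q))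
    (hc : (2 * M / q + 2 * N / q + 1) * q ≤ 2 * (M + N)) :
    ((2 * M / q : ℕ) : ℤ) + ((2 * N / q : ℕ) : ℤ) + 1 ≤
      ((t + M) / q - (t - M) / q) + ((t + N) / q - (t - N) / q) := by
  have hM := block_ge M t hq
  have hN := block_ge N t hq
  by_contra hlt
  push Not at hlt
  obtain ⟨m, hm⟩ := hodd
  have hq' : (0:ℤ) < q := by exact_mod_cast hq
  generalize 2 * M / q = S at *
  generalize 2 * N / q = T at *
  have a1 := Int.ediv_mul_le (t + M) hq'.ne'
  have a2 := Int.lt_ediv_add_one_mul_self (t + M) hq'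
  have b1 := Int.ediv_mul_le (t - M) hq'.ne'
  have a3 := Int.ediv_mul_le (t - N) hq'.ne'
  have a4 := Int.lt_ediv_add_one_mul_self (t + N) hq'
  generalize (t + M) / (q:ℤ) = A at *
  generalize (t - M) / (q:ℤ) = A' at *
  generalize (t + N) / (q:ℤ) = B at *
  generalize (t - N) / (q:ℤ) = B' at *
  have e1 : A - A' = S := by omega
  have e2 : B - B' = T := by omega
  have c1 : (M:ℤ) + N < (B + 1 - A') * q := by nlinarith
  have c2 : (M:ℤ) + N < (A + 1 - B') * q := by nlinarith
  have hsum : (B + 1 - A') + (A + 1 - B') = 2 * m + 3 := by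
    have : (S:ℤ) + T = 2 * m + 1 := by exact_mod_cast hm
    omega
  have hc' : (2 * (m:ℤ) + 2) * q ≤ 2 * (M + N) := by
    rw [hm] at hc
    have : ((2 * m + 1 + 1 : ℕ) : ℤ) * q ≤ 2 * ((M:ℤ) + N) := by exact_mod_cast hc
    push_cast at this; linarith
  rcases le_or_gt (B + 1 - A') (m + 1) with h | h
  · have : (B + 1 - A') * q ≤ (m + 1) * q := mul_le_mul_of_nonneg_right h hq'.le
    linarith
  · have h' : A + 1 - B' ≤ m + 1 := by omega
    have : (A + 1 - B') * q ≤ (m + 1) * q := mul_le_mul_of_nonneg_right h' hq'.le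
    linarith

lemma idx_filter_card (n : ℕ) (t : ℤ) {q : ℕ} (hq : 0 < q) :
    (((idx n).filter (fun e => (q:ℤ) ∣ t - e.2)).card : ℤ) =
     ∑ i : Fin 3, ((t + (aa i * n : ℕ)) / q - (t - (aa i * n : ℕ)) / q) := by
  have : (idx n).filter (fun e => (q:ℤ) ∣ t - e.2) = Finset.univ.sigma (fun i => 
     (Finset.Ico (-((aa i * n : ℕ) : ℤ)) ((aa i * n : ℕ) : ℤ)).filter (fun k => (q:ℤ) ∣ t - k)) := by
    ext ⟨i, k⟩; simp [idx]
  rw [this, Finset.card_sigma]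
  push_cast
  refine Finset.sum_congr rfl fun i _ => ?_
  have := block_card (aa i * n) t hq
  push_cast at this
  exact this

open Classical in
lemma level_ineq (n : ℕ) (t : ℤ) {p l : ℕ} (hp : p.Prime) (hl : 1 ≤ l)
    (u : Finset ((_ : Fin 3) × ℤ)) (hu : u ⊆ idx n) (hc : (idx n).card ≤ u.card + 2) :
    (∑ i : Fin 3, 2 * (aa i * n) / p ^ l) + (if l = 1 ∧ gain n p then 1 else 0) ≤
      (if p ^ l ≤ 26 * n then 1 else 0) + (if p ^ l ≤ 22 * n then 1 else 0) +
      (u.filter (fun e => ((p ^ l : ℕ) : ℤ) ∣ t - e.2)).card := by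
  have hq : 0 < p ^ l := pow_pos hp.pos l
  have hcard := idx_filter_card n t hq
  have hsub : ((idx n).filter (fun e => ((p ^ l : ℕ) : ℤ) ∣ t - e.2)).card ≤
      (u.filter (fun e => ((p ^ l : ℕ) : ℤ) ∣ t - e.2)).card + 2 := by
    have h1 : (idx n).filter (fun e => ((p ^ l : ℕ) : ℤ) ∣ t - e.2) ⊆
       u.filter (fun e => ((p ^ l : ℕ) : ℤ) ∣ t - e.2) ∪ (idx n \ u) := by
      intro e he
      simp only [mem_filter, mem_union, mem_sdiff] at he ⊢
      tauto
    have h2 := Finset.card_le_card h1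
    have h3 := Finset.card_union_le (u.filter (fun e => ((p ^ l : ℕ) : ℤ) ∣ t - e.2)) (idx n \ u)
    have h4 := Finset.card_sdiff_of_subset hu
    omega
  have hb0 := block_ge (aa 0 * n) t hq
  have hb1 := block_ge (aa 1 * n) t hq
  have hb2 := block_ge (aa 2 * n) t hq
  rw [Fin.sum_univ_three] at hcard ⊢
  have v0 : aa 0 = 9 := rfl
  have v1 : aa 1 = 11 := rfl
  have v2 : aa 2 = 13 := rfl
  by_cases hg : l = 1 ∧ gain n p
  · obtain ⟨rfl, hg1, i, j, hodd, hle⟩ := hg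
    have hgain : gain n p := ⟨hg1, i, j, hodd, hle⟩
    rw [pow_one] at *
    have hij := gain_ge (aa i * n) (aa j * n) t hp.pos (by rw [← mul_assoc, ← mul_assoc]; exact hodd)
      (by rw [← mul_assoc, ← mul_assoc]; linarith)
    rw [if_pos ⟨rfl, hgain⟩, if_pos hg1, if_pos (by omega)]
    have hne : i ≠ j := by
      rintro rfl
      rw [← two_mul] at hodd
      exact (Nat.not_odd_iff_even.mpr (even_two_mul _)) hodd
    have : ((2 * (aa 0 * n) / p : ℕ) : ℤ) + (2 * (aa 1 * n) / p : ℕ) + (2 * (aa 2 * n) / p : ℕ) + 1 ≤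
      ((t + (aa 0 * n : ℕ)) / p - (t - (aa 0 * n : ℕ)) / p) +
      ((t + (aa 1 * n : ℕ)) / p - (t - (aa 1 * n : ℕ)) / p) +
      ((t + (aa 2 * n : ℕ)) / p - (t - (aa 2 * n : ℕ)) / p) := by
      fin_cases i <;> fin_cases j <;> first | (exact absurd rfl hne) | (simp only [Fin.zero_eta, Fin.mk_one, Fin.reduceFinMk] at hij; linarith)
    omega
  · rw [if_neg hg]
    by_cases h22 : p ^ l ≤ 22 * n
    · rw [if_pos h22, if_pos (by omega)]
      omega
    · rw [if_neg h22]
      have z0 : 2 * (aa 0 * n) / p ^ l = 0 := Nat.div_eq_of_lt (by rw [v0]; omega)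
      have z1 : 2 * (aa 1 * n) / p ^ l = 0 := Nat.div_eq_of_lt (by rw [v1]; omega)
      by_cases h26 : p ^ l ≤ 26 * n
      · rw [if_pos h26]
        have : 2 * (aa 2 * n) / p ^ l < 2 := by
          rw [Nat.div_lt_iff_lt_mul hq, v2]; omega
        omega
      · rw [if_neg h26]
        have z2 : 2 * (aa 2 * n) / p ^ l = 0 := Nat.div_eq_of_lt (by rw [v2]; omega)
        omega

lemma prod_dvd (n : ℕ) (t : ℤ) (u : Finset ((_ : Fin 3) × ℤ)) (hu : u ⊆ idx n)
    (hc : (idx n).card ≤ u.card + 2) :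
    ((∏ i : Fin 3, (2 * (aa i * n)).factorial : ℕ) : ℤ) ∣ (DD n : ℤ) * ∏ e ∈ u, (t - e.2) := by
  classical
  by_cases h0 : ∏ e ∈ u, (t - e.2) = 0
  · rw [h0, mul_zero]; exact dvd_zero _
  have h0' : ∀ e ∈ u, t - e.2 ≠ 0 := by
    intro e he h; exact h0 (Finset.prod_eq_zero he h)
  have habs : ∀ e ∈ u, (t - e.2).natAbs ≠ 0 := fun e he => Int.natAbs_ne_zero.mpr (h0' e he)
  rw [Int.natCast_dvd, Int.natAbs_mul, Int.natAbs_natCast,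
    show (∏ e ∈ u, (t - e.2)).natAbs = ∏ e ∈ u, (t - e.2).natAbs from map_prod Int.natAbsHom _ _]
  rw [← Nat.factorization_prime_le_iff_dvd
    (Finset.prod_ne_zero_iff.mpr fun i _ => Nat.factorial_ne_zero _)
    (mul_ne_zero (DD_ne n) (Finset.prod_ne_zero_iff.mpr habs))]
  intro p hp
  rw [Nat.factorization_mul (DD_ne n) (Finset.prod_ne_zero_iff.mpr habs),
    Nat.factorization_prod (fun i _ => Nat.factorial_ne_zero _), Nat.factorization_prod habs]
  simp only [Finsupp.add_apply, Finsupp.finsetSum_apply]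
  -- choose b
  obtain ⟨b, hb1, hb2, hb3⟩ : ∃ b : ℕ, 1 < b ∧ 26 * n + 1 < b ∧ ∀ e ∈ u, (t - e.2).natAbs < b := by
    refine ⟨26 * n + 2 + ∑ e ∈ u, (t - e.2).natAbs + 1, by omega, by omega, fun e he => ?_⟩
    have := Finset.single_le_sum (f := fun e => (t - e.2).natAbs) (fun _ _ => Nat.zero_le _) he
    omega
  have hlt : ∀ m, m < b → m < p ^ b := fun m hm => lt_trans hm (Nat.lt_pow_self hp.one_lt)
  have hlog : ∀ m, m < b → p.log m < b := fun m hm => lt_of_le_of_lt (Nat.log_le_self p m) hm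
  have ai : ∀ i : Fin 3, aa i ≤ 13 := by intro i; fin_cases i <;> simp [aa]
  have e1 : ∑ i : Fin 3, (2 * (aa i * n)).factorial.factorization p =
      ∑ l ∈ Ico 1 b, ∑ i : Fin 3, 2 * (aa i * n) / p ^ l := by
    rw [Finset.sum_comm]
    refine Finset.sum_congr rfl fun i _ => Nat.factorization_factorial hp (hlog _ ?_)
    have := Nat.mul_le_mul_right n (ai i)
    omega
  have e2 : ∑ e ∈ u, (t - e.2).natAbs.factorization p =
      ∑ l ∈ Ico 1 b, (u.filter (fun e => ((p ^ l : ℕ) : ℤ) ∣ t - e.2)).card := by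
    simp_rw [Finset.card_filter]
    rw [Finset.sum_comm]
    refine Finset.sum_congr rfl fun e he => ?_
    rw [Nat.factorization_eq_card_pow_dvd_of_lt hp (Nat.pos_of_ne_zero (habs e he)) (hlt _ (hb3 e he)),
      Finset.card_filter]
    refine Finset.sum_congr rfl fun l _ => ?_
    simp only [Int.natCast_dvd]
  have e3 := DD_fact n hp
  rw [log_card hp.one_lt (hlog (26 * n) (by omega)), log_card hp.one_lt (hlog (22 * n) (by omega))] at e3
  have e4 : (if gain n p then 1 else 0) = ∑ l ∈ Ico 1 b, (if l = 1 ∧ gain n p then 1 else 0) := by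
    rw [Finset.sum_eq_single_of_mem 1 (by simp [hb1])]
    · simp
    · intro l _ hl; simp [hl]
  have hs := Finset.sum_le_sum (s := Ico 1 b) (fun l hl => level_ineq n t hp (Finset.mem_Ico.mp hl).1 u hu hc)
  simp only [Finset.sum_add_distrib] at hs
  rw [e1, e2]
  omega

lemma card_idx (n : ℕ) : (idx n).card = 66 * n := by
  unfold idx
  rw [Finset.card_sigma, Fin.sum_univ_three]
  simp [aa]; omega

lemma WP_taylor (n : ℕ) (t : ℤ) : taylor t (WP n) = ∏ e ∈ idx n, (X + C (t - e.2)) := by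
  unfold WP
  rw [← taylorAlgHom_apply, map_prod]
  refine Finset.prod_congr rfl fun e _ => ?_
  rw [taylorAlgHom_apply, map_sub, taylor_X, taylor_C, C_sub]; ring

lemma WP_coeff_dvd (n : ℕ) (t : ℤ) {j : ℕ} (hj : j ≤ 2) :
    ((∏ i : Fin 3, (2 * (aa i * n)).factorial : ℕ) : ℤ) ∣ (DD n : ℤ) * (taylor t (WP n)).coeff j := by
  rw [WP_taylor]
  by_cases hjc : j ≤ (idx n).card
  · rw [Finset.prod_X_add_C_coeff _ _ hjc, Finset.mul_sum]
    refine Finset.dvd_sum fun u hu => ?_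
    rw [Finset.mem_powersetCard] at hu
    exact prod_dvd n t u hu.1 (by omega)
  · have : n = 0 := by rw [card_idx] at hjc; omega
    subst this
    simp

/-- the integrality statement for the numerator times an integer polynomial -/
lemma WPM_dvd (n : ℕ) (M : ℤ[X]) (t : ℤ) {j : ℕ} (hj : j ≤ 2) :
    ((∏ i : Fin 3, (2 * (aa i * n)).factorial : ℕ) : ℤ) ∣ (DD n : ℤ) * (hasseDeriv j (WP n * M)).eval t := by
  rw [← taylor_coeff, taylor_mul, coeff_mul, Finset.mul_sum]
  refine Finset.dvd_sum fun ⟨a, b⟩ hab => ?_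
  have : a ≤ 2 := by have := Finset.HasAntidiagonal.mem_antidiagonal.mp hab; simp at this; omega
  rw [← mul_assoc]
  exact Dvd.dvd.mul_right (WP_coeff_dvd n t this) _
end NQ

namespace NQ
open Finset Filter Topology

def tu : Fin 24 → ℕ := ![1, 1, 1, 2, 1, 3, 4, 1, 4, 2, 4, 5, 1, 6, 7, 8, 7, 2, 7, 8, 4, 9, 9, 10]
def tv : Fin 24 → ℕ := ![12, 11, 6, 11, 4, 11, 13, 3, 11, 5, 9, 11, 2, 11, 12, 13, 11, 3, 10, 11, 5, 11, 10, 11]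
def tu2 : Fin 24 → ℕ := ![1, 1, 2, 2, 3, 4, 1, 4, 5, 4, 5, 6, 6, 5, 8, 7, 2, 9, 8, 10, 9, 11, 10, 12]
def tv2 : Fin 24 → ℕ := ![11, 9, 11, 9, 11, 13, 3, 11, 13, 9, 11, 13, 11, 9, 13, 11, 3, 13, 11, 13, 11, 13, 11, 13]
def ti : Fin 24 → Fin 3 := ![1, 0, 1, 0, 1, 0, 0, 1, 0, 0, 1, 0, 0, 0, 1, 0, 0, 1, 0, 0, 0, 0, 0, 0]
def tj : Fin 24 → Fin 3 := ![2, 2, 2, 2, 2, 2, 1, 2, 2, 1, 2, 2, 1, 2, 2, 1, 2, 2, 1, 2, 1, 2, 1, 2]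
def tf : Fin 24 → ℕ := ![0, 0, 1, 1, 2, 2, 2, 3, 3, 3, 4, 4, 4, 4, 6, 5, 5, 7, 6, 6, 7, 7, 8, 8]
def tg : Fin 24 → ℕ := ![1, 1, 2, 2, 3, 3, 3, 4, 4, 4, 5, 5, 5, 7, 7, 6, 8, 8, 7, 9, 8, 10, 9, 11]

lemma table_ok : ∀ l : Fin 24, 0 < tv l ∧ 0 < tv2 l ∧ 0 < tu l ∧ tu l * tv2 l < tu2 l * tv l ∧ tu2 l < tv2 l ∧
    Odd (tf l + tg l) ∧ tf l * tv l ≤ aa (ti l) * tu l ∧ tg l * tv l ≤ aa (tj l) * tu l ∧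
    aa (ti l) * tu2 l ≤ (tf l + 1) * tv2 l ∧ aa (tj l) * tu2 l ≤ (tg l + 1) * tv2 l ∧
    (tf l + tg l + 1) * tv l ≤ (aa (ti l) + aa (tj l)) * tu l := by decide

lemma table_sorted : ∀ l l' : Fin 24, l < l' → tu2 l * tv l' ≤ tu l' * tv2 l := by decide

lemma table_k0 : ∀ l : Fin 24, l ≠ 0 → tv l ≤ 11 * tu l := by decide

lemma aa_odd : ∀ i, Odd (aa i) := by decide

lemma gain_row {n p k : ℕ} (hp : 0 < p) (l : Fin 24) (h0 : k = 0 → l ≠ 0)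
    (h1 : p * (k * tv l + tu l) ≤ 2 * n * tv l) (h2 : 2 * n * tv2 l < p * (k * tv2 l + tu2 l)) :
    gain n p := by
  obtain ⟨q1, q2, q3, -, -, q4, q5, q6, q7, q8, q9⟩ := table_ok l
  have hkp : k * p ≤ 2 * n := by
    apply Nat.le_of_mul_le_mul_right _ q1
    nlinarith
  obtain ⟨r, hr⟩ := Nat.exists_eq_add_of_le hkp
  have hr1 : p * tu l ≤ r * tv l := by rw [hr] at h1; nlinarith
  have hr2 : r * tv2 l < p * tu2 l := by rw [hr] at h2; nlinarith
  have hdiv : ∀ a f : ℕ, 0 < a → f * tv l ≤ a * tu l → a * tu2 l ≤ (f + 1) * tv2 l → 2 * a * n / p = a * k + f := by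
    intro a f ha hf1 hf2
    have e : 2 * a * n = a * k * p + a * r := by
      have : 2 * a * n = a * (2 * n) := by ring
      rw [this, hr]; ring
    rw [e, add_comm, Nat.add_mul_div_right _ _ hp, add_comm]
    congr 1
    apply Nat.div_eq_of_lt_le
    · apply Nat.le_of_mul_le_mul_right _ q1
      calc f * p * tv l = (f * tv l) * p := by ring
        _ ≤ (a * tu l) * p := Nat.mul_le_mul_right p hf1
        _ = a * (p * tu l) := by ring
        _ ≤ a * (r * tv l) := Nat.mul_le_mul_left a hr1
        _ = _ := by ring
    · apply Nat.lt_of_mul_lt_mul_right (a := tv2 l)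
      calc a * r * tv2 l = a * (r * tv2 l) := by ring
        _ < a * (p * tu2 l) := Nat.mul_lt_mul_of_pos_left hr2 ha
        _ = (a * tu2 l) * p := by ring
        _ ≤ ((f + 1) * tv2 l) * p := Nat.mul_le_mul_right p hf2
        _ = _ := by ring
  have hpos : ∀ i, 0 < aa i := by decide
  refine ⟨?_, ti l, tj l, ?_, ?_⟩
  · rcases Nat.eq_zero_or_pos k with hk | hk
    · have h11 := table_k0 l (h0 hk)
      subst hk
      apply Nat.le_of_mul_le_mul_right _ q1
      calc p * tv l ≤ p * (11 * tu l) := Nat.mul_le_mul_left p h11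
        _ = 11 * (p * tu l) := by ring
        _ ≤ 11 * (2 * n * tv l) := by rw [zero_mul, zero_add] at h1; exact Nat.mul_le_mul_left 11 h1
        _ = _ := by ring
    · have : p ≤ k * p := Nat.le_mul_of_pos_left p hk
      omega
  · rw [hdiv _ _ (hpos _) q5 q7, hdiv _ _ (hpos _) q6 q8]
    have e1 := aa_odd (ti l)
    have e2 := aa_odd (tj l)
    have : aa (ti l) * k + tf l + (aa (tj l) * k + tg l) = (aa (ti l) + aa (tj l)) * k + (tf l + tg l) := by ring
    rw [this]
    exact ((e1.add_odd e2).mul_right k).add_odd q4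
  · rw [hdiv _ _ (hpos _) q5 q7, hdiv _ _ (hpos _) q6 q8]
    have : 2 * (aa (ti l) + aa (tj l)) * n = (aa (ti l) + aa (tj l)) * (k * p + r) := by rw [← hr]; ring
    rw [this]
    have h3 : (tf l + tg l + 1) * p ≤ (aa (ti l) + aa (tj l)) * r := by
      apply Nat.le_of_mul_le_mul_right _ q1
      calc (tf l + tg l + 1) * p * tv l = ((tf l + tg l + 1) * tv l) * p := by ring
        _ ≤ ((aa (ti l) + aa (tj l)) * tu l) * p := Nat.mul_le_mul_right p q9
        _ = (aa (ti l) + aa (tj l)) * (p * tu l) := by ring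
        _ ≤ (aa (ti l) + aa (tj l)) * (r * tv l) := Nat.mul_le_mul_left _ hr1
        _ = _ := by ring
    nlinarith

/-- lower endpoint -/
noncomputable def lo (x : ℕ × Fin 24) : ℝ := x.1 + (tu x.2 : ℝ) / tv x.2
noncomputable def hi (x : ℕ × Fin 24) : ℝ := x.1 + (tu2 x.2 : ℝ) / tv2 x.2

lemma lo_pos (x : ℕ × Fin 24) : 0 < lo x := by
  have h := table_ok x.2
  have h1 : (0:ℝ) < tu x.2 := by exact_mod_cast h.2.2.1
  have h2 : (0:ℝ) < tv x.2 := by exact_mod_cast h.1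
  unfold lo; positivity

lemma lo_lt_hi (x : ℕ × Fin 24) : lo x < hi x := by
  have h := table_ok x.2
  have h2 : (0:ℝ) < tv x.2 := by exact_mod_cast h.1
  have h3 : (0:ℝ) < tv2 x.2 := by exact_mod_cast h.2.1
  have h4 : (tu x.2 : ℝ) * tv2 x.2 < tu2 x.2 * tv x.2 := by exact_mod_cast h.2.2.2.1
  unfold lo hi
  have : (tu x.2 : ℝ) / tv x.2 < tu2 x.2 / tv2 x.2 := by
    rw [div_lt_div_iff₀ h2 h3]; exact h4
  linarith

lemma hi_pos (x : ℕ × Fin 24) : 0 < hi x := (lo_pos x).trans (lo_lt_hi x)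

lemma hi_le (x : ℕ × Fin 24) : hi x < x.1 + 1 := by
  have h := table_ok x.2
  have h3 : (0:ℝ) < tv2 x.2 := by exact_mod_cast h.2.1
  have h4 : (tu2 x.2 : ℝ) < tv2 x.2 := by exact_mod_cast h.2.2.2.2.1
  unfold hi
  have : (tu2 x.2 : ℝ) / tv2 x.2 < 1 := by rw [div_lt_one h3]; exact h4
  linarith

lemma le_lo (x : ℕ × Fin 24) : (x.1 : ℝ) ≤ lo x := by
  unfold lo
  have : (0:ℝ) ≤ (tu x.2 : ℝ) / tv x.2 := by positivity
  linarith

lemma hi_le_lo {x y : ℕ × Fin 24} (h : x.1 < y.1 ∨ (x.1 = y.1 ∧ x.2 < y.2)) : hi x ≤ lo y := by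
  rcases h with h | ⟨h1, h2⟩
  · have a := hi_le x
    have b := le_lo y
    have : (x.1 : ℝ) + 1 ≤ y.1 := by exact_mod_cast h
    linarith
  · have hs := table_sorted _ _ h2
    have h := table_ok x.2
    have h' := table_ok y.2
    have h2 : (0:ℝ) < tv y.2 := by exact_mod_cast h'.1
    have h3 : (0:ℝ) < tv2 x.2 := by exact_mod_cast h.2.1
    have h4 : (tu2 x.2 : ℝ) * tv y.2 ≤ tu y.2 * tv2 x.2 := by exact_mod_cast hs
    unfold lo hi
    rw [h1]
    have : (tu2 x.2 : ℝ) / tv2 x.2 ≤ tu y.2 / tv y.2 := by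
      rw [div_le_div_iff₀ h3 h2]; exact h4
    linarith

open Classical in
/-- the primes in an interval -/
noncomputable def Pk (n : ℕ) (x : ℕ × Fin 24) : Finset ℕ :=
  (gainSet n).filter (fun p => lo x * p ≤ 2 * n ∧ (2 * n : ℝ) < hi x * p)

noncomputable def JK (K : ℕ) : Finset (ℕ × Fin 24) :=
  ((range (K + 1)) ×ˢ Finset.univ).filter (fun x => x ≠ (0, 0))

lemma Pk_disj (n : ℕ) (s : Set (ℕ × Fin 24)) : s.PairwiseDisjoint (Pk n) := by
  intro x _ y _ hxy
  rw [Function.onFun, Finset.disjoint_left]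
  intro p hp hp'
  have h := (Finset.mem_filter.mp hp).2
  have h' := (Finset.mem_filter.mp hp').2
  have key : ∀ x y : ℕ × Fin 24, (x.1 < y.1 ∨ (x.1 = y.1 ∧ x.2 < y.2)) →
     (2 * n : ℝ) < hi x * p → lo y * p ≤ 2 * n → False := by
    intro x y hh a b
    have := mul_le_mul_of_nonneg_right (hi_le_lo hh) (Nat.cast_nonneg (α := ℝ) p)
    linarith
  rcases lt_trichotomy x.1 y.1 with h1 | h1 | h1
  · exact key x y (Or.inl h1) h.2 h'.1
  · rcases lt_trichotomy x.2 y.2 with h2 | h2 | h2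
    · exact key x y (Or.inr ⟨h1, h2⟩) h.2 h'.1
    · exact hxy (Prod.ext h1 h2)
    · exact key y x (Or.inr ⟨h1.symm, h2⟩) h'.2 h.1
  · exact key y x (Or.inl h1) h'.2 h.1

lemma theta_Pk (n : ℕ) (x : ℕ × Fin 24) (hx : x ≠ (0, 0)) :
    Chebyshev.theta (2 * n / lo x) - Chebyshev.theta (2 * n / hi x) ≤ ∑ p ∈ Pk n x, Real.log p := by
  classical
  rw [sub_le_iff_le_add, Chebyshev.theta_eq_sum_primesLE, Chebyshev.theta_eq_sum_primesLE]
  have hsub : Nat.primesLE ⌊2 * n / lo x⌋₊ ⊆ Pk n x ∪ Nat.primesLE ⌊2 * n / hi x⌋₊ := by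
    intro p hp
    rw [Nat.mem_primesLE] at hp
    rw [Finset.mem_union]
    by_cases h : p ≤ ⌊2 * n / hi x⌋₊
    · right; rw [Nat.mem_primesLE]; exact ⟨h, hp.2⟩
    · left
      push Not at h
      have hp0 : (0:ℝ) < p := by exact_mod_cast hp.2.pos
      have h1 : lo x * p ≤ 2 * n := by
        have := (Nat.le_floor_iff' hp.2.ne_zero).mp hp.1
        rw [le_div_iff₀ (lo_pos x)] at this
        linarith
      have h2 : (2 * n : ℝ) < hi x * p := by
        have := (Nat.floor_lt (by have := hi_pos x; positivity)).mp h
        rw [div_lt_iff₀ (hi_pos x)] at this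
        linarith
      refine Finset.mem_filter.mpr ⟨mem_gainSet.mpr ⟨hp.2, ?_⟩, h1, h2⟩
      have ht := table_ok x.2
      have g2 : (0:ℝ) < tv x.2 := by exact_mod_cast ht.1
      have g3 : (0:ℝ) < tv2 x.2 := by exact_mod_cast ht.2.1
      apply gain_row (k := x.1) hp.2.pos x.2
      · intro hk hl; exact hx (Prod.ext hk hl)
      · have : lo x * p * tv x.2 ≤ 2 * n * tv x.2 := mul_le_mul_of_nonneg_right h1 g2.le
        have e : lo x * p * tv x.2 = p * (x.1 * tv x.2 + tu x.2) := by unfold lo; field_simp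
        rw [e] at this
        exact_mod_cast this
      · have : 2 * n * tv2 x.2 < hi x * p * tv2 x.2 := mul_lt_mul_of_pos_right h2 g3
        have e : hi x * p * tv2 x.2 = p * (x.1 * tv2 x.2 + tu2 x.2) := by unfold hi; field_simp
        rw [e] at this
        exact_mod_cast this
  refine (Finset.sum_le_sum_of_subset_of_nonneg hsub ?_).trans ?_
  · intro p _ _; exact Real.log_natCast_nonneg p
  · have := Finset.sum_union_inter (s₁ := Pk n x) (s₂ := Nat.primesLE ⌊2 * n / hi x⌋₊) (f := fun p : ℕ => Real.log p)
    have h0 : 0 ≤ ∑ p ∈ Pk n x ∩ Nat.primesLE ⌊2 * n / hi x⌋₊, Real.log (p:ℝ) :=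
      Finset.sum_nonneg fun p _ => Real.log_natCast_nonneg p
    linarith

lemma log_PiN_ge (n K : ℕ) : ∑ x ∈ JK K, (Chebyshev.theta (2 * n / lo x) - Chebyshev.theta (2 * n / hi x))
    ≤ Real.log (PiN n) := by
  classical
  have h1 : ∑ x ∈ JK K, (Chebyshev.theta (2 * n / lo x) - Chebyshev.theta (2 * n / hi x)) ≤
      ∑ x ∈ JK K, ∑ p ∈ Pk n x, Real.log (p:ℝ) :=
    Finset.sum_le_sum fun x hx => theta_Pk n x (Finset.mem_filter.mp hx).2
  refine h1.trans ?_
  rw [← Finset.sum_biUnion (Pk_disj n _), PiN, Nat.cast_prod, Real.log_prod (fun p hp => by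
    exact_mod_cast (mem_gainSet.mp hp).1.ne_zero)]
  refine Finset.sum_le_sum_of_subset_of_nonneg ?_ fun p _ _ => Real.log_natCast_nonneg p
  intro p hp
  obtain ⟨x, _, hx⟩ := Finset.mem_biUnion.mp hp
  exact (Finset.mem_filter.mp hx).1

noncomputable def SK (K : ℕ) : ℝ := ∑ x ∈ JK K, (1 / lo x - 1 / hi x)

lemma tendsto_comp_nat {f : ℝ → ℝ} (hf : Tendsto (fun x => f x / x) atTop (𝓝 1)) {c : ℝ} (hc : 0 < c) :
    Tendsto (fun n : ℕ => f (c * n) / n) atTop (𝓝 c) := by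
  have h1 : Tendsto (fun n : ℕ => c * (n:ℝ)) atTop atTop :=
    tendsto_natCast_atTop_atTop.const_mul_atTop hc
  have := (hf.comp h1).const_mul c
  rw [mul_one] at this
  refine this.congr fun n => ?_
  simp only [Function.comp]
  rcases Nat.eq_zero_or_pos n with h | h
  · subst h; simp
  · have : (n:ℝ) ≠ 0 := by positivity
    field_simp

lemma log_DD_lim (K : ℕ) : ∀ G : ℝ, 48 - 2 * SK K < G → ∀ᶠ n : ℕ in atTop, Real.log (DD n) ≤ G * n := by
  intro G hG
  have t1 := tendsto_comp_nat pnt_psi (show (0:ℝ) < 26 by norm_num)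
  have t2 := tendsto_comp_nat pnt_psi (show (0:ℝ) < 22 by norm_num)
  have t3 : Tendsto (fun n : ℕ => ∑ x ∈ JK K, (Chebyshev.theta (2 / lo x * n) / n - Chebyshev.theta (2 / hi x * n) / n))
     atTop (𝓝 (∑ x ∈ JK K, (2 / lo x - 2 / hi x))) := by
    refine tendsto_finset_sum _ fun x _ => ?_
    exact (tendsto_comp_nat pnt_theta (div_pos two_pos (lo_pos x))).sub
      (tendsto_comp_nat pnt_theta (div_pos two_pos (hi_pos x)))
  have t4 := (t1.add t2).sub t3
  have e : ∑ x ∈ JK K, (2 / lo x - 2 / hi x) = 2 * SK K := by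
    unfold SK; rw [Finset.mul_sum]; refine Finset.sum_congr rfl fun x _ => by ring
  rw [e] at t4
  filter_upwards [t4.eventually (gt_mem_nhds (show (26:ℝ) + 22 - 2 * SK K < G by linarith)),
    eventually_gt_atTop 0] with n hn hn0
  have hn' : (0:ℝ) < n := by exact_mod_cast hn0
  have h1 := log_PiN_ge n K
  have h2 := congrArg (fun m : ℕ => Real.log (m:ℝ)) (DD_mul n)
  simp only [Nat.cast_mul] at h2
  rw [Real.log_mul (by exact_mod_cast DD_ne n) (by exact_mod_cast PiN_ne n),
    Real.log_mul (by exact_mod_cast Nat.lcmUpto_ne_zero _) (by exact_mod_cast Nat.lcmUpto_ne_zero _),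
    ← Chebyshev.psi_eq_log_lcmUpto, ← Chebyshev.psi_eq_log_lcmUpto] at h2
  push_cast at h2
  have h3 : ∑ x ∈ JK K, (Chebyshev.theta (2 / lo x * n) / n - Chebyshev.theta (2 / hi x * n) / n) * n
     = ∑ x ∈ JK K, (Chebyshev.theta (2 * n / lo x) - Chebyshev.theta (2 * n / hi x)) := by
    refine Finset.sum_congr rfl fun x _ => ?_
    rw [sub_mul, div_mul_cancel₀ _ hn'.ne', div_mul_cancel₀ _ hn'.ne', div_mul_eq_mul_div, div_mul_eq_mul_div]
  rw [← Finset.sum_mul] at h3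
  have h4 := mul_lt_mul_of_pos_right hn hn'
  rw [sub_mul, add_mul, div_mul_cancel₀ _ hn'.ne', div_mul_cancel₀ _ hn'.ne', h3] at h4
  linarith
end NQ

namespace NQ
open Finset Filter Topology

def fl (x : ℕ × Fin 24) : ℕ := 10^12 * (tv x.2 * tu2 x.2 - tv2 x.2 * tu x.2) /
  ((x.1 * tv x.2 + tu x.2) * (x.1 * tv2 x.2 + tu2 x.2))

lemma fl_le (x : ℕ × Fin 24) : (fl x : ℝ) / 10^12 ≤ 1 / lo x - 1 / hi x := by
  obtain ⟨q1, q2, q3, q4, -⟩ := table_ok x.2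
  have h1 : (0:ℝ) < tv x.2 := by exact_mod_cast q1
  have h2 : (0:ℝ) < tv2 x.2 := by exact_mod_cast q2
  have h3 : (0:ℝ) < tu x.2 := by exact_mod_cast q3
  have h5 : 0 < tu2 x.2 := by
    rcases Nat.eq_zero_or_pos (tu2 x.2) with h | h
    · rw [h] at q4; omega
    · exact h
  have h5' : (0:ℝ) < tu2 x.2 := by exact_mod_cast h5
  have e1 : lo x = (x.1 * tv x.2 + tu x.2) / tv x.2 := by unfold lo; field_simp
  have e2 : hi x = (x.1 * tv2 x.2 + tu2 x.2) / tv2 x.2 := by unfold hi; field_simp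
  have hk : (0:ℝ) ≤ x.1 := Nat.cast_nonneg _
  have p1 : (0:ℝ) < x.1 * tv x.2 + tu x.2 := by positivity
  have p2 : (0:ℝ) < x.1 * tv2 x.2 + tu2 x.2 := by positivity
  have e3 : 1 / lo x - 1 / hi x = ((tv x.2 : ℝ) * tu2 x.2 - tv2 x.2 * tu x.2) /
     ((x.1 * tv x.2 + tu x.2) * (x.1 * tv2 x.2 + tu2 x.2)) := by
    rw [e1, e2, one_div_div, one_div_div, div_sub_div _ _ p1.ne' p2.ne']
    congr 1; ring
  rw [e3, div_le_div_iff₀ (by positivity) (by positivity)]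
  have := Nat.div_mul_le_self (10^12 * (tv x.2 * tu2 x.2 - tv2 x.2 * tu x.2)) ((x.1 * tv x.2 + tu x.2) * (x.1 * tv2 x.2 + tu2 x.2))
  change fl x * _ ≤ _ at this
  have hc : ((fl x * ((x.1 * tv x.2 + tu x.2) * (x.1 * tv2 x.2 + tu2 x.2)) : ℕ):ℝ) ≤ ((10^12 * (tv x.2 * tu2 x.2 - tv2 x.2 * tu x.2) : ℕ):ℝ) := by
    exact_mod_cast this
  have hle : tv2 x.2 * tu x.2 ≤ tv x.2 * tu2 x.2 := by nlinarith
  push_cast [Nat.cast_sub hle] at hc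
  linarith

lemma head_num : 6465128014969 ≤ ∑ k ∈ range 20, ∑ l : Fin 24, if (k, l) = (0, 0) then 0 else fl (k, l) := by
  decide +kernel

noncomputable def Dl (l : Fin 24) : ℝ := (tu2 l : ℝ) / tv2 l - (tu l : ℝ) / tv l
noncomputable def elq (l : Fin 24) : ℝ := ((tu2 l : ℝ) / tv2 l + (tu l : ℝ) / tv l) / 2 - 0.5004

lemma sum_D : ∑ l, Dl l = 1363 / 2340 := by
  simp only [Fin.sum_univ_succ, Dl, tu, tv, tu2, tv2]
  norm_num [Fin.succ]

lemma sum_De : ∑ l, Dl l * elq l ≤ 0 := by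
  simp only [Fin.sum_univ_succ, Dl, elq, tu, tv, tu2, tv2]
  norm_num [Fin.succ]

lemma row_term (k : ℕ) (l : Fin 24) :
    Dl l * (1 / ((k:ℝ) + 0.5004)^2) - 2 * (Dl l * elq l) / ((k:ℝ) + 0.5004)^3 ≤ 1 / lo (k, l) - 1 / hi (k, l) := by
  have h1 := lo_pos (k, l)
  have h2 := hi_pos (k, l)
  have h3 := lo_lt_hi (k, l)
  have hD : Dl l = hi (k, l) - lo (k, l) := by unfold Dl hi lo; ring
  have he : elq l = (hi (k, l) + lo (k, l)) / 2 - ((k:ℝ) + 0.5004) := by unfold elq hi lo; ring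
  set y : ℝ := (k:ℝ) + 0.5004 with hy
  have hy0 : 0 < y := by positivity
  set a := lo (k, l)
  set b := hi (k, l)
  set e := elq l
  have hb : b = 2 * (y + e) - a := by rw [he]; ring
  have hye : 0 < y + e := by rw [he]; linarith
  have e1 : 1 / a - 1 / b = (b - a) * (1 / (a * b)) := by field_simp
  have e2 : Dl l * (1 / y^2) - 2 * (Dl l * e) / y^3 = (b - a) * ((y - 2 * e) / y^3) := by
    rw [hD]; field_simp
  rw [e1, e2]
  apply mul_le_mul_of_nonneg_left _ (by linarith)
  calc (y - 2 * e) / y^3 ≤ 1 / (y + e)^2 := by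
        rw [div_le_div_iff₀ (by positivity) (by positivity)]
        nlinarith [mul_nonneg (sq_nonneg e) (by linarith : 0 ≤ 2 * (y + e) + y)]
    _ ≤ 1 / (a * b) := by
        apply one_div_le_one_div_of_le (by positivity)
        rw [hb]; nlinarith [sq_nonneg (a - (y + e))]

lemma row_le (k : ℕ) (hk : 20 ≤ k) :
    1363 / 2340 * (1 / ((k:ℝ) + 0.0067) - 1 / (((k+1:ℕ):ℝ) + 0.0067)) ≤ ∑ l, (1 / lo (k, l) - 1 / hi (k, l)) := by
  have h1 : ∑ l, (Dl l * (1 / ((k:ℝ) + 0.5004)^2) - 2 * (Dl l * elq l) / ((k:ℝ) + 0.5004)^3) ≤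
     ∑ l, (1 / lo (k, l) - 1 / hi (k, l)) := sum_le_sum fun l _ => row_term k l
  have h2 : 1363 / 2340 * (1 / ((k:ℝ) + 0.5004)^2) ≤ ∑ l, (Dl l * (1 / ((k:ℝ) + 0.5004)^2) - 2 * (Dl l * elq l) / ((k:ℝ) + 0.5004)^3) := by
    rw [sum_sub_distrib, ← sum_mul, sum_D, ← sum_div, ← mul_sum]
    have : 2 * ∑ l, Dl l * elq l ≤ 0 := by linarith [sum_De]
    have := div_nonpos_of_nonpos_of_nonneg this (by positivity : (0:ℝ) ≤ ((k:ℝ) + 0.5004)^3)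
    linarith
  refine le_trans ?_ (h2.trans h1)
  apply mul_le_mul_of_nonneg_left _ (by norm_num)
  have hk' : (20:ℝ) ≤ k := by exact_mod_cast hk
  push_cast
  rw [div_sub_div _ _ (by positivity) (by positivity), div_le_div_iff₀ (by positivity) (by positivity)]
  nlinarith

lemma SK_rows (K : ℕ) : SK K = ∑ k ∈ range (K + 1), ∑ l, if (k, l) = ((0, 0) : ℕ × Fin 24) then 0 else (1 / lo (k, l) - 1 / hi (k, l)) := by
  unfold SK JK
  rw [sum_filter, sum_product]
  refine sum_congr rfl fun k _ => sum_congr rfl fun l _ => ?_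
  by_cases h : (k, l) = ((0, 0) : ℕ × Fin 24) <;> simp [h]

lemma SK_ge (m : ℕ) : 6.465128014969 + 1363 / 2340 * (1 / (20 + 0.0067) - 1 / (((20 + m : ℕ) : ℝ) + 0.0067)) ≤ SK (19 + m) := by
  rw [SK_rows]
  induction m with
  | zero =>
    have h := head_num
    have h' : ((6465128014969 : ℕ) : ℝ) ≤ ((∑ k ∈ range 20, ∑ l : Fin 24, if (k, l) = (0, 0) then 0 else fl (k, l) : ℕ) : ℝ) := by
      exact_mod_cast h
    have h2 : ((∑ k ∈ range 20, ∑ l : Fin 24, if (k, l) = (0, 0) then 0 else fl (k, l) : ℕ) : ℝ) / 10^12 ≤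
       ∑ k ∈ range (19 + 0 + 1), ∑ l, if (k, l) = ((0, 0) : ℕ × Fin 24) then 0 else (1 / lo (k, l) - 1 / hi (k, l)) := by
      push_cast
      rw [sum_div]
      refine sum_le_sum fun k _ => ?_
      rw [sum_div]
      refine sum_le_sum fun l _ => ?_
      split_ifs
      · simp
      · exact_mod_cast fl_le (k, l)
    have h3 : ((6465128014969 : ℕ) : ℝ) / 10^12 ≤ ((∑ k ∈ range 20, ∑ l : Fin 24, if (k, l) = (0, 0) then 0 else fl (k, l) : ℕ) : ℝ) / 10^12 := by
      gcongr
    have h4 := h3.trans h2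
    refine le_trans (le_of_eq ?_) h4
    norm_num
  | succ m ih =>
    rw [show 19 + (m + 1) = 19 + m + 1 from rfl, sum_range_succ]
    have h1 := row_le (20 + m) (by omega)
    have h2 : ∑ l, (if (19 + m + 1, l) = ((0, 0) : ℕ × Fin 24) then 0 else (1 / lo (19 + m + 1, l) - 1 / hi (19 + m + 1, l)))
      = ∑ l, (1 / lo (20 + m, l) - 1 / hi (20 + m, l)) := by
      have : 19 + m + 1 = 20 + m := by ring
      rw [this]
      refine sum_congr rfl fun l _ => ?_
      rw [if_neg]
      intro h
      have := congrArg Prod.fst h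
      simp at this
    rw [h2]
    have : (20 + (m + 1)) = 20 + m + 1 := by ring
    rw [this]
    linarith

lemma log_DD_le : ∀ᶠ n : ℕ in atTop, Real.log (DD n) ≤ 35.01152 * n := by
  apply log_DD_lim (19 + 10^8)
  have := SK_ge (10^8)
  norm_num at this ⊢
  linarith

end NQ

namespace NQ
open Finset Filter Topology Polynomial

noncomputable def xx : ℝ := (Real.sqrt 17 - 1) / (Real.sqrt 17 + 1)

lemma s17_sq : Real.sqrt 17 * Real.sqrt 17 = 17 := Real.mul_self_sqrt (by norm_num)
lemma s17_gt : 4 < Real.sqrt 17 := by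
  apply Real.lt_sqrt_of_sq_lt; norm_num
lemma s17_lt : Real.sqrt 17 < 5 := by
  rw [Real.sqrt_lt' (by norm_num)]; norm_num
lemma xx_pos : 0 < xx := by
  have := s17_gt; unfold xx; apply div_pos <;> linarith
lemma xx_lt : xx < 1 := by
  have := s17_gt; unfold xx; rw [div_lt_one] <;> linarith
lemma one_sub_xx : 1 - xx = 2 / (Real.sqrt 17 + 1) := by
  have := s17_gt; unfold xx; field_simp; ring
lemma xx_four : xx = 4 * (1 - xx)^2 := by
  have := s17_gt
  rw [one_sub_xx]; unfold xx
  field_simp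
  nlinarith [s17_sq]
lemma xx_s17 : 1 + xx = Real.sqrt 17 * (1 - xx) := by
  have := s17_gt
  rw [one_sub_xx]; unfold xx
  field_simp; ring

lemma hasSum_shift (m k : ℕ) : HasSum (fun t : ℕ => (((t + k).choose (m + k) : ℕ) : ℝ) * xx ^ t)
    (xx ^ m / (1 - xx)^(m + k + 1)) := by
  have h := hasSum_choose_mul_geometric_of_norm_lt_one (𝕜 := ℝ) (m + k) (r := xx)
    (by rw [Real.norm_of_nonneg xx_pos.le]; exact xx_lt)
  have h2 := h.mul_left (xx ^ m)
  rw [← hasSum_nat_add_iff' m]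
  have e1 : (fun t : ℕ => (((t + m + k).choose (m + k) : ℕ) : ℝ) * xx ^ (t + m)) =
      fun i => xx ^ m * (((i + (m + k)).choose (m + k) : ℕ) * xx ^ i) := by
    funext t
    rw [show t + m + k = t + (m + k) by ring, pow_add]; ring
  have e2 : ∑ t ∈ range m, (((t + k).choose (m + k) : ℕ) : ℝ) * xx ^ t = 0 := by
    apply sum_eq_zero
    intro t ht
    rw [Nat.choose_eq_zero_of_lt (by have := mem_range.1 ht; omega)]; simp
  rw [e1, e2, sub_zero, div_eq_mul_one_div]
  exact h2

noncomputable def bm (m : ℕ) : ℝ[X] := ∏ i ∈ range m, ((X - C (i:ℝ)) * (X + C (1 + (i:ℝ))))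

lemma bm_sym (m : ℕ) (t : ℝ) : (bm m).eval (-1 - t) = (bm m).eval t := by
  unfold bm
  rw [eval_prod, eval_prod]
  refine prod_congr rfl fun i _ => ?_
  simp; ring

lemma bm_zero (m t : ℕ) (h : t < m) : (bm m).eval (t:ℝ) = 0 := by
  unfold bm
  rw [eval_prod]
  apply prod_eq_zero (mem_range.2 h)
  simp

lemma bm_deg (m : ℕ) : (bm m).natDegree ≤ 2 * m := by
  unfold bm
  refine (natDegree_prod_le _ _).trans ?_
  refine (sum_le_card_nsmul _ _ 2 ?_).trans ?_
  · intro i _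
    refine natDegree_mul_le.trans ?_
    have h1 := natDegree_X_sub_C_le (R := ℝ) (i:ℝ)
    have h2 : (X + C (1 + (i:ℝ)) : ℝ[X]).natDegree ≤ 1 := (natDegree_X_add_C _).le
    omega
  · simp; omega

lemma bm_eval (m t : ℕ) : (bm m).eval (t:ℝ) = (2*m).factorial * (t + m).choose (2 * m) := by
  have : (bm m).eval (t:ℝ) = ((t + m).descFactorial (2*m) : ℕ) := by
    induction m with
    | zero => simp [bm]
    | succ m ih =>
      have : bm (m+1) = bm m * ((X - C (m:ℝ)) * (X + C (1 + (m:ℝ)))) := by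
        unfold bm; rw [prod_range_succ]
      rw [this, eval_mul, ih, show t + (m + 1) = (t + m) + 1 by ring, show 2 * (m+1) = (2 * m + 1) + 1 by ring,
        Nat.succ_descFactorial_succ, Nat.descFactorial_succ]
      by_cases h : t < m
      · rw [Nat.descFactorial_of_lt (by omega)]; simp
      · have : t + m - 2 * m = t - m := by omega
        rw [this]
        push_cast [Nat.cast_sub (not_lt.1 h)]
        simp; ring
  rw [this, Nat.descFactorial_eq_factorial_mul_choose]; push_cast; ring

/-- even basis -/
noncomputable def be (m : ℕ) : ℝ[X] := C (1 / ((2*m).factorial : ℝ)) * bm m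
/-- odd basis -/
noncomputable def bo (m : ℕ) : ℝ[X] := C (1 / ((2*m+1).factorial : ℝ)) * ((2 * X + 1) * bm m)

lemma be_eval (m t : ℕ) : (be m).eval (t:ℝ) = ((t + m).choose (2 * m) : ℕ) := by
  have : ((2*m).factorial : ℝ) ≠ 0 := by positivity
  rw [be, eval_mul, bm_eval, eval_C]; field_simp

lemma bo_eval (m t : ℕ) : (bo m).eval (t:ℝ) = (((t + m + 1).choose (2 * m + 1) + (t + m).choose (2 * m + 1) : ℕ) : ℝ) := by
  have h : ((2*m+1).factorial : ℝ) ≠ 0 := by positivity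
  rw [bo, eval_mul, eval_mul, bm_eval, eval_C, one_div, inv_mul_eq_iff_eq_mul₀ h]
  rw [Nat.factorial_succ]
  have h1 : (2 * m + 1) * (t + m + 1).choose (2*m+1) = (t + m + 1) * (t + m).choose (2 * m) := by
    have := Nat.add_one_mul_choose_eq (t+m) (2*m); linarith
  have h2 : ((2 * m + 1) * (t + m).choose (2*m+1) : ℝ) = (t - m) * (t + m).choose (2 * m) := by
    by_cases hh : t < m
    · rw [Nat.choose_eq_zero_of_lt (by omega), Nat.choose_eq_zero_of_lt (by omega)]; simp
    · have := Nat.choose_succ_right_eq (t+m) (2*m)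
      rw [show t + m - 2 * m = t - m by omega] at this
      have h3 : (((t + m).choose (2 * m + 1) * (2 * m + 1) : ℕ):ℝ) = (((t + m).choose (2 * m) * (t - m) : ℕ):ℝ) := by exact_mod_cast this
      push_cast [Nat.cast_sub (not_lt.1 hh)] at h3
      linarith
  have h1' : (((2 * m + 1) * (t + m + 1).choose (2*m+1) : ℕ):ℝ) = (((t + m + 1) * (t + m).choose (2 * m) : ℕ):ℝ) := by exact_mod_cast h1
  push_cast at h1' ⊢
  simp
  linear_combination (-((2*m).factorial : ℝ)) * (h1' + h2)

lemma be_sum (m : ℕ) : HasSum (fun t : ℕ => (be m).eval (t:ℝ) * xx ^ t) (4 ^ m * (1 / (1 - xx))) := by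
  have h := hasSum_shift m m
  have hx : (1 - xx) ≠ 0 := by have := xx_lt; linarith
  convert h using 1
  · funext t; rw [be_eval, two_mul]
  · have : xx ^ m = 4^m * (1-xx)^(2*m) := by
      conv_lhs => rw [xx_four]
      rw [mul_pow, pow_mul]
    rw [this, ← two_mul, pow_succ]; field_simp

lemma bo_sum (m : ℕ) : HasSum (fun t : ℕ => (bo m).eval (t:ℝ) * xx ^ t) (4 ^ m * (Real.sqrt 17 / (1 - xx))) := by
  have h := (hasSum_shift m (m+1)).add (hasSum_shift (m+1) m)
  have hx : (1 - xx) ≠ 0 := by have := xx_lt; linarith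
  convert h using 1
  · funext t; rw [bo_eval]
    rw [show m + (m+1) = 2 * m + 1 by ring, show m + 1 + m = 2 * m + 1 by ring, ← add_assoc]
    push_cast; ring
  · have : xx ^ m = 4^m * (1-xx)^(2*m) := by
      conv_lhs => rw [xx_four]
      rw [mul_pow, pow_mul]
    have h2 : Real.sqrt 17 = (1 + xx) / (1 - xx) := by rw [xx_s17]; field_simp
    rw [h2, pow_succ xx m, this]
    rw [show m + (m+1) + 1 = 2 * m + 2 by ring, show m + 1 + m + 1 = 2 * m + 2 by ring, pow_add]
    field_simp

/-- general reduction -/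
lemma sum_form (b : ℕ → ℝ[X]) (ε κ D : ℝ) (hD : D ≠ 0) (e : ℕ)
    (hsym : ∀ m t, (b m).eval (-1 - t) = ε * (b m).eval t)
    (hz : ∀ m t : ℕ, t < m → (b m).eval (t:ℝ) = 0) (h1 : ∀ m : ℕ, (b m).eval (m:ℝ) = 1)
    (hdeg : ∀ m, (b m).natDegree ≤ 2 * m + e)
    (hs : ∀ m, HasSum (fun t : ℕ => (b m).eval (t:ℝ) * xx ^ t) (4 ^ m * κ))
    (hint : ∀ m t : ℕ, ∃ z : ℤ, (b m).eval (t:ℝ) = z)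
    (base : ∀ (m : ℕ) (f : ℝ[X]), f.natDegree < 2 * m + e → (∀ t, f.eval (-1 - t) = ε * f.eval t) →
       (∀ t : ℕ, t < m → f.eval (t:ℝ) = 0) → f = 0) :
    ∀ (d m : ℕ) (f : ℝ[X]), f.natDegree < 2 * (m + d) + e → (∀ t, f.eval (-1 - t) = ε * f.eval t) →
       (∀ t : ℕ, t < m → f.eval (t:ℝ) = 0) → (∀ t : ℕ, ∃ z : ℤ, D * f.eval (t:ℝ) = z) →
       ∃ z : ℤ, HasSum (fun t : ℕ => f.eval (t:ℝ) * xx ^ t) (4 ^ m * z * κ / D) := by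
  intro d
  induction d with
  | zero =>
    intro m f hf1 hf2 hf3 _
    refine ⟨0, ?_⟩
    rw [base m f (by simpa using hf1) hf2 hf3]
    simp
  | succ d ih =>
    intro m f hf1 hf2 hf3 hf4
    obtain ⟨z0, hz0⟩ := hf4 m
    obtain ⟨z, hzs⟩ := ih (m+1) (f - C (f.eval (m:ℝ)) * b m) (by
        refine (natDegree_sub_le _ _).trans_lt ?_
        rw [max_lt_iff]
        refine ⟨by omega, (natDegree_C_mul_le _ _).trans_lt ?_⟩
        have := hdeg m
        omega) (by
        intro t
        simp only [eval_sub, eval_mul, eval_C, hsym, hf2]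
        ring) (by
        intro t ht
        rcases Nat.lt_succ_iff_lt_or_eq.1 ht with h | h
        · simp [hf3 t h, hz m t h]
        · subst h; simp [h1]) (by
        intro t
        obtain ⟨z1, hz1⟩ := hf4 t
        obtain ⟨z2, hz2⟩ := hint m t
        refine ⟨z1 - z0 * z2, ?_⟩
        simp only [eval_sub, eval_mul, eval_C, hz2]
        push_cast
        rw [← hz1, ← hz0]; ring)
    refine ⟨4 * z + z0, ?_⟩
    have := hzs.add ((hs m).mul_left (f.eval (m:ℝ)))
    convert this using 1
    · funext t; simp; ring
    · have : f.eval (m:ℝ) = z0 / D := by rw [← hz0]; field_simp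
      rw [this]; push_cast; field_simp; ring

lemma too_many (f : ℝ[X]) (s : Finset ℝ) (hs : ∀ t ∈ s, f.eval t = 0) (h : f.natDegree < s.card) : f = 0 := by
  exact Polynomial.eq_zero_of_natDegree_lt_card_of_eval_eq_zero' f s hs h

lemma base_even (m : ℕ) (f : ℝ[X]) (hd : f.natDegree < 2 * m) (hsym : ∀ t, f.eval (-1 - t) = f.eval t)
    (hz : ∀ t : ℕ, t < m → f.eval (t:ℝ) = 0) : f = 0 := by
  apply too_many f ((Ico (-(m:ℤ)) m).image (fun z : ℤ => (z:ℝ)))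
  · intro t ht
    obtain ⟨z, hz1, rfl⟩ := mem_image.1 ht
    rw [mem_Ico] at hz1
    rcases le_or_gt 0 z with h | h
    · lift z to ℕ using h
      exact_mod_cast hz z (by omega)
    · have h2 : 0 ≤ -1 - z := by omega
      obtain ⟨k, hk⟩ := Int.eq_ofNat_of_zero_le h2
      have := hz k (by omega)
      rw [← hsym]
      have e : (-1 - (z:ℝ)) = k := by exact_mod_cast hk
      rw [e]; exact this
  · rw [card_image_of_injective _ Int.cast_injective]
    simp; omega

lemma base_odd (m : ℕ) (f : ℝ[X]) (hd : f.natDegree < 2 * m + 1) (hsym : ∀ t, f.eval (-1 - t) = -1 * f.eval t)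
    (hz : ∀ t : ℕ, t < m → f.eval (t:ℝ) = 0) : f = 0 := by
  apply too_many f (insert (-1/2) ((Ico (-(m:ℤ)) m).image (fun z : ℤ => (z:ℝ))))
  · intro t ht
    rcases mem_insert.1 ht with rfl | ht
    · have := hsym (-1/2)
      norm_num at this ⊢
      linarith
    obtain ⟨z, hz1, rfl⟩ := mem_image.1 ht
    rw [mem_Ico] at hz1
    rcases le_or_gt 0 z with h | h
    · lift z to ℕ using h
      exact_mod_cast hz z (by omega)
    · have h2 : 0 ≤ -1 - z := by omega
      obtain ⟨k, hk⟩ := Int.eq_ofNat_of_zero_le h2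
      have := hz k (by omega)
      have e : (-1 - (z:ℝ)) = k := by exact_mod_cast hk
      have h3 := hsym z
      rw [e, this] at h3
      linarith
  · rw [card_insert_of_notMem, card_image_of_injective _ Int.cast_injective]
    · simp; omega
    · intro h
      obtain ⟨z, -, hz⟩ := mem_image.1 h
      have : (2 * z : ℝ) = -1 := by rw [hz]; norm_num
      have : 2 * z = -1 := by exact_mod_cast this
      omega

lemma sum_even (D : ℝ) (hD : D ≠ 0) (m : ℕ) (f : ℝ[X]) (hsym : ∀ t, f.eval (-1 - t) = f.eval t)
    (hz : ∀ t : ℕ, t < m → f.eval (t:ℝ) = 0) (hi : ∀ t : ℕ, ∃ z : ℤ, D * f.eval (t:ℝ) = z) :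
    ∃ z : ℤ, HasSum (fun t : ℕ => f.eval (t:ℝ) * xx ^ t) (4 ^ m * z * (1 / (1 - xx)) / D) := by
  refine sum_form be 1 _ D hD 0 ?_ ?_ ?_ ?_ be_sum ?_ ?_ (f.natDegree + 1) m f (by omega) (by simpa using hsym) hz hi
  · intro m t; simp [be, bm_sym]
  · intro m t h; simp [be, bm_zero m t h]
  · intro m; rw [be_eval, two_mul]; simp
  · intro m; exact (natDegree_C_mul_le _ _).trans (bm_deg m)
  · intro m t; exact ⟨_, by rw [be_eval, ← Int.cast_natCast]⟩
  · intro m f h1 h2 h3; exact base_even m f h1 (by simpa using h2) h3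

lemma sum_odd (D : ℝ) (hD : D ≠ 0) (m : ℕ) (f : ℝ[X]) (hsym : ∀ t, f.eval (-1 - t) = -1 * f.eval t)
    (hz : ∀ t : ℕ, t < m → f.eval (t:ℝ) = 0) (hi : ∀ t : ℕ, ∃ z : ℤ, D * f.eval (t:ℝ) = z) :
    ∃ z : ℤ, HasSum (fun t : ℕ => f.eval (t:ℝ) * xx ^ t) (4 ^ m * z * (Real.sqrt 17 / (1 - xx)) / D) := by
  refine sum_form bo (-1) _ D hD 1 ?_ ?_ ?_ ?_ bo_sum ?_ ?_ (f.natDegree + 1) m f (by omega) hsym hz hi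
  · intro m t; simp [bo, bm_sym]; ring
  · intro m t h; simp [bo, bm_zero m t h]
  · intro m; rw [bo_eval, show m + m + 1 = 2 * m + 1 by ring, show m + m = 2 * m by ring]; simp
  · intro m
    refine (natDegree_C_mul_le _ _).trans (natDegree_mul_le.trans ?_)
    have h1 : (2 * X + 1 : ℝ[X]).natDegree ≤ 1 := by compute_degree
    have := bm_deg m
    omega
  · intro m t; exact ⟨_, by rw [bo_eval, ← Int.cast_natCast]⟩
  · intro m f h1 h2 h3; exact base_odd m f h1 h2 h3

end NQ

namespace NQ
open Finset Filter Topology Polynomial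

noncomputable def Sm (f : ℝ[X]) : ℝ := ∑' t : ℕ, f.eval (t:ℝ) * xx ^ t

noncomputable def WR (n : ℕ) : ℝ[X] := ∏ i : Fin 3, ∏ z ∈ Ico (-((aa i*n:ℕ):ℤ)) ((aa i*n:ℕ):ℤ), (X - C (z:ℝ))

lemma WR_eq (n : ℕ) : WR n = (WP n).map (Int.castRingHom ℝ) := by
  unfold WR WP idx
  rw [prod_sigma, Polynomial.map_prod]
  refine prod_congr rfl fun i _ => ?_
  rw [Polynomial.map_prod]
  refine prod_congr rfl fun z _ => ?_
  simp

lemma WR_sym (n : ℕ) (t : ℝ) : (WR n).eval (-1 - t) = (WR n).eval t := by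
  unfold WR
  rw [eval_prod, eval_prod]
  refine prod_congr rfl fun i _ => ?_
  rw [eval_prod, eval_prod]
  generalize aa i * n = N
  have h1 : ∏ z ∈ Ico (-(N:ℤ)) N, eval (-1 - t) (X - C (z:ℝ)) = ∏ z ∈ Ico (-(N:ℤ)) N, (-1) * eval t (X - C ((-1 - z : ℤ):ℝ)) := by
    refine prod_congr rfl fun z _ => ?_
    simp; ring
  rw [h1, prod_mul_distrib, prod_const, Int.card_Ico]
  have : ((N:ℤ) - -(N:ℤ)).toNat = 2 * N := by omega
  rw [this, pow_mul]
  norm_num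
  refine prod_nbij' (fun z => -1 - z) (fun z => -1 - z) ?_ ?_ ?_ ?_ ?_
  · intro z hz; rw [mem_Ico] at *; omega
  · intro z hz; rw [mem_Ico] at *; omega
  · intro z hz; ring
  · intro z hz; ring
  · intro z hz; push_cast; ring

lemma dvd_VN (N : ℕ) (z : ℤ) (hz : z ∈ Ico (-(N:ℤ)) N) : (X - C (z:ℝ)) ∣ ∏ z ∈ Ico (-(N:ℤ)) N, (X - C (z:ℝ)) :=
  dvd_prod_of_mem _ hz

lemma dvd_WR3 (n : ℕ) (z : ℤ) (hz : z ∈ Ico (-((9*n:ℕ):ℤ)) ((9*n:ℕ):ℤ)) : (X - C (z:ℝ))^3 ∣ WR n := by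
  unfold WR
  rw [Fin.prod_univ_three, pow_succ, pow_two]
  rw [mem_Ico] at hz
  refine mul_dvd_mul (mul_dvd_mul ?_ ?_) ?_ <;> apply dvd_VN <;> simp [aa] <;> push_cast at hz <;> omega

lemma dvd_WR2 (n : ℕ) (z : ℤ) (hz : z ∈ Ico (-((11*n:ℕ):ℤ)) ((11*n:ℕ):ℤ)) : (X - C (z:ℝ))^2 ∣ WR n := by
  unfold WR
  rw [Fin.prod_univ_three, pow_two, mul_assoc]
  rw [mem_Ico] at hz
  refine Dvd.dvd.mul_left (mul_dvd_mul ?_ ?_) _ <;> apply dvd_VN <;> simp [aa] <;> push_cast at hz <;> omega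

lemma dvd_WR1 (n : ℕ) (z : ℤ) (hz : z ∈ Ico (-((13*n:ℕ):ℤ)) ((13*n:ℕ):ℤ)) : (X - C (z:ℝ))^1 ∣ WR n := by
  unfold WR
  rw [Fin.prod_univ_three, pow_one]
  rw [mem_Ico] at hz
  refine Dvd.dvd.mul_left ?_ _
  apply dvd_VN; simp [aa]; push_cast at hz; omega

lemma deriv_zero {f : ℝ[X]} {t : ℝ} {m j : ℕ} (h : (X - C t)^m ∣ f) (hj : j < m) : (derivative^[j] f).eval t = 0 := by
  have := pow_sub_dvd_iterate_derivative_of_pow_dvd j h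
  have h2 : (X - C t) ∣ derivative^[j] f := (dvd_pow_self _ (by omega)).trans this
  rwa [dvd_iff_isRoot] at h2

lemma WR_deg (n : ℕ) : (WR n).natDegree ≤ 66 * n := by
  rw [WR_eq]
  refine (natDegree_map_le).trans ?_
  unfold WP
  refine (natDegree_prod_le _ _).trans ?_
  refine (sum_le_card_nsmul _ _ 1 ?_).trans ?_
  · intro i _; exact natDegree_X_sub_C_le _
  · rw [card_idx]; simp

lemma WR_ne (n : ℕ) : WR n ≠ 0 := by
  unfold WR
  refine prod_ne_zero_iff.2 fun i _ => prod_ne_zero_iff.2 fun z _ => X_sub_C_ne_zero _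

noncomputable def cN (n : ℕ) : ℝ := ((∏ i : Fin 3, (2*(aa i*n)).factorial : ℕ):ℝ)

lemma cN_pos (n : ℕ) : 0 < cN n := by
  unfold cN
  have : 0 < ∏ i : Fin 3, (2*(aa i*n)).factorial := prod_pos fun i _ => Nat.factorial_pos _
  exact_mod_cast this

/-- the basic polynomial R(t)(2t+1)^k -/
noncomputable def fR (n k : ℕ) : ℝ[X] := C (1 / cN n) * (WR n * (2 * X + 1)^k)

lemma fR_sym (n k : ℕ) (t : ℝ) : (fR n k).eval (-1 - t) = (-1)^k * (fR n k).eval t := by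
  unfold fR
  simp only [eval_mul, eval_pow, eval_add, eval_X, eval_one, eval_C, WR_sym, eval_ofNat]
  have : (2 * (-1 - t) + 1) = (-1) * (2 * t + 1) := by ring
  rw [this, mul_pow]; ring

lemma sym_deriv {f : ℝ[X]} {ε : ℝ} (h : ∀ t, f.eval (-1 - t) = ε * f.eval t) (t : ℝ) :
    (derivative f).eval (-1 - t) = (-ε) * (derivative f).eval t := by
  have h1 : f.comp (-1 - X) = C ε * f := by
    apply Polynomial.funext; intro t
    simp [eval_comp, h]
  have h2 := congrArg derivative h1
  rw [derivative_comp] at h2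
  have h3 := congrArg (eval t) h2
  simp [eval_comp] at h3
  linarith

lemma fR_zero (n k t j : ℕ) (ht : t < 9 * n) (hj : j < 3) : (derivative^[j] (fR n k)).eval (t:ℝ) = 0 := by
  have : ((t:ℤ):ℝ) = (t:ℝ) := by simp
  rw [← this]
  refine deriv_zero (m := 3) ?_ hj
  unfold fR
  refine Dvd.dvd.mul_left (Dvd.dvd.mul_right (dvd_WR3 n t ?_) _) _
  rw [mem_Ico]; push_cast; omega

lemma hasseDeriv_map' (j : ℕ) (F : ℤ[X]) : hasseDeriv j (F.map (Int.castRingHom ℝ)) = (hasseDeriv j F).map (Int.castRingHom ℝ) := by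
  ext i
  simp [hasseDeriv_coeff]

lemma fR_int (n k j : ℕ) (t : ℤ) (hj : j ≤ 2) : ∃ z : ℤ, (DD n : ℝ) * (hasseDeriv j (fR n k)).eval (t:ℝ) = z := by
  obtain ⟨z, hz⟩ := WPM_dvd n ((2 * X + 1)^k) t hj
  refine ⟨z, ?_⟩
  have e : fR n k = C (1 / cN n) * (WP n * (2 * X + 1)^k).map (Int.castRingHom ℝ) := by
    unfold fR; rw [WR_eq]; simp [Polynomial.map_mul]
  have e2 : (hasseDeriv j (fR n k)).eval (t:ℝ) = 1 / cN n * ((hasseDeriv j (WP n * (2 * X + 1)^k)).eval t : ℤ) := by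
    rw [e, ← smul_eq_C_mul, map_smul, hasseDeriv_map']
    rw [eval_smul, smul_eq_mul]
    congr 1
    have : (t:ℝ) = Int.castRingHom ℝ t := by simp
    rw [this, eval_map_apply]; simp
  rw [e2]
  have h3 : (DD n : ℝ) * ((hasseDeriv j (WP n * (2 * X + 1)^k)).eval t : ℤ) = cN n * z := by
    unfold cN; exact_mod_cast hz
  have := cN_pos n
  field_simp
  linarith

end NQ

namespace NQ
open Finset Filter Topology Polynomial

lemma half_deriv (f : ℝ[X]) : hasseDeriv 2 f = C (1/2) * derivative^[2] f := by
  have h := congrFun (factorial_smul_hasseDeriv (R := ℝ) 2) f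
  rw [← h]
  ext i
  simp

noncomputable def Lam (n : ℕ) : ℝ := (DD n : ℝ) * (1 - xx) / 4 ^ (9 * n)

lemma sk_case (k : ℕ) : ((-1:ℝ))^k = 1 ∨ ((-1:ℝ))^k = -1 := neg_one_pow_eq_or ℝ k

/-- scalar -/
noncomputable def sk (k : ℕ) : ℝ := if Even k then 1 else 1 / Real.sqrt 17

lemma gen_even (n : ℕ) (f : ℝ[X]) (hsym : ∀ t, f.eval (-1 - t) = f.eval t)
    (hz : ∀ t : ℕ, t < 9 * n → f.eval (t:ℝ) = 0) (hi : ∀ t : ℕ, ∃ z : ℤ, (DD n : ℝ) * f.eval (t:ℝ) = z) :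
    ∃ z : ℤ, Lam n * Sm f = z := by
  have hD : (DD n : ℝ) ≠ 0 := by exact_mod_cast DD_ne n
  obtain ⟨z, h⟩ := sum_even (DD n) hD (9 * n) f hsym hz hi
  refine ⟨z, ?_⟩
  rw [Sm, h.tsum_eq, Lam]
  have : 1 - xx ≠ 0 := by have := xx_lt; linarith
  field_simp

lemma gen_odd (n : ℕ) (f : ℝ[X]) (hsym : ∀ t, f.eval (-1 - t) = -1 * f.eval t)
    (hz : ∀ t : ℕ, t < 9 * n → f.eval (t:ℝ) = 0) (hi : ∀ t : ℕ, ∃ z : ℤ, (DD n : ℝ) * f.eval (t:ℝ) = z) :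
    ∃ z : ℤ, Lam n * Sm f = Real.sqrt 17 * z := by
  have hD : (DD n : ℝ) ≠ 0 := by exact_mod_cast DD_ne n
  obtain ⟨z, h⟩ := sum_odd (DD n) hD (9 * n) f hsym hz hi
  refine ⟨z, ?_⟩
  rw [Sm, h.tsum_eq, Lam]
  have : 1 - xx ≠ 0 := by have := xx_lt; linarith
  field_simp

lemma int_forms (n k : ℕ) : ∃ q p r : ℤ, (q:ℝ) = sk k * Lam n * Sm (fR n k) ∧
    (p:ℝ) = -Real.sqrt 17 * (sk k * Lam n * Sm (derivative (fR n k))) ∧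
    (r:ℝ) = 34 * (sk k * Lam n * Sm (hasseDeriv 2 (fR n k))) := by
  have s1 := fR_sym n k
  have s2 := sym_deriv s1
  have s3 : ∀ t, (hasseDeriv 2 (fR n k)).eval (-1 - t) = (-1)^k * (hasseDeriv 2 (fR n k)).eval t := by
    intro t
    have := sym_deriv s2 t
    rw [half_deriv]
    simp only [eval_mul, eval_C, Function.iterate_succ, Function.iterate_zero, Function.comp_apply, id]
    rw [this]; ring
  have i1 : ∀ t : ℕ, ∃ z : ℤ, (DD n : ℝ) * (fR n k).eval (t:ℝ) = z := fun t => by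
    have := fR_int n k 0 t (by norm_num)
    simpa using this
  have i2 : ∀ t : ℕ, ∃ z : ℤ, (DD n : ℝ) * (derivative (fR n k)).eval (t:ℝ) = z := fun t => by
    have := fR_int n k 1 t (by norm_num)
    simpa [hasseDeriv_one'] using this
  have i3 : ∀ t : ℕ, ∃ z : ℤ, (DD n : ℝ) * (hasseDeriv 2 (fR n k)).eval (t:ℝ) = z := fun t => by
    have := fR_int n k 2 t (by norm_num)
    simpa using this
  have z1 : ∀ t : ℕ, t < 9 * n → (fR n k).eval (t:ℝ) = 0 := fun t ht => fR_zero n k t 0 ht (by norm_num)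
  have z2 : ∀ t : ℕ, t < 9 * n → (derivative (fR n k)).eval (t:ℝ) = 0 := fun t ht => fR_zero n k t 1 ht (by norm_num)
  have z3 : ∀ t : ℕ, t < 9 * n → (hasseDeriv 2 (fR n k)).eval (t:ℝ) = 0 := fun t ht => by
    rw [half_deriv, eval_mul, fR_zero n k t 2 ht (by norm_num), mul_zero]
  have h17 := s17_sq
  have h0 : Real.sqrt 17 ≠ 0 := by have := s17_gt; linarith
  by_cases hk : Even k
  · simp only [hk.neg_one_pow, one_mul] at s1 s2 s3
    obtain ⟨q, hq⟩ := gen_even n _ s1 z1 i1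
    obtain ⟨p, hp⟩ := gen_odd n _ s2 z2 i2
    obtain ⟨r, hr⟩ := gen_even n _ s3 z3 i3
    refine ⟨q, -17 * p, 34 * r, ?_, ?_, ?_⟩
    · simp [sk, hk, hq]
    · simp only [sk, hk, if_true, one_mul, hp]; push_cast
      linear_combination (p:ℝ) * h17
    · simp [sk, hk, hr]
  · have hk' : Odd k := Nat.not_even_iff_odd.1 hk
    simp only [hk'.neg_one_pow, neg_neg, one_mul] at s1 s2 s3
    obtain ⟨q, hq⟩ := gen_odd n _ s1 z1 i1
    obtain ⟨p, hp⟩ := gen_even n _ s2 z2 i2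
    obtain ⟨r, hr⟩ := gen_odd n _ s3 z3 i3
    refine ⟨q, -p, 34 * r, ?_, ?_, ?_⟩
    · simp only [sk, hk, if_false, mul_assoc, hq]; field_simp
    · simp only [sk, hk, if_false, mul_assoc, hp]; push_cast; field_simp
    · simp only [sk, hk, if_false, mul_assoc, hr]; push_cast; field_simp

/-! ### difference operator -/

noncomputable def TT (g : ℝ[X]) : ℝ[X] := C xx * g.comp (X + 1) - g

lemma TT_add (g h : ℝ[X]) : TT (g + h) = TT g + TT h := by unfold TT; simp; ring

lemma TT_deriv (g : ℝ[X]) : derivative (TT g) = TT (derivative g) := by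
  unfold TT; simp [derivative_comp]

lemma TT_eval (g : ℝ[X]) (t : ℝ) : (TT g).eval t = xx * g.eval (t + 1) - g.eval t := by
  unfold TT; simp [eval_comp]

lemma natDegree_comp_X1 (g : ℝ[X]) : (g.comp (X + 1)).natDegree = g.natDegree := by
  rw [natDegree_comp]
  have : (X + 1 : ℝ[X]).natDegree = 1 := by
    rw [← C_1]; exact natDegree_X_add_C _
  rw [this, mul_one]

lemma TT_exists : ∀ (d : ℕ) (f : ℝ[X]), f.natDegree ≤ d → ∃ g, g.natDegree ≤ d ∧ TT g = f := by
  have hx : xx - 1 ≠ 0 := by have := xx_lt; linarith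
  intro d
  induction d with
  | zero =>
    intro f hf
    replace hf := eq_C_of_natDegree_le_zero hf
    refine ⟨C (f.coeff 0 / (xx - 1)), by simp, ?_⟩
    conv_rhs => rw [hf]
    unfold TT; simp only [C_comp]
    rw [← C_mul, ← C_sub]; congr 1; field_simp
  | succ d ih =>
    intro f hf
    set g0 : ℝ[X] := C (f.coeff (d+1) / (xx - 1)) * X^(d+1) with hg0
    have hg0d : g0.natDegree ≤ d + 1 := natDegree_C_mul_X_pow_le _ _
    have hT : (TT g0).natDegree ≤ d + 1 := by
      unfold TT
      refine (natDegree_sub_le _ _).trans (max_le ((natDegree_C_mul_le _ _).trans ?_) hg0d)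
      rw [natDegree_comp_X1]; exact hg0d
    have hc : (TT g0).coeff (d+1) = f.coeff (d+1) := by
      unfold TT
      rw [hg0]
      simp only [mul_comp, C_comp, pow_comp, X_comp, coeff_sub, coeff_C_mul, coeff_X_pow, if_true]
      rw [show (X + 1 : ℝ[X]) = X + C 1 by simp, coeff_X_add_C_pow]
      simp
      field_simp
    obtain ⟨g, hg1, hg2⟩ := ih (f - TT g0) (by
      rw [natDegree_le_iff_coeff_eq_zero]
      intro N hN
      rcases Nat.eq_or_lt_of_le (Nat.succ_le_of_lt hN) with h | h
      · rw [← h]; simp [hc]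
      · rw [coeff_sub, coeff_eq_zero_of_natDegree_lt (hf.trans_lt h), coeff_eq_zero_of_natDegree_lt (hT.trans_lt h), sub_zero])
    refine ⟨g + g0, (natDegree_add_le _ _).trans (max_le (by omega) hg0d), ?_⟩
    rw [TT_add, hg2]; ring

lemma tendsto_poly (g : ℝ[X]) : Tendsto (fun t : ℕ => g.eval (t:ℝ) * xx ^ t) atTop (𝓝 0) := by
  induction g using Polynomial.induction_on' with
  | add p q hp hq =>
    have := hp.add hq
    simp only [eval_add, add_mul]
    simpa using this
  | monomial k a =>
    have := (tendsto_pow_const_mul_const_pow_of_abs_lt_one k (r := xx) (by rw [abs_of_pos xx_pos]; exact xx_lt)).const_mul a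
    simpa [mul_assoc] using this

lemma summable_poly (g : ℝ[X]) : Summable (fun t : ℕ => g.eval (t:ℝ) * xx ^ t) := by
  induction g using Polynomial.induction_on' with
  | add p q hp hq =>
    have := hp.add hq
    simpa only [eval_add, add_mul] using this
  | monomial k a =>
    have := (summable_pow_mul_geometric_of_norm_lt_one k (r := xx) (by rw [Real.norm_of_nonneg xx_pos.le]; exact xx_lt)).mul_left a
    simpa [mul_assoc] using this

lemma Sm_TT (g : ℝ[X]) : Sm (TT g) = - g.eval 0 := by
  have h := (summable_poly (TT g)).hasSum.tendsto_sum_nat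
  have h2 : ∀ n : ℕ, ∑ t ∈ range n, (TT g).eval (t:ℝ) * xx ^ t = g.eval (n:ℝ) * xx ^ n - g.eval 0 := by
    intro n
    have := Finset.sum_range_sub (fun t : ℕ => g.eval (t:ℝ) * xx ^ t) n
    simp only [Nat.cast_zero, pow_zero, mul_one] at this
    rw [← this]
    refine sum_congr rfl fun t _ => ?_
    rw [TT_eval, pow_succ]; push_cast; ring
  simp only [h2] at h
  have h3 := (tendsto_poly g).sub_const (g.eval 0)
  rw [zero_sub] at h3
  exact tendsto_nhds_unique h h3

lemma Sm_add (f g : ℝ[X]) : Sm (f + g) = Sm f + Sm g := by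
  unfold Sm
  rw [← (summable_poly f).tsum_add (summable_poly g)]
  simp only [eval_add, add_mul]

lemma Sm_C_mul (c : ℝ) (f : ℝ[X]) : Sm (C c * f) = c * Sm f := by
  unfold Sm
  rw [← tsum_mul_left]
  simp only [eval_mul, eval_C, mul_assoc]

/-- propagation of zeros -/
lemma prop_zero (g : ℝ[X]) (N : ℕ) (h0 : g.eval 0 = 0) (hf : ∀ z ∈ Ico (-(N:ℤ)) N, (TT g).eval (z:ℝ) = 0) :
    ∀ z ∈ Icc (-(N:ℤ)) N, g.eval (z:ℝ) = 0 := by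
  have hx := xx_pos
  have up : ∀ j : ℕ, j ≤ N → g.eval (j:ℝ) = 0 := by
    intro j
    induction j with
    | zero => intro _; simpa using h0
    | succ j ih =>
      intro hj
      have h1 := hf j (by rw [mem_Ico]; omega)
      rw [TT_eval] at h1
      have h2 := ih (by omega)
      push_cast at h1 ⊢
      rw [h2, sub_zero, mul_eq_zero] at h1
      exact h1.resolve_left hx.ne'
  have dn : ∀ j : ℕ, j ≤ N → g.eval (-(j:ℝ)) = 0 := by
    intro j
    induction j with
    | zero => intro _; simpa using h0
    | succ j ih =>
      intro hj
      have h1 := hf (-((j+1:ℕ):ℤ)) (by rw [mem_Ico]; omega)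
      rw [TT_eval] at h1
      have h2 := ih (by omega)
      push_cast at h1 ⊢
      rw [show -((j:ℝ) + 1) + 1 = -j by ring, h2] at h1
      linarith
  intro z hz
  rw [mem_Icc] at hz
  rcases le_total 0 z with h | h
  · lift z to ℕ using h
    exact_mod_cast up z (by omega)
  · obtain ⟨j, hj⟩ := Int.eq_ofNat_of_zero_le (by omega : 0 ≤ -z)
    have : (z:ℝ) = -(j:ℝ) := by
      have : z = -(j:ℤ) := by omega
      rw [this]; push_cast; ring
    rw [this]; exact dn j (by omega)

lemma nonvanish (n : ℕ) (M : ℝ[X]) (hM : M.natDegree ≤ 2) (h0 : Sm (WR n * M) = 0)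
    (h1 : Sm (derivative (WR n * M)) = 0) (h2 : Sm (derivative^[2] (WR n * M)) = 0) : M = 0 := by
  by_contra hne
  have hfd : (WR n * M).natDegree ≤ 66 * n + 2 := natDegree_mul_le.trans (add_le_add (WR_deg n) hM)
  obtain ⟨g, hgd, hg⟩ := TT_exists _ _ hfd
  have hgne : g ≠ 0 := by
    rintro rfl
    have : TT 0 = 0 := by unfold TT; simp
    rw [this] at hg
    exact (mul_ne_zero (WR_ne n) hne) hg.symm
  rw [← hg] at h0 h1 h2
  have hT2 : derivative^[2] (TT g) = TT (derivative^[2] g) := by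
    simp [TT_deriv]
  rw [Sm_TT, neg_eq_zero] at h0
  rw [TT_deriv, Sm_TT, neg_eq_zero] at h1
  rw [hT2, Sm_TT, neg_eq_zero] at h2
  have a0 := prop_zero g (13 * n) h0 (fun z hz => by
    rw [hg]; exact deriv_zero (j := 0) ((dvd_WR1 n z hz).mul_right M) (by norm_num))
  have a1 := prop_zero (derivative g) (11 * n) h1 (fun z hz => by
    rw [← TT_deriv, hg]; exact deriv_zero (j := 1) ((dvd_WR2 n z hz).mul_right M) (by norm_num))
  have a2 := prop_zero (derivative^[2] g) (9 * n) h2 (fun z hz => by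
    rw [← hT2, hg]; exact deriv_zero (j := 2) ((dvd_WR3 n z hz).mul_right M) (by norm_num))
  have key : ∀ z ∈ Icc (-((13*n:ℕ):ℤ)) ((13*n:ℕ):ℤ),
      1 + (if z ∈ Icc (-((11*n:ℕ):ℤ)) ((11*n:ℕ):ℤ) then 1 else 0) + (if z ∈ Icc (-((9*n:ℕ):ℤ)) ((9*n:ℕ):ℤ) then 1 else 0)
       ≤ g.roots.count (z:ℝ) := by
    intro z hz
    rw [count_roots]
    have b0 := a0 z hz
    split_ifs with c1 c2 c2
    · have := (lt_rootMultiplicity_iff_isRoot_iterate_derivative (n := 2) (t := (z:ℝ)) hgne).2 (by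
        intro m hm
        interval_cases m
        · exact b0
        · exact a1 z c1
        · exact a2 z c2)
      omega
    · have := (lt_rootMultiplicity_iff_isRoot_iterate_derivative (n := 1) (t := (z:ℝ)) hgne).2 (by
        intro m hm
        interval_cases m
        · exact b0
        · exact a1 z c1)
      omega
    · rw [mem_Icc] at c1 c2; omega
    · have := (lt_rootMultiplicity_iff_isRoot_iterate_derivative (n := 0) (t := (z:ℝ)) hgne).2 (by
        intro m hm
        interval_cases m
        · exact b0)
      omega
  have hs := sum_le_sum key
  rw [sum_add_distrib, sum_add_distrib, ← sum_filter, ← sum_filter, ← card_eq_sum_ones, ← card_eq_sum_ones, ← card_eq_sum_ones] at hs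
  have f1 : (Icc (-((13*n:ℕ):ℤ)) ((13*n:ℕ):ℤ)).filter (· ∈ Icc (-((11*n:ℕ):ℤ)) ((11*n:ℕ):ℤ)) = Icc (-((11*n:ℕ):ℤ)) ((11*n:ℕ):ℤ) := by
    ext z; simp only [mem_filter, mem_Icc]; omega
  have f2 : (Icc (-((13*n:ℕ):ℤ)) ((13*n:ℕ):ℤ)).filter (· ∈ Icc (-((9*n:ℕ):ℤ)) ((9*n:ℕ):ℤ)) = Icc (-((9*n:ℕ):ℤ)) ((9*n:ℕ):ℤ) := by
    ext z; simp only [mem_filter, mem_Icc]; omega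
  rw [f1, f2, Int.card_Icc, Int.card_Icc, Int.card_Icc] at hs
  have hle : ∑ z ∈ Icc (-((13*n:ℕ):ℤ)) ((13*n:ℕ):ℤ), g.roots.count (z:ℝ) ≤ g.roots.card := by
    rw [← sum_image (s := Icc (-((13*n:ℕ):ℤ)) ((13*n:ℕ):ℤ)) (g := fun z : ℤ => (z:ℝ)) (f := fun t => g.roots.count t)
      (Int.cast_injective.injOn)]
    calc _ ≤ ∑ t ∈ ((Icc (-((13*n:ℕ):ℤ)) ((13*n:ℕ):ℤ)).image (fun z : ℤ => (z:ℝ))) ∪ g.roots.toFinset, g.roots.count t :=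
          sum_le_sum_of_subset subset_union_left
      _ = g.roots.card := Multiset.sum_count_eq_card (fun a ha => mem_union_right _ (Multiset.mem_toFinset.2 ha))
  have := card_roots' g
  omega

end NQ

namespace NQ
open Finset Filter Topology Polynomial

lemma nonsing (n : ℕ) (u v w : ℝ) (h : ¬ (u = 0 ∧ v = 0 ∧ w = 0)) : ∃ k : Fin 3,
    u * Sm (fR n k) + v * Sm (derivative (fR n k)) + w * Sm (hasseDeriv 2 (fR n k)) ≠ 0 := by
  by_contra hcon
  push Not at hcon
  let Mx : Matrix (Fin 3) (Fin 3) ℝ := fun k => ![Sm (fR n k), Sm (derivative (fR n k)), Sm (hasseDeriv 2 (fR n k))]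
  have h1 : ∃ x : Fin 3 → ℝ, x ≠ 0 ∧ Mx.mulVec x = 0 := by
    refine ⟨![u, v, w], ?_, ?_⟩
    · intro hx
      apply h
      exact ⟨congrFun hx 0, congrFun hx 1, congrFun hx 2⟩
    · funext k
      have := hcon k
      simp only [Matrix.mulVec, dotProduct, Fin.sum_univ_three, Mx, Pi.zero_apply]
      simp
      linarith
  have hdet := Matrix.exists_mulVec_eq_zero_iff.1 h1
  obtain ⟨m, hm0, hm⟩ := Matrix.exists_vecMul_eq_zero_iff.2 hdet
  have e0 := congrFun hm 0
  have e1 := congrFun hm 1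
  have e2 := congrFun hm 2
  simp [Matrix.vecMul, dotProduct, Fin.sum_univ_three, Mx] at e0 e1 e2
  set M : ℝ[X] := C (m 0) + C (m 1) * (2 * X + 1) + C (m 2) * (2 * X + 1)^2 with hMdef
  have hMd : M.natDegree ≤ 2 := by rw [hMdef]; compute_degree
  have hc := cN_pos n
  have hrep : WR n * M = C (cN n) * (C (m 0) * fR n 0 + C (m 1) * fR n 1 + C (m 2) * fR n 2) := by
    have hCC : (C (cN n) * C (1 / cN n) : ℝ[X]) = 1 := by rw [← C_mul, mul_one_div_cancel hc.ne', C_1]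
    unfold fR
    rw [hMdef]
    linear_combination (-(C (m 0) * WR n + C (m 1) * (WR n * (2 * X + 1)) + C (m 2) * (WR n * (2 * X + 1)^2))) * hCC
  have hh : ∀ a b c : ℝ, m 0 * a + m 1 * b + m 2 * c = 0 → cN n * (m 0 * a + m 1 * b + m 2 * c) = 0 := by
    intro a b c h; rw [h, mul_zero]
  have r0 : Sm (WR n * M) = 0 := by
    rw [hrep]; simp only [Sm_C_mul, Sm_add]; exact hh _ _ _ e0
  have r1 : Sm (derivative (WR n * M)) = 0 := by
    rw [hrep]; simp only [derivative_C_mul, derivative_add, Sm_C_mul, Sm_add]; exact hh _ _ _ e1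
  have r2 : Sm (derivative^[2] (WR n * M)) = 0 := by
    have e3 : derivative^[2] (WR n * M) = C 2 * hasseDeriv 2 (WR n * M) := by
      rw [half_deriv, ← mul_assoc, ← C_mul]; norm_num
    rw [e3, hrep]
    simp only [← smul_eq_C_mul, map_smul, map_add]
    simp only [smul_eq_C_mul, Sm_C_mul, Sm_add]
    rw [hh _ _ _ e2, mul_zero]
  have hM0 := nonvanish n M hMd r0 r1 r2
  apply hm0
  have v0 := congrArg (eval (-1/2)) hM0
  have v1 := congrArg (eval 0) hM0
  have v2 := congrArg (eval (-1)) hM0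
  simp [hMdef] at v0 v1 v2
  norm_num at v0 v1 v2
  funext i
  fin_cases i
  · exact v0
  · simp; linarith
  · simp; linarith

end NQ

namespace NQ
open Finset Filter Topology Polynomial

lemma VN_eq (N : ℕ) : ∏ z ∈ Ico (-(N:ℤ)) N, (X - C (z:ℝ)) = bm N := by
  induction N with
  | zero => simp [bm]
  | succ N ih =>
    have : Ico (-((N+1:ℕ):ℤ)) ((N+1:ℕ):ℤ) = insert (N:ℤ) (insert (-((N:ℤ)+1)) (Ico (-(N:ℤ)) N)) := by
      ext z; simp only [mem_insert, mem_Ico]; push_cast; omega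
    rw [this, prod_insert (by simp; omega), prod_insert (by simp), ih]
    unfold bm
    rw [prod_range_succ]
    push_cast
    rw [C_neg, sub_neg_eq_add, add_comm (N:ℝ) 1]
    ring

lemma WR_bm (n : ℕ) : WR n = ∏ i : Fin 3, bm (aa i * n) := by
  unfold WR; exact prod_congr rfl fun i _ => VN_eq _

lemma fR_nat (n k t : ℕ) : (fR n k).eval (t:ℝ) = (∏ i : Fin 3, ((t + aa i * n).choose (2 * (aa i * n)) : ℝ)) * (2 * t + 1)^k := by
  have hc := (cN_pos n).ne'
  unfold fR
  rw [WR_bm]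
  simp only [eval_mul, eval_prod, bm_eval, eval_C, eval_pow, eval_add, eval_ofNat, eval_X, eval_one]
  rw [prod_mul_distrib]
  have : cN n = ∏ i : Fin 3, ((2 * (aa i * n)).factorial : ℝ) := by unfold cN; push_cast; rfl
  rw [← this]; field_simp

noncomputable def ww : Fin 3 → ℝ := ![1.14437675, 1.17933737, 1.21545685]

noncomputable def EQ : ℝ := ∏ i : Fin 3, (ww i)^(aa i) / (ww i - 1)^(2 * aa i)

lemma ww_gt (i : Fin 3) : 1 < ww i := by fin_cases i <;> norm_num [ww]

lemma xx_eq : xx = (9 - Real.sqrt 17) / 8 := by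
  have := s17_gt
  unfold xx
  rw [div_eq_div_iff (by positivity) (by norm_num)]
  linear_combination s17_sq

lemma rho_lt : xx * ∏ i, ww i < 1 := by
  have h : (4.123105625 : ℝ) < Real.sqrt 17 := by
    apply Real.lt_sqrt_of_sq_lt; norm_num
  rw [xx_eq, Fin.prod_univ_three]
  have e0 : ww 0 = 1.14437675 := rfl
  have e1 : ww 1 = 1.17933737 := rfl
  have e2 : ww 2 = 1.21545685 := rfl
  rw [e0, e1, e2]
  norm_num
  linarith

lemma choose_le (t N : ℕ) (w : ℝ) (hw : 1 < w) : ((t + N).choose (2 * N) : ℝ) ≤ w^t * (w^N / (w-1)^(2*N)) := by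
  have hw1 : 0 < w - 1 := by linarith
  rw [← mul_div_assoc, le_div_iff₀ (by positivity), ← pow_add]
  by_cases h : 2 * N ≤ t + N
  · have h1 := add_pow (w - 1) 1 (t + N)
    rw [sub_add_cancel] at h1
    rw [h1]
    have := single_le_sum (f := fun m => (w - 1)^m * 1^(t + N - m) * ((t+N).choose m : ℝ)) (s := range (t + N + 1))
      (fun i _ => by positivity) (mem_range.2 (by omega : 2 * N < t + N + 1))
    simp only [one_pow, mul_one] at this ⊢
    linarith
  · rw [Nat.choose_eq_zero_of_lt (by omega)]
    simp; positivity

lemma Q_bound : ∃ K : ℝ, ∀ n k : ℕ, k ≤ 2 → |Sm (fR n k)| ≤ K * EQ ^ n := by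
  set ρ := xx * ∏ i, ww i with hρ
  have hw0 : ∀ i, 0 < ww i := fun i => by linarith [ww_gt i]
  have hρ0 : 0 < ρ := mul_pos xx_pos (prod_pos fun i _ => hw0 i)
  have hs : Summable (fun t : ℕ => (2 * (t:ℝ) + 1)^2 * ρ^t) := by
    have hn : ‖ρ‖ < 1 := by rw [Real.norm_of_nonneg hρ0.le]; exact rho_lt
    have h2 := (summable_pow_mul_geometric_of_norm_lt_one 2 hn).mul_left 4
    have h1 := (summable_pow_mul_geometric_of_norm_lt_one 1 hn).mul_left 4
    have h0 := (summable_pow_mul_geometric_of_norm_lt_one 0 hn).mul_left 1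
    refine ((h2.add h1).add h0).congr fun t => ?_
    ring
  refine ⟨∑' t : ℕ, (2 * (t:ℝ) + 1)^2 * ρ^t, fun n k hk => ?_⟩
  rw [mul_comm, ← tsum_mul_left]
  have hE : EQ ^ n = ∏ i : Fin 3, (ww i)^(aa i * n) / (ww i - 1)^(2 * (aa i * n)) := by
    unfold EQ
    rw [← prod_pow]
    refine prod_congr rfl fun i _ => ?_
    rw [div_pow, ← pow_mul, ← pow_mul, mul_assoc]
  have hb : ∀ t : ℕ, |(fR n k).eval (t:ℝ) * xx^t| ≤ EQ^n * ((2 * (t:ℝ) + 1)^2 * ρ^t) := by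
    intro t
    have hx := xx_pos
    rw [fR_nat, abs_of_nonneg (by positivity)]
    have h1 : ∏ i : Fin 3, ((t + aa i * n).choose (2 * (aa i * n)) : ℝ) ≤ (∏ i, ww i)^t * EQ^n := by
      rw [hE, ← prod_pow, ← prod_mul_distrib]
      exact prod_le_prod (fun i _ => by positivity) fun i _ => choose_le _ _ _ (ww_gt i)
    have h2 : (2 * (t:ℝ) + 1)^k ≤ (2 * (t:ℝ) + 1)^2 := pow_le_pow_right₀ (by linarith [Nat.cast_nonneg (α := ℝ) t]) hk
    calc _ ≤ ((∏ i, ww i)^t * EQ^n) * (2 * (t:ℝ) + 1)^2 * xx^t := by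
          have h3 : 0 ≤ (∏ i, ww i)^t * EQ^n := le_trans (by positivity) h1
          gcongr
      _ = _ := by rw [hρ, mul_pow]; ring
  have hs' := hs.mul_left (EQ^n)
  unfold Sm
  have := tsum_of_norm_bounded (f := fun t : ℕ => (fR n k).eval (t:ℝ) * xx^t) hs'.hasSum (fun t => hb t)
  exact this

end NQ

namespace NQ
open Finset Filter Topology Polynomial MeasureTheory

lemma integrable_exp_abs : Integrable (fun y : ℝ => Real.exp (-|y|)) := by
  have h1 : IntegrableOn (fun y : ℝ => Real.exp (-|y|)) (Set.Ioi 0) := by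
    refine (integrableOn_exp_neg_Ioi 0).congr_fun ?_ measurableSet_Ioi
    intro y hy; simp only [abs_of_pos (Set.mem_Ioi.1 hy)]
  have h2 : IntegrableOn (fun y : ℝ => Real.exp (-|y|)) (Set.Iic 0) := by
    refine (integrableOn_exp_Iic 0).congr_fun ?_ measurableSet_Iic
    intro y hy; simp only [abs_of_nonpos (Set.mem_Iic.1 hy), neg_neg]
  have := h2.union h1
  rwa [Set.Iic_union_Ioi, integrableOn_univ] at this

lemma integrable_of_decay {u : ℝ → ℂ} (hc : Continuous u) (K : ℝ) (h : ∀ y, ‖u y‖ ≤ K * Real.exp (-|y|)) :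
    Integrable u :=
  (integrable_exp_abs.const_mul K).mono' hc.aestronglyMeasurable (Eventually.of_forall h)

def strip (a b : ℝ) : Set ℂ := {z | a ≤ z.re ∧ z.re ≤ b}

lemma line_mem {a b c : ℝ} (h1 : a ≤ c) (h2 : c ≤ b) (y : ℝ) : ((c:ℂ) + y * Complex.I) ∈ strip a b := by
  simp [strip, h1, h2]

lemma line_cont {H : ℂ → ℂ} {a b c : ℝ} (h1 : a ≤ c) (h2 : c ≤ b) (hd : ContinuousOn H (strip a b)) :
    Continuous (fun y : ℝ => H ((c:ℂ) + y * Complex.I)) := by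
  rw [← continuousOn_univ]
  refine hd.comp (by fun_prop) fun y _ => line_mem h1 h2 y

lemma line_integrable {H : ℂ → ℂ} {a b c K : ℝ} (h1 : a ≤ c) (h2 : c ≤ b) (hd : ContinuousOn H (strip a b))
    (hb : ∀ z ∈ strip a b, ‖H z‖ ≤ K * Real.exp (-|z.im|)) : Integrable (fun y : ℝ => H ((c:ℂ) + y * Complex.I)) := by
  refine integrable_of_decay (line_cont h1 h2 hd) K fun y => ?_
  have := hb _ (line_mem h1 h2 y)
  simpa using this

lemma strip_shift {H : ℂ → ℂ} {a b K : ℝ} (hab : a ≤ b) (hd : DifferentiableOn ℂ H (strip a b))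
    (hb : ∀ z ∈ strip a b, ‖H z‖ ≤ K * Real.exp (-|z.im|)) :
    ∫ y : ℝ, H ((a:ℂ) + y * Complex.I) = ∫ y : ℝ, H ((b:ℂ) + y * Complex.I) := by
  have ia := line_integrable le_rfl hab hd.continuousOn hb
  have ib := line_integrable hab le_rfl hd.continuousOn hb
  have ta := intervalIntegral_tendsto_integral ia tendsto_neg_atTop_atBot tendsto_id
  have tb := intervalIntegral_tendsto_integral ib tendsto_neg_atTop_atBot tendsto_id
  have key : ∀ T : ℝ, 0 ≤ T → ‖(∫ y in -T..T, H ((b:ℂ) + y * Complex.I)) - ∫ y in -T..T, H ((a:ℂ) + y * Complex.I)‖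
      ≤ 2 * (K * (b - a)) * Real.exp (-T) := by
    intro T hT
    have h := Complex.integral_boundary_rect_eq_zero_of_differentiableOn H (⟨a, -T⟩ : ℂ) (⟨b, T⟩ : ℂ) (hd.mono (by
      intro z hz
      have := hz.1
      simp only [Set.uIcc_of_le hab, Set.mem_preimage, Set.mem_Icc] at this
      exact this))
    simp only at h
    have hor : ∀ s : ℝ, |s| = T → ‖∫ x : ℝ in a..b, H (x + s * Complex.I)‖ ≤ K * Real.exp (-T) * (b - a) := by
      intro s hs
      have := intervalIntegral.norm_integral_le_of_norm_le_const (a := a) (b := b) (f := fun x : ℝ => H (x + s * Complex.I)) (C := K * Real.exp (-T)) (by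
        intro x hx
        rw [Set.uIoc_of_le hab] at hx
        have := hb _ (line_mem hx.1.le hx.2 s)
        simpa [hs] using this)
      rwa [abs_of_nonneg (by linarith)] at this
    have h1 := hor (-T) (by rw [abs_neg, abs_of_nonneg hT])
    have h2 := hor T (abs_of_nonneg hT)
    have e : Complex.I * ((∫ y in -T..T, H ((b:ℂ) + y * Complex.I)) - ∫ y in -T..T, H ((a:ℂ) + y * Complex.I)) =
       (∫ x : ℝ in a..b, H (x + T * Complex.I)) - (∫ x : ℝ in a..b, H (x + (-T : ℝ) * Complex.I)) := by
      simp only [smul_eq_mul] at h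
      linear_combination h
    have e2 : ‖(∫ y in -T..T, H ((b:ℂ) + y * Complex.I)) - ∫ y in -T..T, H ((a:ℂ) + y * Complex.I)‖ =
      ‖Complex.I * ((∫ y in -T..T, H ((b:ℂ) + y * Complex.I)) - ∫ y in -T..T, H ((a:ℂ) + y * Complex.I))‖ := by
      rw [norm_mul, Complex.norm_I, one_mul]
    rw [e2, e]
    refine (norm_sub_le _ _).trans ?_
    linarith
  have t0 : Tendsto (fun T : ℝ => 2 * (K * (b - a)) * Real.exp (-T)) atTop (𝓝 0) := by
    have := (Real.tendsto_exp_neg_atTop_nhds_zero).const_mul (2 * (K * (b - a)))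
    simpa using this
  have t1 : Tendsto (fun T : ℝ => (∫ y in -T..T, H ((b:ℂ) + y * Complex.I)) - ∫ y in -T..T, H ((a:ℂ) + y * Complex.I)) atTop (𝓝 0) :=
    squeeze_zero_norm' ((eventually_ge_atTop 0).mono key) t0
  have t2 := tendsto_nhds_unique t1 (tb.sub ta)
  exact (sub_eq_zero.1 t2.symm).symm

/-- polynomial growth -/
lemma poly_growth (p : ℝ[X]) (A : ℝ) : ∃ K : ℝ, 0 ≤ K ∧ ∀ z : ℂ, |z.re| ≤ A → ‖aeval z p‖ ≤ K * Real.exp |z.im| := by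
  induction p using Polynomial.induction_on' with
  | add p q hp hq =>
    obtain ⟨K1, h1, hp⟩ := hp
    obtain ⟨K2, h2, hq⟩ := hq
    refine ⟨K1 + K2, by positivity, fun z hz => ?_⟩
    rw [map_add]
    refine (norm_add_le _ _).trans ?_
    linarith [hp z hz, hq z hz]
  | monomial k a =>
    refine ⟨|a| * (k.factorial * Real.exp A), by positivity, fun z hz => ?_⟩
    rw [aeval_monomial, norm_mul, norm_pow]
    simp only [Complex.coe_algebraMap, Complex.norm_real, Real.norm_eq_abs]
    rw [mul_assoc, mul_assoc]
    apply mul_le_mul_of_nonneg_left _ (abs_nonneg a)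
    have h1 := Real.pow_div_factorial_le_exp ‖z‖ (norm_nonneg z) k
    rw [div_le_iff₀ (by positivity)] at h1
    refine h1.trans ?_
    rw [mul_comm, ← Real.exp_add]
    gcongr
    have := Complex.norm_le_abs_re_add_abs_im z
    linarith

lemma sin_lower (z : ℂ) (h : 1 ≤ |z.im|) : Real.exp (Real.pi * |z.im|) / 4 ≤ ‖Complex.sin (Real.pi * z)‖ := by
  have e : Complex.sin (Real.pi * z) = (Complex.exp (-(Real.pi * z) * Complex.I) - Complex.exp (Real.pi * z * Complex.I)) * Complex.I / 2 := rfl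
  rw [e, norm_div, norm_mul, Complex.norm_I, mul_one]
  have n1 : ‖Complex.exp (-(Real.pi * z) * Complex.I)‖ = Real.exp (Real.pi * z.im) := by
    rw [Complex.norm_exp]; simp
  have n2 : ‖Complex.exp (Real.pi * z * Complex.I)‖ = Real.exp (-(Real.pi * z.im)) := by
    rw [Complex.norm_exp]; simp
  have t := abs_norm_sub_norm_le (Complex.exp (-(Real.pi * z) * Complex.I)) (Complex.exp (Real.pi * z * Complex.I))
  rw [n1, n2] at t
  have hpi := Real.pi_gt_three
  have hm : Real.exp (-(Real.pi * |z.im|)) ≤ Real.exp (Real.pi * |z.im|) / 2 := by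
    have a1 : Real.exp (-(Real.pi * |z.im|)) ≤ 1 := by rw [Real.exp_le_one_iff]; nlinarith
    have a2 : Real.pi * |z.im| + 1 ≤ Real.exp (Real.pi * |z.im|) := Real.add_one_le_exp _
    nlinarith
  have hn : ‖(2:ℂ)‖ = 2 := by simp
  rw [hn, div_le_div_iff₀ (by norm_num) (by norm_num)]
  rcases abs_cases z.im with ⟨h1, _⟩ | ⟨h1, _⟩
  · rw [h1] at hm ⊢
    have := le_abs_self (Real.exp (Real.pi * z.im) - Real.exp (-(Real.pi * z.im)))
    linarith
  · rw [h1] at hm ⊢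
    have := neg_abs_le (Real.exp (Real.pi * z.im) - Real.exp (-(Real.pi * z.im)))
    simp only [mul_neg, neg_neg] at hm ⊢
    linarith

/-- decay for large imaginary part suffices -/
lemma decay_ext {H : ℂ → ℂ} {a b K : ℝ} (hd : ContinuousOn H (strip a b))
    (hb : ∀ z ∈ strip a b, 1 ≤ |z.im| → ‖H z‖ ≤ K * Real.exp (-|z.im|)) :
    ∃ K', ∀ z ∈ strip a b, ‖H z‖ ≤ K' * Real.exp (-|z.im|) := by
  have hcomp : IsCompact (Set.Icc a b ×ℂ Set.Icc (-1:ℝ) 1) := isCompact_Icc.reProdIm isCompact_Icc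
  obtain ⟨B, hB⟩ := hcomp.exists_bound_of_continuousOn (f := H) (hd.mono (by
    intro z hz; exact ⟨hz.1.1, hz.1.2⟩))
  refine ⟨max K (B * Real.exp 1), fun z hz => ?_⟩
  rcases le_or_gt 1 |z.im| with h | h
  · refine (hb z hz h).trans ?_
    gcongr; exact le_max_left _ _
  · have h1 := hB z ⟨hz, by rw [Set.mem_preimage, Set.mem_Icc, ← abs_le]; exact h.le⟩
    have hB0 : 0 ≤ B := (norm_nonneg _).trans h1
    refine h1.trans ?_
    calc B = B * Real.exp 1 * Real.exp (-1) := by rw [mul_assoc, ← Real.exp_add]; simp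
      _ ≤ B * Real.exp 1 * Real.exp (-|z.im|) := by gcongr
      _ ≤ _ := by gcongr; exact le_max_right _ _

end NQ

namespace NQ
open Finset Filter Topology Polynomial MeasureTheory

noncomputable def LL : ℝ := Real.log xx

lemma exp_LL : Real.exp LL = xx := Real.exp_log xx_pos

/-- polynomial times exponential -/
noncomputable def GG (g : ℝ[X]) (z : ℂ) : ℂ := aeval z g * Complex.exp (LL * z)

lemma GG_hasDeriv (g : ℝ[X]) (z : ℂ) : HasDerivAt (GG g) (GG (derivative g + C LL * g) z) z := by
  have h1 := Polynomial.hasDerivAt_aeval g z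
  have h2 : HasDerivAt (fun z : ℂ => Complex.exp (LL * z)) (Complex.exp (LL * z) * (LL * 1)) z :=
    ((hasDerivAt_id z).const_mul (LL:ℂ)).cexp
  refine (h1.mul h2).congr_deriv ?_
  simp only [GG, map_add, map_mul, aeval_C, Complex.coe_algebraMap]
  ring

lemma GG_diff (g : ℝ[X]) : Differentiable ℂ (GG g) := fun z => (GG_hasDeriv g z).differentiableAt

lemma GG_growth (g : ℝ[X]) (A : ℝ) (hA : 0 ≤ A) : ∃ K : ℝ, 0 ≤ K ∧ ∀ z : ℂ, |z.re| ≤ A → ‖GG g z‖ ≤ K * Real.exp |z.im| := by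
  obtain ⟨K, hK, h⟩ := poly_growth g A
  refine ⟨K * Real.exp (|LL| * A), by positivity, fun z hz => ?_⟩
  rw [GG, norm_mul, Complex.norm_exp]
  have h1 := h z hz
  have h2 : Real.exp ((LL:ℂ) * z).re ≤ Real.exp (|LL| * A) := by
    apply Real.exp_le_exp.2
    simp only [Complex.mul_re, Complex.ofReal_re, Complex.ofReal_im, zero_mul, sub_zero]
    calc LL * z.re ≤ |LL * z.re| := le_abs_self _
      _ = |LL| * |z.re| := abs_mul _ _
      _ ≤ _ := by gcongr
  calc _ ≤ K * Real.exp |z.im| * Real.exp (|LL| * A) := by gcongr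
    _ = _ := by ring

lemma GG_TT (g : ℝ[X]) (z : ℂ) : GG (TT g) z = GG g (z + 1) - GG g z := by
  unfold GG TT
  have : Complex.exp (LL * (z + 1)) = xx * Complex.exp (LL * z) := by
    rw [mul_add, mul_one, Complex.exp_add, ← Complex.ofReal_exp, exp_LL, mul_comm]
  rw [this]
  simp only [map_sub, map_mul, aeval_C, aeval_comp, map_add, aeval_X, map_one, Complex.coe_algebraMap]
  ring

noncomputable def K1 (z : ℂ) : ℂ := Real.pi / Complex.sin (Real.pi * z)

lemma K1_period (z : ℂ) : K1 (z + 1) ^ 2 = K1 z ^ 2 := by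
  unfold K1
  rw [mul_add, mul_one, Complex.sin_add_pi, div_neg, neg_sq]

/-- the point on the half line -/
noncomputable def hl (y : ℝ) : ℂ := ((-1/2 : ℝ):ℂ) + y * Complex.I

lemma sin_hl (y : ℝ) : Complex.sin (Real.pi * hl y) = -(Real.cosh (Real.pi * y) : ℝ) := by
  have : (Real.pi * hl y : ℂ) = (((Real.pi * y : ℝ):ℂ) * Complex.I) - Real.pi / 2 := by
    unfold hl; push_cast; ring
  rw [this, Complex.sin_sub_pi_div_two, Complex.cos_mul_I, Complex.ofReal_cosh]

lemma cos_hl (y : ℝ) : Complex.cos (Real.pi * hl y) = (Real.sinh (Real.pi * y) : ℝ) * Complex.I := by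
  have : (Real.pi * hl y : ℂ) = (((Real.pi * y : ℝ):ℂ) * Complex.I) - Real.pi / 2 := by
    unfold hl; push_cast; ring
  rw [this, Complex.cos_sub_pi_div_two, Complex.sin_mul_I, Complex.ofReal_sinh]

lemma cosh_lower (t : ℝ) : Real.exp |t| / 2 ≤ Real.cosh t := by
  rw [← Real.cosh_abs, Real.cosh_eq]
  have := Real.exp_pos (-|t|)
  linarith

lemma sinh_upper (t : ℝ) : |Real.sinh t| ≤ Real.exp |t| := by
  rw [Real.abs_sinh, Real.sinh_eq]
  have := Real.exp_pos (-|t|)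
  have := Real.exp_pos (|t|)
  linarith

lemma sin_hl_ne (y : ℝ) : Complex.sin (Real.pi * hl y) ≠ 0 := by
  rw [sin_hl, neg_ne_zero, Complex.ofReal_ne_zero]
  exact (Real.cosh_pos _).ne'

lemma K1_hl_norm (y : ℝ) : ‖K1 (hl y)‖ ≤ 2 * Real.pi * Real.exp (-(Real.pi * |y|)) := by
  rw [K1, sin_hl, norm_div, norm_neg, Complex.norm_real, Complex.norm_real, Real.norm_of_nonneg Real.pi_pos.le,
    Real.norm_of_nonneg (Real.cosh_pos _).le, div_le_iff₀ (Real.cosh_pos _)]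
  have h := cosh_lower (Real.pi * y)
  rw [abs_mul, abs_of_pos Real.pi_pos] at h
  have e : Real.exp (-(Real.pi * |y|)) * Real.exp (Real.pi * |y|) = 1 := by rw [← Real.exp_add]; simp
  have hp := Real.pi_pos
  calc Real.pi = 2 * Real.pi * Real.exp (-(Real.pi * |y|)) * (Real.exp (Real.pi * |y|) / 2) := by
        linear_combination (-Real.pi) * e
    _ ≤ _ := by gcongr

lemma cos_hl_norm (y : ℝ) : ‖Complex.cos (Real.pi * hl y)‖ ≤ Real.exp (Real.pi * |y|) := by
  rw [cos_hl, norm_mul, Complex.norm_I, mul_one, Complex.norm_real, Real.norm_eq_abs]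
  have h := sinh_upper (Real.pi * y)
  rwa [abs_mul, abs_of_pos Real.pi_pos] at h

lemma hl_cont : Continuous hl := by unfold hl; fun_prop

lemma hl_deriv (y : ℝ) : HasDerivAt hl Complex.I y := by
  have h0 : HasDerivAt (fun y : ℝ => (y:ℂ)) 1 y := Complex.ofRealCLM.hasDerivAt
  have h1 := (h0.mul_const Complex.I).const_add ((-1/2 : ℝ):ℂ)
  rw [one_mul] at h1
  exact h1

lemma K1_hl_cont : Continuous (fun y => K1 (hl y)) := by
  unfold K1
  refine Continuous.div continuous_const ?_ sin_hl_ne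
  have := hl_cont
  fun_prop

lemma hl_re (y : ℝ) : (hl y).re = -1/2 := by simp [hl]
lemma hl_im (y : ℝ) : (hl y).im = y := by simp [hl]

lemma GG_cont (g : ℝ[X]) : Continuous (fun y => GG g (hl y)) := (GG_diff g).continuous.comp hl_cont

lemma int_K2G (g : ℝ[X]) : Integrable (fun y => GG g (hl y) * K1 (hl y) ^ 2) := by
  obtain ⟨K, hK, h⟩ := GG_growth g 1 (by norm_num)
  refine integrable_of_decay ((GG_cont g).mul (K1_hl_cont.pow 2)) (K * (2 * Real.pi)^2) fun y => ?_
  have h1 := h (hl y) (by rw [hl_re]; norm_num [abs_le])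
  rw [hl_im] at h1
  rw [norm_mul, norm_pow]
  have hp := Real.pi_gt_three
  calc _ ≤ K * Real.exp |y| * (2 * Real.pi * Real.exp (-(Real.pi * |y|)))^2 := by
        gcongr; exact K1_hl_norm y
    _ = K * (2 * Real.pi)^2 * Real.exp (|y| + 2 * (-(Real.pi * |y|))) := by
        rw [mul_pow, ← Real.exp_nat_mul, Real.exp_add]; push_cast; ring
    _ ≤ _ := by
        gcongr
        nlinarith [abs_nonneg y]

lemma int_K3G (g : ℝ[X]) : Integrable (fun y => GG g (hl y) * (K1 (hl y) ^ 3 * Complex.cos (Real.pi * hl y))) := by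
  obtain ⟨K, hK, h⟩ := GG_growth g 1 (by norm_num)
  refine integrable_of_decay ((GG_cont g).mul ((K1_hl_cont.pow 3).mul (by have := hl_cont; fun_prop))) (K * (2 * Real.pi)^3) fun y => ?_
  have h1 := h (hl y) (by rw [hl_re]; norm_num [abs_le])
  rw [hl_im] at h1
  rw [norm_mul, norm_mul, norm_pow]
  have hp := Real.pi_gt_three
  calc _ ≤ K * Real.exp |y| * ((2 * Real.pi * Real.exp (-(Real.pi * |y|)))^3 * Real.exp (Real.pi * |y|)) := by
        gcongr
        · exact K1_hl_norm y
        · exact cos_hl_norm y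
    _ = K * (2 * Real.pi)^3 * Real.exp (|y| + 3 * (-(Real.pi * |y|)) + Real.pi * |y|) := by
        rw [mul_pow, ← Real.exp_nat_mul, Real.exp_add, Real.exp_add]; push_cast; ring
    _ ≤ _ := by
        gcongr
        nlinarith [abs_nonneg y]

lemma K2_eq (y : ℝ) : K1 (hl y) ^ 2 = (((Real.pi / Real.cosh (Real.pi * y))^2 : ℝ) : ℂ) := by
  rw [K1, sin_hl, div_neg, neg_sq]; push_cast; ring

lemma int_K2 : Integrable (fun y => K1 (hl y) ^ 2) := by
  have := (int_K2G (1:ℝ[X]))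
  refine integrable_of_decay (K1_hl_cont.pow 2) ((2 * Real.pi)^2) fun y => ?_
  rw [norm_pow]
  have hp := Real.pi_gt_three
  calc _ ≤ (2 * Real.pi * Real.exp (-(Real.pi * |y|)))^2 := by
        gcongr; exact K1_hl_norm y
    _ = (2 * Real.pi)^2 * Real.exp (2 * (-(Real.pi * |y|))) := by
        rw [mul_pow, ← Real.exp_nat_mul]; push_cast; ring
    _ ≤ _ := by
        gcongr
        nlinarith [abs_nonneg y]

lemma integral_K2 : ∫ y, K1 (hl y) ^ 2 = 2 * Real.pi := by
  have hi : Integrable (fun y => (Real.pi / Real.cosh (Real.pi * y))^2) := by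
    have := int_K2.re
    refine this.congr (Eventually.of_forall fun y => ?_)
    simp only [K2_eq]; exact Complex.ofReal_re _
  have hp := Real.pi_pos
  have hd : ∀ y, HasDerivAt (fun y : ℝ => -(2 * Real.pi) / (Real.exp (2 * Real.pi * y) + 1)) ((Real.pi / Real.cosh (Real.pi * y))^2) y := by
    intro y
    have h1 : HasDerivAt (fun y : ℝ => Real.exp (2 * Real.pi * y) + 1) (Real.exp (2 * Real.pi * y) * (2 * Real.pi * 1)) y :=
      (((hasDerivAt_id y).const_mul (2 * Real.pi)).exp).add_const 1
    have hne : Real.exp (2 * Real.pi * y) + 1 ≠ 0 := by positivity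
    refine ((hasDerivAt_const y (-(2 * Real.pi))).div h1 hne).congr_deriv ?_
    rw [Real.cosh_eq, Real.exp_neg]
    have e : Real.exp (2 * Real.pi * y) = Real.exp (Real.pi * y) ^ 2 := by
      rw [← Real.exp_nat_mul]; push_cast; ring_nf
    rw [e]
    have := Real.exp_pos (Real.pi * y)
    field_simp
    ring
  have hT : Tendsto (fun y : ℝ => Real.exp (2 * Real.pi * y) + 1) atTop atTop :=
    tendsto_atTop_add_const_right _ _ (Real.tendsto_exp_atTop.comp (tendsto_id.const_mul_atTop (by positivity)))
  have hB : Tendsto (fun y : ℝ => Real.exp (2 * Real.pi * y) + 1) atBot (𝓝 (0 + 1)) :=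
    (Real.tendsto_exp_atBot.comp (tendsto_id.const_mul_atBot (by positivity))).add_const 1
  have := integral_of_hasDerivAt_of_tendsto hd hi (Tendsto.div tendsto_const_nhds hB (by norm_num)) (hT.const_div_atTop (-(2 * Real.pi)))
  simp_rw [K2_eq]
  rw [integral_complex_ofReal, this]
  push_cast; ring

lemma res1 (f : ℝ[X]) : ∫ y, GG f (hl y) * K1 (hl y) ^ 2 = -(2 * Real.pi) * ((LL * Sm f + Sm (derivative f) : ℝ) : ℂ) := by
  obtain ⟨g, -, hg⟩ := TT_exists _ f le_rfl
  have s1 : Sm f = - g.eval 0 := by rw [← hg, Sm_TT]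
  have s2 : Sm (derivative f) = - (derivative g).eval 0 := by rw [← hg, TT_deriv, Sm_TT]
  set G := GG g with hG
  have Gd : Differentiable ℂ G := GG_diff g
  set D := deriv G 0 with hD
  have hDv : D = ((LL * g.eval 0 + (derivative g).eval 0 : ℝ) : ℂ) := by
    rw [hD, (GG_hasDeriv g 0).deriv, GG]
    simp only [mul_zero, Complex.exp_zero, mul_one]
    rw [show (0:ℂ) = ((0:ℝ):ℂ) by simp, ← Complex.coe_algebraMap, aeval_algebraMap_apply]
    simp; ring
  set Sn : ℂ → ℂ := fun z => Complex.sin (Real.pi * z) with hSn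
  have Snd : Differentiable ℂ Sn := by fun_prop
  have Sn0 : deriv Sn 0 = Real.pi := by
    have : HasDerivAt Sn (Complex.cos (Real.pi * 0) * (Real.pi * 1)) 0 :=
      ((hasDerivAt_id (0:ℂ)).const_mul (Real.pi:ℂ)).csin
    rw [this.deriv]; simp
  set S0 := dslope Sn 0 with hS0
  have S0d : Differentiable ℂ S0 := by
    rw [← differentiableOn_univ] at Snd ⊢
    exact (Complex.differentiableOn_dslope (by simp)).2 Snd
  have d1 : Differentiable ℂ (dslope G 0) := by
    rw [← differentiableOn_univ] at Gd ⊢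
    exact (Complex.differentiableOn_dslope (by simp)).2 Gd
  have d2 : Differentiable ℂ (dslope (dslope G 0) 0) := by
    rw [← differentiableOn_univ] at d1 ⊢
    exact (Complex.differentiableOn_dslope (by simp)).2 d1
  have hpi0 : (Real.pi : ℂ) ≠ 0 := by exact_mod_cast Real.pi_ne_zero
  have S0ne : ∀ z ∈ strip (-1/2) (1/2), S0 z ≠ 0 := by
    intro z hz
    by_cases h0 : z = 0
    · rw [h0, hS0, dslope_same, Sn0]; exact hpi0
    · rw [hS0, dslope_of_ne _ h0, slope_def_field]
      have : Sn 0 = 0 := by simp [hSn]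
      rw [this, sub_zero, sub_zero]
      refine div_ne_zero ?_ h0
      rw [hSn]; simp only
      intro hs
      rw [Complex.sin_eq_zero_iff] at hs
      obtain ⟨k, hk⟩ := hs
      rw [mul_comm] at hk
      have hzk : z = k := mul_right_cancel₀ hpi0 hk
      have hre : z.re = k := by rw [hzk]; simp
      have := hz.1
      have h2 := hz.2
      rw [hre] at this h2
      have a1 : (-1:ℝ) < k := by linarith
      have a2 : (k:ℝ) < 1 := by linarith
      have a1' : (-1:ℤ) < k := by exact_mod_cast a1
      have a2' : k < 1 := by exact_mod_cast a2
      have : k = 0 := by omega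
      apply h0; rw [hzk, this]; simp
  set H : ℂ → ℂ := fun z => dslope (dslope G 0) 0 z * (Real.pi / S0 z)^2 with hH
  have Hd : DifferentiableOn ℂ H (strip (-1/2) (1/2)) := by
    refine d2.differentiableOn.mul (DifferentiableOn.pow ?_ 2)
    exact (differentiableOn_const _).div S0d.differentiableOn S0ne
  have Hne : ∀ z ∈ strip (-1/2) (1/2), z ≠ 0 → H z = (G z - G 0 - D * z) * K1 z ^ 2 := by
    intro z hz h0
    have hs := S0ne z hz
    simp only [hH]
    rw [dslope_of_ne _ h0, slope_def_field, dslope_of_ne _ h0, slope_def_field, dslope_same, K1]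
    rw [hS0, dslope_of_ne _ h0, slope_def_field] at hs ⊢
    have e0 : Sn 0 = 0 := by simp [hSn]
    rw [e0, sub_zero, sub_zero] at hs ⊢
    have : Complex.sin (Real.pi * z) ≠ 0 := by
      intro h; apply hs; simp only [hSn]; rw [h]; simp
    simp only [hSn]
    field_simp
    rw [← hD]
  obtain ⟨KG, hKG, hKGb⟩ := GG_growth g 1 (by norm_num)
  obtain ⟨KX, hKX, hKXb⟩ := poly_growth X 1
  have hp := Real.pi_gt_three
  obtain ⟨K', hdec⟩ : ∃ K', ∀ z ∈ strip (-1/2) (1/2), ‖H z‖ ≤ K' * Real.exp (-|z.im|) := by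
    refine decay_ext (K := (KG + ‖G 0‖ + ‖D‖ * KX) * (4 * Real.pi)^2) Hd.continuousOn fun z hz h1 => ?_
    have h0 : z ≠ 0 := by rintro rfl; norm_num at h1
    rw [Hne z hz h0, norm_mul, norm_pow]
    have hre : |z.re| ≤ 1 := by rw [abs_le]; constructor <;> linarith [hz.1, hz.2]
    have b1 := hKGb z hre
    have b2 := hKXb z hre
    rw [aeval_X] at b2
    have e1 : 1 ≤ Real.exp |z.im| := Real.one_le_exp (abs_nonneg _)
    have b3 : ‖G z - G 0 - D * z‖ ≤ (KG + ‖G 0‖ + ‖D‖ * KX) * Real.exp |z.im| := by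
      refine (norm_sub_le _ _).trans ((add_le_add (norm_sub_le _ _) (norm_mul_le _ _)).trans ?_)
      have : ‖G 0‖ ≤ ‖G 0‖ * Real.exp |z.im| := le_mul_of_one_le_right (norm_nonneg _) e1
      have : ‖D‖ * ‖z‖ ≤ ‖D‖ * (KX * Real.exp |z.im|) := by gcongr
      linarith
    have b4 : ‖K1 z‖ ≤ 4 * Real.pi * Real.exp (-(Real.pi * |z.im|)) := by
      have hs := sin_lower z h1
      have hs0 : 0 < ‖Complex.sin (Real.pi * z)‖ := lt_of_lt_of_le (by positivity) hs
      rw [K1, norm_div, Complex.norm_real, Real.norm_of_nonneg Real.pi_pos.le, div_le_iff₀ hs0]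
      have e : Real.exp (-(Real.pi * |z.im|)) * Real.exp (Real.pi * |z.im|) = 1 := by rw [← Real.exp_add]; simp
      calc Real.pi = 4 * Real.pi * Real.exp (-(Real.pi * |z.im|)) * (Real.exp (Real.pi * |z.im|) / 4) := by
            linear_combination (-Real.pi) * e
        _ ≤ _ := by gcongr
    calc _ ≤ (KG + ‖G 0‖ + ‖D‖ * KX) * Real.exp |z.im| * (4 * Real.pi * Real.exp (-(Real.pi * |z.im|)))^2 := by gcongr
      _ = (KG + ‖G 0‖ + ‖D‖ * KX) * (4 * Real.pi)^2 * Real.exp (|z.im| + 2 * (-(Real.pi * |z.im|))) := by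
          rw [mul_pow, ← Real.exp_nat_mul, Real.exp_add]; push_cast; ring
      _ ≤ _ := by
          gcongr
          nlinarith [abs_nonneg z.im]
  have hshift := strip_shift (by norm_num) Hd hdec
  have i1 := line_integrable (c := -1/2) le_rfl (by norm_num) Hd.continuousOn hdec
  have i2 := line_integrable (c := 1/2) (by norm_num) le_rfl Hd.continuousOn hdec
  have hpt : ∀ y : ℝ, GG f (hl y) * K1 (hl y) ^ 2 = (H (((1/2:ℝ):ℂ) + y * Complex.I) - H (((-1/2:ℝ):ℂ) + y * Complex.I)) + D * K1 (hl y) ^ 2 := by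
    intro y
    rw [Hne _ (line_mem (by norm_num) le_rfl y) (by intro h; have := congrArg Complex.re h; simp at this),
      Hne _ (line_mem le_rfl (by norm_num) y) (by intro h; have := congrArg Complex.re h; simp at this)]
    have e : (((1/2:ℝ):ℂ) + y * Complex.I) = hl y + 1 := by unfold hl; push_cast; ring
    have e' : (((-1/2:ℝ):ℂ) + y * Complex.I) = hl y := rfl
    rw [e, e', K1_period, ← hg, GG_TT]
    ring
  simp_rw [hpt]
  rw [integral_add (by exact i2.sub i1) (int_K2.const_mul D), integral_sub i2 i1, hshift, sub_self, zero_add, integral_const_mul, integral_K2, hDv, s1, s2]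
  push_cast; ring

lemma res2 (f : ℝ[X]) : ∫ y, GG f (hl y) * (K1 (hl y) ^ 3 * Complex.cos (Real.pi * hl y)) =
    -(2 * Real.pi) * ((LL^2/2 * Sm f + LL * Sm (derivative f) + Sm (hasseDeriv 2 f) : ℝ) : ℂ) := by
  have hu : ∀ y, HasDerivAt (fun y => GG f (hl y)) (GG (derivative f + C LL * f) (hl y) * Complex.I) y :=
    fun y => HasDerivAt.comp y (GG_hasDeriv f (hl y)) (hl_deriv y)
  have hv : ∀ y, HasDerivAt (fun y => K1 (hl y) ^ 2) (-2 * (K1 (hl y) ^ 3 * Complex.cos (Real.pi * hl y)) * Complex.I) y := by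
    intro y
    have hs := sin_hl_ne y
    have h1 : HasDerivAt (fun z : ℂ => Complex.sin (Real.pi * z)) (Complex.cos (Real.pi * hl y) * (Real.pi * 1)) (hl y) :=
      ((hasDerivAt_id (hl y)).const_mul (Real.pi:ℂ)).csin
    have h2 : HasDerivAt K1 _ (hl y) := (hasDerivAt_const (hl y) (Real.pi:ℂ)).div h1 hs
    have h3 := (HasDerivAt.comp y h2 (hl_deriv y)).pow 2
    refine h3.congr_deriv ?_
    simp only [Function.comp, K1, Nat.add_one_sub_one, pow_one, Nat.cast_ofNat, zero_mul, zero_sub, mul_one]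
    field_simp
  have i1 : Integrable (fun y => GG f (hl y) * (-2 * (K1 (hl y) ^ 3 * Complex.cos (Real.pi * hl y)) * Complex.I)) := by
    refine ((int_K3G f).mul_const (-2 * Complex.I)).congr (Eventually.of_forall fun y => ?_)
    simp only; ring
  have i2 : Integrable (fun y => (GG (derivative f + C LL * f) (hl y) * Complex.I) * K1 (hl y) ^ 2) := by
    refine ((int_K2G (derivative f + C LL * f)).mul_const (Complex.I)).congr (Eventually.of_forall fun y => ?_)
    simp only; ring
  have i3 := int_K2G f
  have key := integral_mul_deriv_eq_deriv_mul_of_integrable (u := fun y => GG f (hl y)) (v := fun y => K1 (hl y) ^ 2)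
    (fun y _ => hu y) (fun y _ => hv y) i1 i2 i3
  have e1 : ∀ y, GG f (hl y) * (-2 * (K1 (hl y) ^ 3 * Complex.cos (Real.pi * hl y)) * Complex.I) = (-2 * Complex.I) * (GG f (hl y) * (K1 (hl y) ^ 3 * Complex.cos (Real.pi * hl y))) := fun y => by ring
  have e2 : ∀ y, (GG (derivative f + C LL * f) (hl y) * Complex.I) * K1 (hl y) ^ 2 = Complex.I * (GG (derivative f + C LL * f) (hl y) * K1 (hl y) ^ 2) := fun y => by ring
  simp_rw [e1, e2] at key
  rw [integral_const_mul, integral_const_mul, res1] at key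
  have hI : Complex.I ≠ 0 := Complex.I_ne_zero
  have e3 : LL * Sm (derivative f + C LL * f) + Sm (derivative (derivative f + C LL * f)) = 2 * (LL^2/2 * Sm f + LL * Sm (derivative f) + Sm (hasseDeriv 2 f)) := by
    rw [half_deriv, derivative_add, derivative_C_mul, Sm_add, Sm_add, Sm_C_mul, Sm_C_mul, Sm_C_mul]
    simp only [Function.iterate_succ, Function.iterate_zero, Function.comp, id]
    ring
  rw [e3] at key
  apply mul_left_cancel₀ (mul_ne_zero (by norm_num : (-2:ℂ) ≠ 0) hI)
  rw [key]; push_cast; ring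

end NQ

namespace NQ
open Finset Filter Topology Polynomial MeasureTheory

lemma cgamma_int {a : ℂ} (ha : 0 < a.re) {r : ℂ} (hr : 0 < r.re) :
    ∫ t : ℝ in Set.Ioi 0, (t:ℂ) ^ (a - 1) * Complex.exp (-(r * t)) = (1 / r) ^ a * Complex.Gamma a := by
  set U : Set ℂ := {r | 0 < r.re} with hU
  have Uo : IsOpen U := isOpen_lt continuous_const Complex.continuous_re
  have Uc : Convex ℝ U := convex_halfSpace_re_gt 0
  have nrm : ∀ (s : ℂ) (t : ℝ), 0 < t → ∀ b : ℂ, ‖(t:ℂ) ^ b * Complex.exp (-(s * t))‖ = t ^ b.re * Real.exp (-(s.re * t)) := by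
    intro s t ht b
    rw [norm_mul, Complex.norm_cpow_eq_rpow_re_of_pos ht, Complex.norm_exp]; simp
  have meas : ∀ (s b : ℂ), AEStronglyMeasurable (fun t : ℝ => (t:ℂ) ^ b * Complex.exp (-(s * t))) (volume.restrict (Set.Ioi 0)) := by
    intro s b
    refine ContinuousOn.aestronglyMeasurable ?_ measurableSet_Ioi
    refine ContinuousOn.mul ?_ (by fun_prop)
    intro t ht
    exact (Complex.continuousAt_ofReal_cpow_const t b (Or.inr (ne_of_gt ht))).continuousWithinAt
  have intg : ∀ (c e : ℝ), -1 < c → 0 < e → IntegrableOn (fun t : ℝ => t ^ c * Real.exp (-(e * t))) (Set.Ioi 0) := by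
    intro c e hc he
    have := integrableOn_rpow_mul_exp_neg_mul_rpow (p := 1) (s := c) (b := e) hc one_pos he
    refine this.congr_fun (fun t ht => ?_) measurableSet_Ioi
    simp
  have D1 : DifferentiableOn ℂ (fun s : ℂ => ∫ t : ℝ in Set.Ioi 0, (t:ℂ) ^ (a - 1) * Complex.exp (-(s * t))) U := by
    intro s hs
    have hs' : 0 < s.re := hs
    have := hasDerivAt_integral_of_dominated_loc_of_deriv_le (μ := volume.restrict (Set.Ioi (0:ℝ))) (𝕜 := ℂ)
      (F := fun (s : ℂ) (t : ℝ) => (t:ℂ) ^ (a - 1) * Complex.exp (-(s * t)))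
      (F' := fun (s : ℂ) (t : ℝ) => (t:ℂ) ^ (a - 1) * (Complex.exp (-(s * t)) * (-(1 * t))))
      (x₀ := s) (s := {w : ℂ | s.re / 2 < w.re}) (bound := fun t : ℝ => t ^ a.re * Real.exp (-(s.re / 2 * t)))
      ((isOpen_lt continuous_const Complex.continuous_re).mem_nhds (by simp only [Set.mem_setOf_eq]; linarith))
      (Eventually.of_forall fun w => meas w _) ?_ ?_ ?_ ?_ ?_
    · exact this.2.differentiableAt.differentiableWithinAt
    · refine (intg (a.re - 1) s.re (by linarith) hs').mono' (meas s _) ?_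
      refine (ae_restrict_iff' measurableSet_Ioi).2 (Eventually.of_forall fun t ht => ?_)
      rw [nrm s t ht]; simp
    · have := (meas s (a-1)).mul (f := fun t : ℝ => (t:ℂ) ^ (a - 1) * Complex.exp (-(s * t))) (g := fun t : ℝ => (-(1 * (t:ℂ)))) (by
        refine Continuous.aestronglyMeasurable ?_; fun_prop)
      refine this.congr (Eventually.of_forall fun t => ?_)
      simp only [Pi.mul_apply]; ring
    · refine (ae_restrict_iff' measurableSet_Ioi).2 (Eventually.of_forall fun t ht w hw => ?_)
      have ht' : 0 < t := ht
      rw [← mul_assoc, norm_mul, nrm w t ht]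
      have : ‖(-(1 * (t:ℂ)))‖ = t := by simp [abs_of_pos ht']
      rw [this]
      have e : t ^ a.re = t ^ (a - 1).re * t := by
        rw [← Real.rpow_add_one ht'.ne']; simp
      rw [e]
      have : Real.exp (-(w.re * t)) ≤ Real.exp (-(s.re / 2 * t)) := by
        apply Real.exp_le_exp.2
        have hw' : s.re / 2 < w.re := hw
        nlinarith
      have p1 : 0 ≤ t ^ (a - 1).re := by positivity
      calc _ ≤ t ^ (a - 1).re * Real.exp (-(s.re / 2 * t)) * t := by gcongr
        _ = _ := by ring
    · exact intg a.re (s.re / 2) (by linarith) (by linarith)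
    · refine Eventually.of_forall fun t w _ => ?_
      exact (((hasDerivAt_id w).mul_const (t:ℂ)).neg.cexp).const_mul _
  have D2 : DifferentiableOn ℂ (fun s : ℂ => (1 / s) ^ a * Complex.Gamma a) U := by
    refine DifferentiableOn.mul_const ?_ _
    have hne : ∀ s ∈ U, s ≠ 0 := by rintro s hs rfl; simp [hU] at hs
    refine DifferentiableOn.cpow_const ((differentiableOn_const _).div differentiableOn_id hne) ?_
    intro s hs
    refine Or.inl ?_
    have hs' : 0 < s.re := hs
    simp only [one_div, id, Complex.inv_re]
    have := Complex.normSq_pos.2 (hne s hs)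
    positivity
  have fr : ∃ᶠ s in 𝓝[≠] (1:ℂ), (fun s : ℂ => ∫ t : ℝ in Set.Ioi 0, (t:ℂ) ^ (a - 1) * Complex.exp (-(s * t))) s = (fun s : ℂ => (1 / s) ^ a * Complex.Gamma a) s := by
    have ht : Tendsto (fun x : ℝ => (x:ℂ)) (𝓝[≠] 1) (𝓝[≠] 1) := by
      refine tendsto_nhdsWithin_of_tendsto_nhds_of_eventually_within _ ?_ ?_
      · exact (Complex.continuous_ofReal.tendsto' 1 1 (by simp)).mono_left nhdsWithin_le_nhds
      · filter_upwards [self_mem_nhdsWithin] with x hx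
        simpa using hx
    refine ht.frequently (Eventually.frequently ?_)
    filter_upwards [nhdsWithin_le_nhds (lt_mem_nhds (one_pos : (0:ℝ) < 1))] with x hx
    exact Complex.integral_cpow_mul_exp_neg_mul_Ioi ha hx
  exact (D1.analyticOnNhd Uo).eqOn_of_preconnected_of_frequently_eq (D2.analyticOnNhd Uo) Uc.isPreconnected (by simp [hU]) fr hr

lemma Gam_bound (a : ℂ) (ha : 0 < a.re) (ψ : ℝ) (h1 : -(Real.pi/2) < ψ) (h2 : ψ < Real.pi/2) :
    ‖Complex.Gamma a‖ ≤ Real.exp (-(ψ * a.im)) * (Real.Gamma a.re * Real.exp (-(a.re * Real.log (Real.cos ψ)))) := by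
  have hc : 0 < Real.cos ψ := Real.cos_pos_of_mem_Ioo ⟨h1, h2⟩
  set r : ℂ := Complex.exp (ψ * Complex.I) with hr
  have hrre : r.re = Real.cos ψ := Complex.exp_ofReal_mul_I_re ψ
  have key := cgamma_int ha (r := r) (by rw [hrre]; exact hc)
  have e1 : (1 / r) ^ a = Complex.exp (-(ψ * Complex.I) * a) := by
    have : 1 / r = Complex.exp (-(ψ * Complex.I)) := by rw [hr, Complex.exp_neg, one_div]
    rw [this, Complex.cpow_def_of_ne_zero (Complex.exp_ne_zero _), Complex.log_exp]
    · simp; linarith [Real.pi_pos]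
    · simp; linarith [Real.pi_pos]
  have n1 : ‖(1 / r) ^ a‖ = Real.exp (ψ * a.im) := by
    rw [e1, Complex.norm_exp]; simp
  have nb : ‖∫ t : ℝ in Set.Ioi 0, (t:ℂ) ^ (a - 1) * Complex.exp (-(r * t))‖ ≤ (1 / Real.cos ψ) ^ a.re * Real.Gamma a.re := by
    rw [← Real.integral_rpow_mul_exp_neg_mul_Ioi ha hc]
    refine (norm_integral_le_integral_norm _).trans (le_of_eq ?_)
    refine setIntegral_congr_fun measurableSet_Ioi fun t ht => ?_
    rw [norm_mul, Complex.norm_cpow_eq_rpow_re_of_pos ht, Complex.norm_exp]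
    simp [hrre]
  rw [key, norm_mul, n1] at nb
  have e2 : (1 / Real.cos ψ) ^ a.re = Real.exp (-(a.re * Real.log (Real.cos ψ))) := by
    rw [Real.rpow_def_of_pos (by positivity), one_div, Real.log_inv]; ring_nf
  rw [e2] at nb
  have hp := Real.exp_pos (ψ * a.im)
  calc ‖Complex.Gamma a‖ = Real.exp (-(ψ * a.im)) * (Real.exp (ψ * a.im) * ‖Complex.Gamma a‖) := by
        rw [← mul_assoc, ← Real.exp_add]; simp
    _ ≤ Real.exp (-(ψ * a.im)) * (Real.exp (-(a.re * Real.log (Real.cos ψ))) * Real.Gamma a.re) := by gcongr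
    _ = _ := by ring

noncomputable def BB (N : ℕ) (z : ℂ) : ℂ := Complex.Gamma (z + N + 1) * Complex.Gamma (N - z) / (2 * N).factorial
noncomputable def rB (N : ℕ) (x : ℝ) : ℝ := Real.Gamma (x + N + 1) * Real.Gamma (N - x) / (2 * N).factorial

lemma Gam_bound' (a : ℂ) (ha : 0 < a.re) (ψ : ℝ) (h1 : 0 ≤ ψ) (h2 : ψ < Real.pi/2) :
    ‖Complex.Gamma a‖ ≤ Real.exp (-(ψ * |a.im|)) * (Real.Gamma a.re * Real.exp (-(a.re * Real.log (Real.cos ψ)))) := by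
  rcases abs_cases a.im with ⟨h, _⟩ | ⟨h, _⟩
  · rw [h]; exact Gam_bound a ha ψ (by linarith [Real.pi_pos]) h2
  · have := Gam_bound a ha (-ψ) (by linarith [Real.pi_pos]) (by linarith [Real.pi_pos])
    rw [Real.cos_neg] at this
    rw [h]; convert this using 3; ring

lemma BB_bound (N : ℕ) (z : ℂ) (hz1 : -1 - N < z.re) (hz2 : z.re < N) (ψ χ : ℝ) (h1 : 0 ≤ ψ) (h2 : ψ < Real.pi/2)
    (h3 : 0 ≤ χ) (h4 : χ < Real.pi/2) :
    ‖BB N z‖ ≤ Real.exp (-((ψ + χ) * |z.im|)) * (rB N z.re *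
      Real.exp (-((z.re + N + 1) * Real.log (Real.cos ψ)) - (N - z.re) * Real.log (Real.cos χ))) := by
  have b1 := Gam_bound' (z + N + 1) (by simp; linarith) ψ h1 h2
  have b2 := Gam_bound' (N - z) (by simp; linarith) χ h3 h4
  simp only [Complex.add_re, Complex.add_im, Complex.natCast_re, Complex.natCast_im, Complex.one_re, Complex.one_im, add_zero] at b1
  simp only [Complex.sub_re, Complex.sub_im, Complex.natCast_re, Complex.natCast_im, zero_sub, abs_neg] at b2
  rw [BB, rB, norm_div, norm_mul, Complex.norm_natCast]
  have e : Real.exp (-((ψ + χ) * |z.im|)) = Real.exp (-(ψ * |z.im|)) * Real.exp (-(χ * |z.im|)) := by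
    rw [← Real.exp_add]; ring_nf
  have e' : Real.exp (-((z.re + N + 1) * Real.log (Real.cos ψ)) - (N - z.re) * Real.log (Real.cos χ)) =
     Real.exp (-((z.re + N + 1) * Real.log (Real.cos ψ))) * Real.exp (-((N - z.re) * Real.log (Real.cos χ))) := by
    rw [← Real.exp_add]; ring_nf
  rw [e, e', div_le_iff₀ (by positivity)]
  have := mul_le_mul b1 b2 (norm_nonneg _) (by
    have := Real.Gamma_pos_of_pos (s := z.re + N + 1) (by linarith)
    positivity)
  refine this.trans (le_of_eq ?_)
  have : ((2 * N).factorial : ℝ) ≠ 0 := by positivity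
  field_simp

lemma rB_bound (a : ℝ) (n N : ℕ) (hN : (N:ℝ) = a * n) (c : ℝ) (hp : 0 < a + c) (hq : 0 < a - c) :
    rB N (c * n - 1/2) ≤ Real.pi * Real.exp (n * ((a + c) * Real.log (a + c) + (a - c) * Real.log (a - c) - 2 * a * Real.log (2 * a))) := by
  set lam := (a + c) * Real.log (a + c) + (a - c) * Real.log (a - c) - 2 * a * Real.log (2 * a) with hlam
  have ha : 0 < a := by linarith
  set P : ℝ := (a + c) * n + 1/2 with hP
  set Q : ℝ := (a - c) * n + 1/2 with hQ
  have hP0 : 0 < P := by positivity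
  have hQ0 : 0 < Q := by positivity
  have e0 : rB N (c * n - 1/2) = ProbabilityTheory.beta P Q := by
    rw [rB, ProbabilityTheory.beta, hN]
    have : P + Q = ((2 * N : ℕ) : ℝ) + 1 := by push_cast; rw [hN, hP, hQ]; ring
    rw [this, Real.Gamma_nat_eq_factorial]
    congr 3
    · rw [hP]; ring
    · rw [hQ]; ring
  rw [e0, ProbabilityTheory.beta_eq_betaIntegralReal _ _ hP0 hQ0]
  refine (Complex.re_le_norm _).trans ?_
  have hconv := Complex.betaIntegral_convergent (u := 1/2) (v := 1/2) (by norm_num) (by norm_num)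
  have hpi : Complex.betaIntegral (1/2) (1/2) = Real.pi := by
    rw [Complex.betaIntegral_eq_Gamma_mul_div _ _ (by norm_num) (by norm_num)]
    rw [Complex.Gamma_one_half_eq]
    rw [← Complex.cpow_add _ _ (by exact_mod_cast Real.pi_ne_zero)]
    norm_num
  have hnorm : ∀ x ∈ Set.Ioo (0:ℝ) 1, ∀ u v : ℝ, ‖(x:ℂ) ^ ((u:ℂ) - 1) * (1 - (x:ℂ)) ^ ((v:ℂ) - 1)‖ = x ^ (u - 1) * (1 - x) ^ (v - 1) := by
    intro x hx u v
    rw [norm_mul, Complex.norm_cpow_eq_rpow_re_of_pos hx.1]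
    have : (1 - (x:ℂ)) = ((1 - x : ℝ):ℂ) := by push_cast; ring
    rw [this, Complex.norm_cpow_eq_rpow_re_of_pos (by linarith [hx.2])]
    simp
  have hreal : ∀ x ∈ Set.Ioo (0:ℝ) 1, ∀ u v : ℝ, (x:ℂ) ^ ((u:ℂ) - 1) * (1 - (x:ℂ)) ^ ((v:ℂ) - 1) = ((x ^ (u - 1) * (1 - x) ^ (v - 1) : ℝ) : ℂ) := by
    intro x hx u v
    have h1x : 0 ≤ 1 - x := by linarith [hx.2]
    push_cast
    rw [Complex.ofReal_cpow hx.1.le, Complex.ofReal_cpow h1x]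
    push_cast; rfl
  have hI : ∫ x in (0:ℝ)..1, ‖(x:ℂ) ^ ((1/2:ℂ) - 1) * (1 - (x:ℂ)) ^ ((1/2:ℂ) - 1)‖ = Real.pi := by
    have : ((∫ x in (0:ℝ)..1, ‖(x:ℂ) ^ ((1/2:ℂ) - 1) * (1 - (x:ℂ)) ^ ((1/2:ℂ) - 1)‖ : ℝ) : ℂ) = Complex.betaIntegral (1/2) (1/2) := by
      rw [← intervalIntegral.integral_ofReal, Complex.betaIntegral]
      rw [intervalIntegral.integral_of_le zero_le_one, intervalIntegral.integral_of_le zero_le_one,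
        integral_Ioc_eq_integral_Ioo, integral_Ioc_eq_integral_Ioo]
      refine setIntegral_congr_fun measurableSet_Ioo fun x hx => ?_
      have h1 := hnorm x hx (1/2) (1/2)
      have h2 := hreal x hx (1/2) (1/2)
      push_cast at h1 h2
      rw [h1, h2]; push_cast; rfl
    rw [hpi] at this
    exact_mod_cast this
  rw [Complex.betaIntegral]
  have hb : ∀ x ∈ Set.Ioo (0:ℝ) 1, ‖(x:ℂ) ^ ((P:ℂ) - 1) * (1 - (x:ℂ)) ^ ((Q:ℂ) - 1)‖ ≤
      Real.exp (n * lam) * ‖(x:ℂ) ^ ((1/2:ℂ) - 1) * (1 - (x:ℂ)) ^ ((1/2:ℂ) - 1)‖ := by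
    intro x hx
    have h1 := hnorm x hx (1/2) (1/2)
    push_cast at h1
    have hx1 : 0 < 1 - x := by linarith [hx.2]
    rw [hnorm x hx, h1]
    rw [Real.rpow_def_of_pos hx.1, Real.rpow_def_of_pos hx.1, Real.rpow_def_of_pos hx1, Real.rpow_def_of_pos hx1,
      ← Real.exp_add, ← Real.exp_add, ← Real.exp_add]
    apply Real.exp_le_exp.2
    have k1 : Real.log (x * (2 * a) / (a + c)) = Real.log x + Real.log (2 * a) - Real.log (a + c) := by
      rw [Real.log_div (by have := hx.1; positivity) hp.ne', Real.log_mul hx.1.ne' (by positivity)]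
    have k2 : Real.log ((1 - x) * (2 * a) / (a - c)) = Real.log (1 - x) + Real.log (2 * a) - Real.log (a - c) := by
      rw [Real.log_div (by positivity) hq.ne', Real.log_mul hx1.ne' (by positivity)]
    have l1 := Real.log_le_sub_one_of_pos (x := x * (2 * a) / (a + c)) (by have := hx.1; positivity)
    have l2 := Real.log_le_sub_one_of_pos (x := (1 - x) * (2 * a) / (a - c)) (by positivity)
    rw [k1] at l1
    rw [k2] at l2
    have m1 := mul_le_mul_of_nonneg_left l1 hp.le
    have m2 := mul_le_mul_of_nonneg_left l2 hq.le
    have r1 : (a + c) * (x * (2 * a) / (a + c) - 1) = x * (2 * a) - (a + c) := by field_simp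
    have r2 : (a - c) * ((1 - x) * (2 * a) / (a - c) - 1) = (1 - x) * (2 * a) - (a - c) := by field_simp
    rw [r1] at m1
    rw [r2] at m2
    have main : (a + c) * Real.log x + (a - c) * Real.log (1 - x) ≤ lam := by
      rw [hlam]; nlinarith
    have hn : (0:ℝ) ≤ n := Nat.cast_nonneg n
    have := mul_le_mul_of_nonneg_left main hn
    rw [hP, hQ]; nlinarith
  calc _ ≤ ∫ x in (0:ℝ)..1, Real.exp (n * lam) * ‖(x:ℂ) ^ ((1/2:ℂ) - 1) * (1 - (x:ℂ)) ^ ((1/2:ℂ) - 1)‖ := by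
        refine intervalIntegral.norm_integral_le_of_norm_le zero_le_one ?_ (hconv.norm.const_mul _)
        have : ∀ᵐ x : ℝ, x ≠ 1 := by
          rw [ae_iff]; simp
        filter_upwards [this] with x hx h
        exact hb x ⟨h.1, lt_of_le_of_ne h.2 hx⟩
    _ = _ := by rw [intervalIntegral.integral_const_mul, hI]; ring

lemma bm_K1 (N : ℕ) (y : ℝ) : aeval (hl y) (bm N) * K1 (hl y) = (-1)^(N+1) * (Complex.Gamma (hl y + N + 1) * Complex.Gamma (N - hl y)) := by
  induction N with
  | zero =>
    have := Complex.Gamma_mul_Gamma_one_sub (-hl y)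
    simp only [bm, range_zero, prod_empty, map_one, K1]
    simp only [mul_neg, Complex.sin_neg, sub_neg_eq_add, div_neg] at this
    simp only [Nat.cast_zero, add_zero, zero_sub, zero_add, pow_one]
    rw [add_comm (hl y) 1]
    linear_combination this
  | succ N ih =>
    have e : bm (N+1) = bm N * ((X - C (N:ℝ)) * (X + C (1 + (N:ℝ)))) := by
      unfold bm; rw [prod_range_succ]
    have h1 : hl y + N + 1 ≠ 0 := by
      intro h
      have := congrArg Complex.re h
      simp [hl_re] at this
      have hn : (0:ℝ) ≤ N := Nat.cast_nonneg N
      linarith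
    have h2 : (N:ℂ) - hl y ≠ 0 := by
      intro h
      have := congrArg Complex.re h
      simp [hl_re] at this
      have hn : (0:ℝ) ≤ N := Nat.cast_nonneg N
      linarith
    have g1 := Complex.Gamma_add_one _ h1
    have g2 := Complex.Gamma_add_one _ h2
    rw [e, map_mul]
    have a1 : hl y + ((N+1:ℕ):ℂ) + 1 = hl y + N + 1 + 1 := by push_cast; ring
    have a2 : ((N+1:ℕ):ℂ) - hl y = N - hl y + 1 := by push_cast; ring
    rw [a1, a2, g1, g2]
    simp only [map_mul, map_sub, map_add, aeval_X, aeval_C, Complex.coe_algebraMap, map_one]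
    push_cast
    rw [pow_succ (-1:ℂ) (N+1)]
    linear_combination (hl y - N) * (hl y + (1 + N)) * ih

end NQ

namespace NQ
open Finset Filter Topology Polynomial MeasureTheory

noncomputable def PH (n k : ℕ) (h : ℂ → ℂ) (z : ℂ) : ℂ := (∏ i, BB (aa i * n) z) * (GG ((2*X+1)^k) z * h (Real.pi * z))

/-- sign -/
noncomputable def sg (n : ℕ) : ℂ := ∏ i, (-1:ℂ)^(aa i * n + 1)

lemma sg_norm (n : ℕ) : ‖sg n‖ = 1 := by simp [sg, norm_prod]

lemma GG_fR (n k : ℕ) (z : ℂ) : GG (fR n k) z = (1 / (cN n : ℂ)) * ((∏ i, aeval z (bm (aa i * n))) * GG ((2*X+1)^k) z) := by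
  rw [GG, GG, fR, WR_bm]
  simp only [map_mul, map_prod, aeval_C, Complex.coe_algebraMap]
  push_cast
  ring

lemma GG_PH (n k : ℕ) (y : ℝ) : GG (fR n k) (hl y) * K1 (hl y) ^ 3 = sg n * ((∏ i, BB (aa i * n) (hl y)) * GG ((2*X+1)^k) (hl y)) := by
  rw [GG_fR]
  have e : (∏ i, aeval (hl y) (bm (aa i * n))) * K1 (hl y) ^ 3 = sg n * ((cN n : ℂ) * ∏ i, BB (aa i * n) (hl y)) := by
    have h1 : (∏ i : Fin 3, aeval (hl y) (bm (aa i * n))) * K1 (hl y) ^ 3 = ∏ i : Fin 3, (aeval (hl y) (bm (aa i * n)) * K1 (hl y)) := by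
      rw [prod_mul_distrib]; simp
    have h2 : (cN n : ℂ) = ∏ i, ((2 * (aa i * n)).factorial : ℂ) := by
      unfold cN; push_cast; rfl
    rw [h1, h2, sg, ← prod_mul_distrib, ← prod_mul_distrib]
    refine prod_congr rfl fun i _ => ?_
    rw [bm_K1, BB]
    have : ((2 * (aa i * n)).factorial : ℂ) ≠ 0 := by exact_mod_cast Nat.factorial_ne_zero _
    field_simp
  have hc : (cN n : ℂ) ≠ 0 := by exact_mod_cast (cN_pos n).ne'
  have : ∀ A B C D E : ℂ, A * (B * C) * D = A * (B * D) * C := fun A B C D _ => by ring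
  rw [this _ _ _ _ 0, e]
  field_simp

lemma PH_sin (n k : ℕ) (y : ℝ) : GG (fR n k) (hl y) * K1 (hl y) ^ 2 = sg n / Real.pi * PH n k Complex.sin (hl y) := by
  have h := GG_PH n k y
  have hs := sin_hl_ne y
  have hp : (Real.pi : ℂ) ≠ 0 := by exact_mod_cast Real.pi_ne_zero
  have e : K1 (hl y) ^ 2 = K1 (hl y) ^ 3 * (Complex.sin (Real.pi * hl y) / Real.pi) := by
    rw [K1]; field_simp
  rw [e, ← mul_assoc, h, PH]; ring

lemma PH_cos (n k : ℕ) (y : ℝ) : GG (fR n k) (hl y) * (K1 (hl y) ^ 3 * Complex.cos (Real.pi * hl y)) = sg n * PH n k Complex.cos (hl y) := by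
  rw [← mul_assoc, GG_PH, PH]; ring

noncomputable def f1 (f : ℝ[X]) : ℝ := LL * Sm f + Sm (derivative f)
noncomputable def f2 (f : ℝ[X]) : ℝ := LL^2/2 * Sm f + LL * Sm (derivative f) + Sm (hasseDeriv 2 f)

lemma f1_le (n k : ℕ) : |f1 (fR n k)| ≤ ‖∫ y, PH n k Complex.sin (hl y)‖ := by
  have h := res1 (fR n k)
  simp_rw [PH_sin] at h
  rw [integral_const_mul] at h
  have h2 := congrArg norm h
  rw [norm_mul, norm_div, sg_norm, norm_mul, norm_neg, norm_mul] at h2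
  simp only [Complex.norm_real, Real.norm_eq_abs, abs_of_pos Real.pi_pos, Complex.norm_ofNat] at h2
  have hp := Real.pi_gt_three
  have e : |f1 (fR n k)| * (2 * Real.pi ^ 2) = ‖∫ y, PH n k Complex.sin (hl y)‖ := by
    rw [f1]; field_simp at h2; linarith
  have h2p : 1 ≤ 2 * Real.pi ^ 2 := by nlinarith
  rw [← e]; exact le_mul_of_one_le_right (abs_nonneg _) h2p

lemma f2_le (n k : ℕ) : |f2 (fR n k)| ≤ ‖∫ y, PH n k Complex.cos (hl y)‖ := by
  have h := res2 (fR n k)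
  simp_rw [PH_cos] at h
  rw [integral_const_mul] at h
  have h2 := congrArg norm h
  rw [norm_mul, sg_norm, norm_mul, norm_neg, norm_mul] at h2
  simp only [Complex.norm_real, Real.norm_eq_abs, abs_of_pos Real.pi_pos, Complex.norm_ofNat] at h2
  have hp := Real.pi_gt_three
  have e : |f2 (fR n k)| * (2 * Real.pi) = ‖∫ y, PH n k Complex.cos (hl y)‖ := by
    rw [f2]; linarith
  nlinarith [abs_nonneg (f2 (fR n k))]

/-- admissible trigonometric factor -/
def TR (h : ℂ → ℂ) : Prop := Differentiable ℂ h ∧ ∀ z : ℂ, ‖h (Real.pi * z)‖ ≤ Real.exp (Real.pi * |z.im|)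

lemma exp_I_norm (z : ℂ) : ‖Complex.exp (-(Real.pi * z) * Complex.I)‖ ≤ Real.exp (Real.pi * |z.im|) ∧
   ‖Complex.exp (Real.pi * z * Complex.I)‖ ≤ Real.exp (Real.pi * |z.im|) := by
  have n1 : ‖Complex.exp (-(Real.pi * z) * Complex.I)‖ = Real.exp (Real.pi * z.im) := by
    rw [Complex.norm_exp]; simp
  have n2 : ‖Complex.exp (Real.pi * z * Complex.I)‖ = Real.exp (-(Real.pi * z.im)) := by
    rw [Complex.norm_exp]; simp
  rw [n1, n2]
  have hp := Real.pi_pos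
  constructor <;> apply Real.exp_le_exp.2
  · have := le_abs_self z.im; gcongr
  · have := neg_abs_le z.im; nlinarith

lemma TR_sin : TR Complex.sin := by
  refine ⟨Complex.differentiable_sin, fun z => ?_⟩
  have e : Complex.sin (Real.pi * z) = (Complex.exp (-(Real.pi * z) * Complex.I) - Complex.exp (Real.pi * z * Complex.I)) * Complex.I / 2 := rfl
  rw [e, norm_div, norm_mul, Complex.norm_I, mul_one, Complex.norm_ofNat]
  have := norm_sub_le (Complex.exp (-(Real.pi * z) * Complex.I)) (Complex.exp (Real.pi * z * Complex.I))
  have := exp_I_norm z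
  linarith

lemma TR_cos : TR Complex.cos := by
  refine ⟨Complex.differentiable_cos, fun z => ?_⟩
  have e : Complex.cos (Real.pi * z) = (Complex.exp (Real.pi * z * Complex.I) + Complex.exp (-(Real.pi * z) * Complex.I)) / 2 := rfl
  rw [e, norm_div, Complex.norm_ofNat]
  have := norm_add_le (Complex.exp (Real.pi * z * Complex.I)) (Complex.exp (-(Real.pi * z) * Complex.I))
  have := exp_I_norm z
  linarith

noncomputable def cc : ℝ := 6/5
noncomputable def y0 : ℝ := 6.185754

lemma aa_cast (i : Fin 3) (n : ℕ) : (((aa i * n : ℕ)):ℝ) = (aa i : ℝ) * n := by push_cast; ring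
lemma aa_ge (i : Fin 3) : (9:ℝ) ≤ aa i := by fin_cases i <;> norm_num [aa]

lemma aa_strip (i : Fin 3) (n : ℕ) (z : ℂ) (hz : z ∈ strip (-1/2) (cc * n - 1/2)) :
    -1 - ((aa i * n : ℕ):ℝ) < z.re ∧ z.re < ((aa i * n : ℕ):ℝ) := by
  have h := aa_ge i
  have h1 := hz.1
  have h2 := hz.2
  rw [aa_cast]
  have hn : (0:ℝ) ≤ n := Nat.cast_nonneg n
  have hc : cc = 6/5 := rfl
  rw [hc] at h2
  constructor <;> nlinarith

lemma BB_diff (N : ℕ) (z : ℂ) (h : -1 - (N:ℝ) < z.re ∧ z.re < N) : DifferentiableAt ℂ (BB N) z := by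
  have g1 : DifferentiableAt ℂ Complex.Gamma (z + N + 1) := by
    refine Complex.differentiableAt_Gamma _ fun m hm => ?_
    have := congrArg Complex.re hm
    simp at this
    have hm0 : (0:ℝ) ≤ m := Nat.cast_nonneg m
    linarith [h.1]
  have g2 : DifferentiableAt ℂ Complex.Gamma (N - z) := by
    refine Complex.differentiableAt_Gamma _ fun m hm => ?_
    have := congrArg Complex.re hm
    simp at this
    have hm0 : (0:ℝ) ≤ m := Nat.cast_nonneg m
    linarith [h.2]
  unfold BB
  refine DifferentiableAt.div_const (DifferentiableAt.mul ?_ ?_) _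
  · exact DifferentiableAt.comp z (f := fun z : ℂ => z + N + 1) g1 (by fun_prop)
  · exact DifferentiableAt.comp z (f := fun z : ℂ => (N:ℂ) - z) g2 (by fun_prop)

lemma PH_diff (n k : ℕ) {h : ℂ → ℂ} (hh : TR h) : DifferentiableOn ℂ (PH n k h) (strip (-1/2) (cc * n - 1/2)) := by
  intro z hz
  refine DifferentiableAt.differentiableWithinAt ?_
  unfold PH
  refine DifferentiableAt.mul ?_ (DifferentiableAt.mul (GG_diff _ z) ?_)
  · refine DifferentiableAt.fun_finsetProd fun i _ => BB_diff _ z (aa_strip i n z hz)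
  · exact DifferentiableAt.comp z (f := fun z : ℂ => Real.pi * z) (hh.1 _) (by fun_prop)

lemma rB_cont (N : ℕ) (a b : ℝ) (ha : -1 - (N:ℝ) < a) (hb : b < N) : ∃ K, ∀ x, a ≤ x → x ≤ b → rB N x ≤ K := by
  have hc : ContinuousOn (rB N) (Set.Icc a b) := by
    intro x hx
    refine ContinuousAt.continuousWithinAt ?_
    unfold rB
    have g1 : ContinuousAt Real.Gamma (x + N + 1) := by
      refine (Real.differentiableAt_Gamma fun m hm => ?_).continuousAt
      have hm0 : (0:ℝ) ≤ m := Nat.cast_nonneg m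
      linarith [hx.1]
    have g2 : ContinuousAt Real.Gamma (N - x) := by
      refine (Real.differentiableAt_Gamma fun m hm => ?_).continuousAt
      have hm0 : (0:ℝ) ≤ m := Nat.cast_nonneg m
      linarith [hx.2]
    refine ContinuousAt.div_const (ContinuousAt.mul ?_ ?_) _
    · exact ContinuousAt.comp (f := fun x : ℝ => x + N + 1) g1 (by fun_prop)
    · exact ContinuousAt.comp (f := fun x : ℝ => (N:ℝ) - x) g2 (by fun_prop)
  obtain ⟨K, hK⟩ := isCompact_Icc.exists_bound_of_continuousOn hc
  exact ⟨K, fun x h1 h2 => (le_abs_self _).trans (hK x ⟨h1, h2⟩)⟩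

lemma BB_decay (i : Fin 3) (n : ℕ) : ∃ K, ∀ z ∈ strip (-1/2) (cc * n - 1/2), ‖BB (aa i * n) z‖ ≤ K * Real.exp (-(2 * Real.pi / 3 * |z.im|)) := by
  have hn : (0:ℝ) ≤ n := Nat.cast_nonneg n
  have h9 := aa_ge i
  have hc : cc = 6/5 := rfl
  obtain ⟨K, hK⟩ := rB_cont (aa i * n) (-1/2) (cc * n - 1/2) (by rw [aa_cast]; nlinarith) (by rw [aa_cast, hc]; nlinarith)
  refine ⟨K * Real.exp ((2 * (aa i * n : ℕ) + 1) * Real.log 2), fun z hz => ?_⟩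
  have hs := aa_strip i n z hz
  have hp := Real.pi_pos
  have := BB_bound (aa i * n) z hs.1 hs.2 (Real.pi/3) (Real.pi/3) (by positivity) (by linarith) (by positivity) (by linarith)
  refine this.trans ?_
  rw [Real.cos_pi_div_three, one_div, Real.log_inv]
  have e1 : -((z.re + (aa i * n : ℕ) + 1) * -Real.log 2) - ((aa i * n : ℕ) - z.re) * -Real.log 2 = (2 * (aa i * n : ℕ) + 1) * Real.log 2 := by ring
  rw [e1, mul_comm, show (Real.pi/3 + Real.pi/3) = 2 * Real.pi / 3 by ring]
  have := hK z.re hz.1 hz.2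
  gcongr

lemma PH_decay (n k : ℕ) {h : ℂ → ℂ} (hh : TR h) : ∃ K, ∀ z ∈ strip (-1/2) (cc * n - 1/2), ‖PH n k h z‖ ≤ K * Real.exp (-|z.im|) := by
  have hn : (0:ℝ) ≤ n := Nat.cast_nonneg n
  have hc : cc = 6/5 := rfl
  choose K hK using fun i => BB_decay i n
  obtain ⟨M, hM, hMb⟩ := GG_growth ((2*X+1)^k) (cc * n + 1) (by rw [hc]; positivity)
  have hp := Real.pi_gt_three
  refine ⟨(∏ i, |K i|) * M, fun z hz => ?_⟩
  have b1 : ∀ i, ‖BB (aa i * n) z‖ ≤ |K i| * Real.exp (-(2 * Real.pi / 3 * |z.im|)) := fun i =>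
    (hK i z hz).trans (by gcongr; exact le_abs_self _)
  have b2 : ‖∏ i, BB (aa i * n) z‖ ≤ (∏ i, |K i|) * Real.exp (-(2 * Real.pi * |z.im|)) := by
    rw [norm_prod]
    refine (prod_le_prod (fun i _ => norm_nonneg _) fun i _ => b1 i).trans (le_of_eq ?_)
    rw [prod_mul_distrib, prod_const, card_univ, Fintype.card_fin, ← Real.exp_nat_mul]
    push_cast; ring_nf
  have b3 := hMb z (by
    have h1 := hz.1
    have h2 := hz.2
    rw [hc] at *
    rw [abs_le]; constructor <;> linarith)
  have b4 := hh.2 z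
  rw [PH, norm_mul, norm_mul]
  have p0 : 0 ≤ ∏ i, |K i| := prod_nonneg fun i _ => abs_nonneg _
  calc _ ≤ ((∏ i, |K i|) * Real.exp (-(2 * Real.pi * |z.im|))) * ((M * Real.exp |z.im|) * Real.exp (Real.pi * |z.im|)) := by gcongr
    _ = (∏ i, |K i|) * M * Real.exp (-(2 * Real.pi * |z.im|) + |z.im| + Real.pi * |z.im|) := by
      rw [Real.exp_add, Real.exp_add]; ring
    _ ≤ _ := by
      gcongr
      nlinarith [abs_nonneg z.im]

lemma PH_shift (n k : ℕ) {h : ℂ → ℂ} (hh : TR h) : ∫ y, PH n k h (hl y) = ∫ y : ℝ, PH n k h (((cc * n - 1/2 : ℝ) : ℂ) + y * Complex.I) := by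
  obtain ⟨K, hK⟩ := PH_decay n k hh
  refine strip_shift ?_ (PH_diff n k hh) hK
  have hn : (0:ℝ) ≤ n := Nat.cast_nonneg n
  have hc : cc = 6/5 := rfl
  rw [hc]; linarith

/-- angle sum and rate -/
noncomputable def ps (a : ℝ) : ℝ := Real.arctan (y0 / (a + cc)) + Real.arctan (y0 / (a - cc))
noncomputable def el (a : ℝ) : ℝ := (a + cc) / 2 * Real.log ((a + cc)^2 + y0^2) + (a - cc) / 2 * Real.log ((a - cc)^2 + y0^2) - 2 * a * Real.log (2 * a)

lemma log_cos_arctan (p : ℝ) (hp : 0 < p) : Real.log (Real.cos (Real.arctan (y0 / p))) = Real.log p - 1/2 * Real.log (p^2 + y0^2) := by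
  rw [Real.cos_arctan, one_div, Real.log_inv, Real.log_sqrt (by positivity)]
  have : 1 + (y0 / p)^2 = (p^2 + y0^2) / p^2 := by field_simp
  have hy : 0 < p^2 + y0^2 := by positivity
  rw [this, Real.log_div hy.ne' (by positivity), Real.log_pow]; push_cast; ring

lemma BB_line (i : Fin 3) : ∃ K, 0 ≤ K ∧ ∀ (n : ℕ) (y : ℝ), ‖BB (aa i * n) (((cc * n - 1/2 : ℝ) : ℂ) + y * Complex.I)‖ ≤
    K * Real.exp (n * el (aa i)) * Real.exp (-(ps (aa i) * |y|)) := by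
  set a : ℝ := (aa i : ℝ) with ha
  have h9 : 9 ≤ a := aa_ge i
  have hc : cc = 6/5 := rfl
  have hy0 : 0 < y0 := by norm_num [y0]
  have hp : 0 < a + cc := by rw [hc]; linarith
  have hq : 0 < a - cc := by rw [hc]; linarith
  set ψ := Real.arctan (y0 / (a + cc))
  set χ := Real.arctan (y0 / (a - cc))
  have h1 : 0 ≤ ψ := Real.arctan_nonneg.2 (by positivity)
  have h3 : 0 ≤ χ := Real.arctan_nonneg.2 (by positivity)
  refine ⟨Real.pi * Real.exp (-(1/2 * Real.log (Real.cos ψ)) - 1/2 * Real.log (Real.cos χ)), by positivity, fun n y => ?_⟩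
  have hm := line_mem (a := -1/2) (b := cc * n - 1/2) (c := cc * n - 1/2) (by have : (0:ℝ) ≤ n := Nat.cast_nonneg n; rw [hc]; linarith) le_rfl y
  have hs := aa_strip i n _ hm
  have b := BB_bound (aa i * n) _ hs.1 hs.2 ψ χ h1 (Real.arctan_lt_pi_div_two _) h3 (Real.arctan_lt_pi_div_two _)
  refine b.trans ?_
  have hre : (((cc * n - 1/2 : ℝ) : ℂ) + y * Complex.I).re = cc * n - 1/2 := by simp
  have him : (((cc * n - 1/2 : ℝ) : ℂ) + y * Complex.I).im = y := by simp
  rw [hre, him, aa_cast, ← ha]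
  have r := rB_bound a n (aa i * n) (aa_cast i n) cc hp hq
  have l1 := log_cos_arctan (a + cc) hp
  have l2 := log_cos_arctan (a - cc) hq
  have e : -((cc * n - 1/2 + a * n + 1) * Real.log (Real.cos ψ)) - (a * n - (cc * n - 1/2)) * Real.log (Real.cos χ) =
     (-(1/2 * Real.log (Real.cos ψ)) - 1/2 * Real.log (Real.cos χ)) + n * (-((a + cc) * Real.log (Real.cos ψ)) - (a - cc) * Real.log (Real.cos χ)) := by ring
  rw [e, Real.exp_add]
  have e2 : el a = (a + cc) * Real.log (a + cc) + (a - cc) * Real.log (a - cc) - 2 * a * Real.log (2 * a) + (-((a + cc) * Real.log (Real.cos ψ)) - (a - cc) * Real.log (Real.cos χ)) := by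
    rw [l1, l2, el]; ring
  rw [e2, mul_add, Real.exp_add]
  have e3 : ps a = ψ + χ := rfl
  rw [e3]
  set A := Real.exp (-((ψ + χ) * |y|))
  have hA : 0 < A := Real.exp_pos _
  set B := Real.exp (-(1/2 * Real.log (Real.cos ψ)) - 1/2 * Real.log (Real.cos χ))
  have hB : 0 < B := Real.exp_pos _
  set D := Real.exp (n * (-((a + cc) * Real.log (Real.cos ψ)) - (a - cc) * Real.log (Real.cos χ)))
  have hD : 0 < D := Real.exp_pos _
  calc _ ≤ A * (Real.pi * Real.exp (n * ((a + cc) * Real.log (a + cc) + (a - cc) * Real.log (a - cc) - 2 * a * Real.log (2 * a))) * (B * D)) := by gcongr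
    _ = _ := by ring

lemma pair_arctan (a : ℝ) (ha : 9 ≤ a) : ps a = Real.arctan (2 * a * y0 / (a^2 - cc^2 - y0^2)) := by
  have hc : cc = 6/5 := rfl
  have hy : y0 = 6.185754 := rfl
  have hp : 0 < a + cc := by rw [hc]; linarith
  have hq : 0 < a - cc := by rw [hc]; linarith
  have h0 : 0 < a^2 - cc^2 - y0^2 := by rw [hc, hy]; nlinarith
  rw [ps, Real.arctan_add]
  · congr 1
    have : 1 - y0 / (a + cc) * (y0 / (a - cc)) = (a^2 - cc^2 - y0^2) / ((a + cc) * (a - cc)) := by field_simp; ring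
    rw [this]
    field_simp
    ring
  · rw [div_mul_div_comm, div_lt_one (by positivity)]; nlinarith

lemma angle_gt : Real.pi < ps 9 + ps 11 + ps 13 := by
  rw [pair_arctan 9 (by norm_num), pair_arctan 11 (by norm_num), pair_arctan 13 (by norm_num)]
  rw [Real.arctan_add_eq_add_pi (by norm_num [cc, y0]) (by norm_num [cc, y0])]
  have : -Real.arctan (2 * 13 * y0 / (13^2 - cc^2 - y0^2)) < Real.arctan ((2 * 9 * y0 / (9^2 - cc^2 - y0^2) + 2 * 11 * y0 / (11^2 - cc^2 - y0^2)) / (1 - 2 * 9 * y0 / (9^2 - cc^2 - y0^2) * (2 * 11 * y0 / (11^2 - cc^2 - y0^2)))) := by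
    rw [← Real.arctan_neg, Real.arctan_lt_arctan_iff]
    norm_num [cc, y0]
  linarith

noncomputable def lamr : ℝ := el 9 + el 11 + el 13 + cc * LL

lemma PH_line : ∃ K, 0 ≤ K ∧ ∀ (n k : ℕ), k ≤ 2 → ∀ h, TR h → ∀ y : ℝ, ‖PH n k h (((cc * n - 1/2 : ℝ) : ℂ) + y * Complex.I)‖ ≤
    K * (((n:ℝ) + 1)^2 * Real.exp (n * lamr)) * ((1 + |y|)^2 * Real.exp (-((ps 9 + ps 11 + ps 13 - Real.pi) * |y|))) := by
  choose K hK0 hK using BB_line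
  refine ⟨(K 0 * K 1 * K 2) * (9 * Real.exp (-(LL/2))), by have := hK0 0; have := hK0 1; have := hK0 2; positivity, fun n k hk h hh y => ?_⟩
  set z : ℂ := ((cc * n - 1/2 : ℝ) : ℂ) + y * Complex.I with hz
  have hre : z.re = cc * n - 1/2 := by simp [hz]
  have him : z.im = y := by simp [hz]
  have hn : (0:ℝ) ≤ n := Nat.cast_nonneg n
  have hc : cc = 6/5 := rfl
  have b1 : ‖∏ i, BB (aa i * n) z‖ ≤ (K 0 * Real.exp (n * el 9) * Real.exp (-(ps 9 * |y|))) * (K 1 * Real.exp (n * el 11) * Real.exp (-(ps 11 * |y|))) * (K 2 * Real.exp (n * el 13) * Real.exp (-(ps 13 * |y|))) := by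
    rw [norm_prod, Fin.prod_univ_three]
    have h0 := hK 0 n y
    have h1 := hK 1 n y
    have h2 := hK 2 n y
    have a0 : ((aa 0 : ℕ):ℝ) = 9 := by simp [aa]
    have a1 : ((aa 1 : ℕ):ℝ) = 11 := by simp [aa]
    have a2 : ((aa 2 : ℕ):ℝ) = 13 := by simp [aa]
    rw [a0] at h0
    rw [a1] at h1
    rw [a2] at h2
    have := hK0 0; have := hK0 1; have := hK0 2
    gcongr
  have b2 : ‖GG ((2*X+1)^k) z‖ ≤ (3 * ((n:ℝ) + 1) * (1 + |y|))^2 * (Real.exp (-(LL/2)) * Real.exp (n * (cc * LL))) := by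
    rw [GG, norm_mul, Complex.norm_exp, ← Real.exp_add]
    have e : ((LL:ℂ) * z).re = -(LL/2) + n * (cc * LL) := by simp [hre]; ring
    rw [e]
    have e2 : ‖aeval z ((2*X+1)^k : ℝ[X])‖ ≤ (3 * ((n:ℝ) + 1) * (1 + |y|))^k := by
      rw [map_pow, norm_pow]
      gcongr
      simp only [map_add, map_mul, aeval_X, map_one, map_ofNat]
      refine (Complex.norm_le_abs_re_add_abs_im _).trans ?_
      simp only [Complex.add_re, Complex.mul_re, Complex.re_ofNat, Complex.im_ofNat, zero_mul, sub_zero, Complex.one_re, Complex.add_im, Complex.mul_im, Complex.one_im, add_zero, hre, him]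
      rw [hc]
      have : |2 * (6/5 * (n:ℝ) - 1/2) + 1| = 12/5 * n := by rw [abs_of_nonneg (by linarith)]; ring
      rw [this, abs_mul]
      have := abs_nonneg y
      norm_num
      nlinarith
    have e3 : 1 ≤ 3 * ((n:ℝ) + 1) * (1 + |y|) := by nlinarith [abs_nonneg y, mul_nonneg hn (abs_nonneg y)]
    have := e2.trans (pow_le_pow_right₀ e3 hk)
    gcongr
  have b3 := hh.2 z
  rw [him] at b3
  rw [PH, norm_mul, norm_mul]
  have := hK0 0; have := hK0 1; have := hK0 2
  have e1 : Real.exp (n * lamr) = Real.exp (n * el 9) * Real.exp (n * el 11) * Real.exp (n * el 13) * Real.exp (n * (cc * LL)) := by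
    rw [← Real.exp_add, ← Real.exp_add, ← Real.exp_add, lamr]; ring_nf
  have e2 : Real.exp (-((ps 9 + ps 11 + ps 13 - Real.pi) * |y|)) = Real.exp (-(ps 9 * |y|)) * Real.exp (-(ps 11 * |y|)) * Real.exp (-(ps 13 * |y|)) * Real.exp (Real.pi * |y|) := by
    rw [← Real.exp_add, ← Real.exp_add, ← Real.exp_add]; ring_nf
  rw [e1, e2]
  refine (mul_le_mul b1 (mul_le_mul b2 b3 (norm_nonneg _) (by positivity)) (by positivity) (by positivity)).trans (le_of_eq ?_)
  ring

lemma poly_exp_int (e : ℝ) (he : 0 < e) : Integrable (fun y : ℝ => (1 + |y|)^2 * Real.exp (-(e * |y|))) := by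
  set m := min 1 (e/4) with hm
  have m0 : 0 < m := lt_min one_pos (by positivity)
  have h1 : Integrable (fun y : ℝ => Real.exp (-|e/2 * y|)) := integrable_exp_abs.comp_mul_left' (by positivity)
  refine (h1.const_mul (1/m^2)).mono' (Continuous.aestronglyMeasurable (by fun_prop)) (Eventually.of_forall fun y => ?_)
  rw [Real.norm_of_nonneg (by positivity), abs_mul, abs_of_pos (by positivity : 0 < e/2)]
  have hy := abs_nonneg y
  have k1 : m * (1 + |y|) ≤ Real.exp (e/4 * |y|) := by
    have := Real.add_one_le_exp (e/4 * |y|)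
    have m1 : m ≤ 1 := min_le_left _ _
    have m2 : m ≤ e/4 := min_le_right _ _
    nlinarith
  have k2 : (m * (1 + |y|))^2 ≤ Real.exp (e/2 * |y|) := by
    calc _ ≤ (Real.exp (e/4 * |y|))^2 := by gcongr
      _ = _ := by rw [← Real.exp_nat_mul]; push_cast; ring_nf
  have k3 : (1 + |y|)^2 ≤ 1/m^2 * Real.exp (e/2 * |y|) := by
    rw [div_mul_eq_mul_div, one_mul, le_div_iff₀ (by positivity)]; linarith
  calc _ ≤ 1/m^2 * Real.exp (e/2 * |y|) * Real.exp (-(e * |y|)) := by gcongr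
    _ = _ := by rw [mul_assoc, ← Real.exp_add]; ring_nf

lemma f_bound : ∃ K, 0 ≤ K ∧ ∀ n k : ℕ, k ≤ 2 → |f1 (fR n k)| ≤ K * (((n:ℝ) + 1)^2 * Real.exp (n * lamr)) ∧
    |f2 (fR n k)| ≤ K * (((n:ℝ) + 1)^2 * Real.exp (n * lamr)) := by
  obtain ⟨K, hK0, hK⟩ := PH_line
  have he : 0 < ps 9 + ps 11 + ps 13 - Real.pi := by linarith [angle_gt]
  have hi := poly_exp_int _ he
  set J := ∫ y : ℝ, ((1 + |y|)^2 * Real.exp (-((ps 9 + ps 11 + ps 13 - Real.pi) * |y|))) with hJ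
  have hJ0 : 0 ≤ J := integral_nonneg fun y => by positivity
  have key : ∀ n k : ℕ, k ≤ 2 → ∀ h, TR h → ‖∫ y, PH n k h (hl y)‖ ≤ K * J * (((n:ℝ) + 1)^2 * Real.exp (n * lamr)) := by
    intro n k hk h hh
    rw [PH_shift n k hh]
    refine (norm_integral_le_of_norm_le (hi.const_mul _) (Eventually.of_forall fun y => hK n k hk h hh y)).trans (le_of_eq ?_)
    rw [integral_const_mul, ← hJ]; ring
  refine ⟨K * J, by positivity, fun n k hk => ⟨?_, ?_⟩⟩
  · exact (f1_le n k).trans (key n k hk _ TR_sin)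
  · exact (f2_le n k).trans (key n k hk _ TR_cos)

end NQ

namespace NQ
open Finset Filter Topology Polynomial

lemma log_two_eq (j : ℤ) (x : ℝ) (h0 : 0 ≤ x) (h1 : x < 1) : Real.log ((2:ℝ)^j * ((1 + x) / (1 - x))) = j * Real.log 2 + Real.log ((1 + x) / (1 - x)) := by
  have : 0 < 1 - x := by linarith
  rw [Real.log_mul (by positivity) (by positivity), Real.log_zpow]

lemma log_up {v x R : ℝ} {j : ℤ} (hv : 0 < v) (h0 : 0 ≤ x) (h1 : x < 1) (h : v * (1 - x) ≤ (2:ℝ)^j * (1 + x))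
    (hR : 2 * ((∑ i ∈ range 8, x ^ (2 * i + 1) / (2 * i + 1)) + x ^ (2 * 8 + 1) / (1 - x ^ 2)) ≤ R) :
    Real.log v ≤ (j:ℤ) * Real.log 2 + R := by
  have hx : 0 < 1 - x := by linarith
  have h2 : v ≤ (2:ℝ)^j * ((1 + x) / (1 - x)) := by rw [← mul_div_assoc, le_div_iff₀ hx]; exact h
  have h3 := Real.log_le_log hv h2
  rw [log_two_eq j x h0 h1] at h3
  have := Real.log_div_le_sum_range_add h0 h1 8
  linarith

lemma log_lo {v x R : ℝ} {j : ℤ} (hv : 0 < v) (h0 : 0 ≤ x) (h1 : x < 1) (h : (2:ℝ)^j * (1 + x) ≤ v * (1 - x))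
    (hR : R ≤ 2 * (∑ i ∈ range 8, x ^ (2 * i + 1) / (2 * i + 1))) :
    Real.log v ≥ (j:ℤ) * Real.log 2 + R := by
  have hx : 0 < 1 - x := by linarith
  have h2 : (2:ℝ)^j * ((1 + x) / (1 - x)) ≤ v := by rw [← mul_div_assoc, div_le_iff₀ hx]; exact h
  have h3 := Real.log_le_log (by positivity) h2
  rw [log_two_eq j x h0 h1] at h3
  have := Real.sum_range_le_log_div h0 h1 8
  linarith

lemma lgw0 : Real.log (1.14437675) ≤ (0:ℤ) * Real.log 2 + 0.13486016568 := by
  refine log_up (x := 0.06732807097) ?_ (by norm_num) (by norm_num) ?_ ?_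
  · norm_num
  · norm_num
  · norm_num [Finset.sum_range_succ]

lemma lgv0 : Real.log (1.14437675 - 1) ≥ (-3:ℤ) * Real.log 2 + 0.14411246510 := by
  refine log_lo (x := 0.07193178327) ?_ (by norm_num) (by norm_num) ?_ ?_
  · norm_num
  · norm_num
  · norm_num [Finset.sum_range_succ]

lemma lgw1 : Real.log (1.17933737) ≤ (0:ℤ) * Real.log 2 + 0.16495272992 := by
  refine log_up (x := 0.08228986135) ?_ (by norm_num) (by norm_num) ?_ ?_
  · norm_num
  · norm_num
  · norm_num [Finset.sum_range_succ]

lemma lgv1 : Real.log (1.17933737 - 1) ≥ (-3:ℤ) * Real.log 2 + 0.36095504321 := by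
  refine log_lo (x := 0.17854320683) ?_ (by norm_num) (by norm_num) ?_ ?_
  · norm_num
  · norm_num
  · norm_num [Finset.sum_range_succ]

lemma lgw2 : Real.log (1.21545685) ≤ (0:ℤ) * Real.log 2 + 0.19512001436 := by
  refine log_up (x := 0.09725165715) ?_ (by norm_num) (by norm_num) ?_ ?_
  · norm_num
  · norm_num
  · norm_num [Finset.sum_range_succ]

lemma lgv2 : Real.log (1.21545685 - 1) ≥ (-3:ℤ) * Real.log 2 + 0.54444692015 := by
  refine log_lo (x := 0.26569255399) ?_ (by norm_num) (by norm_num) ?_ ?_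
  · norm_num
  · norm_num
  · norm_num [Finset.sum_range_succ]

lemma lgp0 : Real.log ((9 + cc)^2 + y0^2) ≤ (7:ℤ) * Real.log 2 + 0.10593220609 := by
  refine log_up (x := 0.05291662805) ?_ (by norm_num) (by norm_num) ?_ ?_
  · norm_num [cc, y0]
  · norm_num [cc, y0]
  · norm_num [Finset.sum_range_succ]

lemma lgm0 : Real.log ((9 - cc)^2 + y0^2) ≤ (6:ℤ) * Real.log 2 + 0.43728220547 := by
  refine log_up (x := 0.21522248903) ?_ (by norm_num) (by norm_num) ?_ ?_
  · norm_num [cc, y0]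
  · norm_num [cc, y0]
  · norm_num [Finset.sum_range_succ]

lemma lga0 : Real.log (2 * 9) ≥ (4:ℤ) * Real.log 2 + 0.11778303565 := by
  refine log_lo (x := 0.05882352941) ?_ (by norm_num) (by norm_num) ?_ ?_
  · norm_num
  · norm_num
  · norm_num [Finset.sum_range_succ]

lemma lgp1 : Real.log ((11 + cc)^2 + y0^2) ≤ (7:ℤ) * Real.log 2 + 0.37963195663 := by
  refine log_up (x := 0.18756866456) ?_ (by norm_num) (by norm_num) ?_ ?_
  · norm_num [cc, y0]
  · norm_num [cc, y0]
  · norm_num [Finset.sum_range_succ]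

lemma lgm1 : Real.log ((11 - cc)^2 + y0^2) ≤ (7:ℤ) * Real.log 2 + 0.04807229161 := by
  refine log_up (x := 0.02403151802) ?_ (by norm_num) (by norm_num) ?_ ?_
  · norm_num [cc, y0]
  · norm_num [cc, y0]
  · norm_num [Finset.sum_range_succ]

lemma lga1 : Real.log (2 * 11) ≥ (4:ℤ) * Real.log 2 + 0.31845373111 := by
  refine log_lo (x := 0.15789473684) ?_ (by norm_num) (by norm_num) ?_ ?_
  · norm_num
  · norm_num
  · norm_num [Finset.sum_range_succ]

lemma lgp2 : Real.log ((13 + cc)^2 + y0^2) ≤ (7:ℤ) * Real.log 2 + 0.62820671767 := by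
  refine log_up (x := 0.30416545797) ?_ (by norm_num) (by norm_num) ?_ ?_
  · norm_num [cc, y0]
  · norm_num [cc, y0]
  · norm_num [Finset.sum_range_succ]

lemma lgm2 : Real.log ((13 - cc)^2 + y0^2) ≤ (7:ℤ) * Real.log 2 + 0.32696035917 := by
  refine log_up (x := 0.16203920425) ?_ (by norm_num) (by norm_num) ?_ ?_
  · norm_num [cc, y0]
  · norm_num [cc, y0]
  · norm_num [Finset.sum_range_succ]

lemma lga2 : Real.log (2 * 13) ≥ (4:ℤ) * Real.log 2 + 0.48550781576 := by
  refine log_lo (x := 0.23809523809) ?_ (by norm_num) (by norm_num) ?_ ?_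
  · norm_num
  · norm_num
  · norm_num [Finset.sum_range_succ]

lemma lgx : Real.log ((9 - 4.1231056256)/8) ≤ (-1:ℤ) * Real.log 2 + 0.19821425749 := by
  refine log_up (x := 0.09878391445) ?_ (by norm_num) (by norm_num) ?_ ?_
  · norm_num
  · norm_num
  · norm_num [Finset.sum_range_succ]

lemma EQ_pos : 0 < EQ := by
  unfold EQ
  refine prod_pos fun i _ => ?_
  have h := ww_gt i
  have : 0 < ww i - 1 := by linarith
  positivity

lemma log_EQ : Real.log EQ = ∑ i, ((aa i : ℝ) * Real.log (ww i) - 2 * aa i * Real.log (ww i - 1)) := by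
  unfold EQ
  rw [Real.log_prod]
  · refine sum_congr rfl fun i _ => ?_
    have h := ww_gt i
    have h2 : 0 < ww i - 1 := by linarith
    rw [Real.log_div (by positivity) (by positivity), Real.log_pow, Real.log_pow]
    push_cast; ring
  · intro i _
    have h := ww_gt i
    have h2 : 0 < ww i - 1 := by linarith
    positivity

lemma LL_le : LL ≤ Real.log ((9 - 4.1231056256)/8) := by
  unfold LL
  refine Real.log_le_log xx_pos ?_
  have h : (4.1231056256 : ℝ) < Real.sqrt 17 := by
    apply Real.lt_sqrt_of_sq_lt; norm_num
  rw [xx_eq]; linarith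

noncomputable def sig : ℝ := Real.log EQ + 35.01152 - 9 * Real.log 4
noncomputable def tau : ℝ := -lamr - 35.01152 + 9 * Real.log 4

lemma rates : sig < 9.9057 * tau ∧ 0 < tau ∧ 0 < sig := by
  have h4 : Real.log 4 = 2 * Real.log 2 := by
    rw [show (4:ℝ) = 2^2 by norm_num, Real.log_pow]; push_cast; ring
  have l1 := Real.log_two_gt_d9
  have l2 := Real.log_two_lt_d9
  have e0 : ww 0 = 1.14437675 := rfl
  have e1 : ww 1 = 1.17933737 := rfl
  have e2 : ww 2 = 1.21545685 := rfl
  have a0 : ((aa 0 : ℕ):ℝ) = 9 := by simp [aa]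
  have a1 : ((aa 1 : ℕ):ℝ) = 11 := by simp [aa]
  have a2 : ((aa 2 : ℕ):ℝ) = 13 := by simp [aa]
  have hc : cc = 6/5 := rfl
  have hE := log_EQ
  rw [Fin.sum_univ_three, e0, e1, e2, a0, a1, a2] at hE
  have g1 := lgw0; have g2 := lgw1; have g3 := lgw2
  have g4 := lgv0; have g5 := lgv1; have g6 := lgv2
  have g7 := lgp0; have g8 := lgp1; have g9 := lgp2
  have k1 := lgm0; have k2 := lgm1; have k3 := lgm2
  have k4 := lga0; have k5 := lga1; have k6 := lga2
  have k7 := LL_le.trans lgx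
  push_cast at g1 g2 g3 g4 g5 g6 g7 g8 g9 k1 k2 k3 k4 k5 k6 k7
  have hEub : Real.log EQ ≤ 118.11728 := by rw [hE]; linarith
  have hlam : lamr ≤ -36.73402 := by
    rw [lamr, el, el, el]
    generalize Real.log ((9 + cc)^2 + y0^2) = t1 at *
    generalize Real.log ((11 + cc)^2 + y0^2) = t2 at *
    generalize Real.log ((13 + cc)^2 + y0^2) = t3 at *
    generalize Real.log ((9 - cc)^2 + y0^2) = t4 at *
    generalize Real.log ((11 - cc)^2 + y0^2) = t5 at *
    generalize Real.log ((13 - cc)^2 + y0^2) = t6 at *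
    rw [hc]
    linarith
  have hElb : 1 ≤ EQ := by
    have h : ∀ i : Fin 3, 1 ≤ (ww i)^(aa i) / (ww i - 1)^(2 * aa i) := by
      intro i
      have h1 := ww_gt i
      have h2 : ww i < 2 := by fin_cases i <;> norm_num [ww]
      have h3 : 0 < ww i - 1 := by linarith
      rw [le_div_iff₀ (by positivity), one_mul]
      exact (pow_le_one₀ h3.le (by linarith)).trans (one_le_pow₀ h1.le)
    rw [EQ, Fin.prod_univ_three]
    exact one_le_mul_of_one_le_of_one_le (one_le_mul_of_one_le_of_one_le (h 0) (h 1)) (h 2)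
  have hE0 := Real.log_nonneg hElb
  refine ⟨?_, ?_, ?_⟩
  · rw [sig, tau, h4]; linarith
  · rw [tau, h4]; linarith
  · rw [sig, h4]; linarith

end NQ

namespace NQ
open Finset Filter Topology Polynomial

lemma poly_exp (δ : ℝ) (hδ : 0 < δ) (n : ℕ) :
    ((n:ℝ)+1)^2 ≤ 4 / δ^2 * Real.exp δ * Real.exp (δ * n) := by
  have h := Real.add_one_le_exp (δ/2 * ((n:ℝ)+1))
  have h0 : 0 ≤ δ/2 * ((n:ℝ)+1) := by positivity
  have h1 : (δ/2 * ((n:ℝ)+1))^2 ≤ (Real.exp (δ/2 * ((n:ℝ)+1)))^2 :=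
    pow_le_pow_left₀ h0 (by linarith) 2
  have h2 : (Real.exp (δ/2 * ((n:ℝ)+1)))^2 = Real.exp δ * Real.exp (δ * n) := by
    rw [← Real.exp_nat_mul, ← Real.exp_add]; congr 1; push_cast; ring
  rw [h2] at h1
  have h3 : ((n:ℝ)+1)^2 = 4/δ^2 * (δ/2 * ((n:ℝ)+1))^2 := by field_simp; ring
  rw [h3, mul_assoc]
  exact mul_le_mul_of_nonneg_left h1 (by positivity)

lemma Lam_pos (n : ℕ) : 0 < Lam n := by
  unfold Lam
  have := xx_lt
  have h : 0 < (DD n : ℝ) := by exact_mod_cast Nat.pos_of_ne_zero (DD_ne n)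
  have : 0 < 1 - xx := by linarith
  positivity

lemma Lam_le : ∀ᶠ n : ℕ in atTop, Lam n ≤ Real.exp ((35.01152 - 9 * Real.log 4) * n) := by
  filter_upwards [log_DD_le] with n hn
  have h : 0 < (DD n : ℝ) := by exact_mod_cast Nat.pos_of_ne_zero (DD_ne n)
  have h1 : (DD n : ℝ) ≤ Real.exp (35.01152 * n) := (Real.log_le_iff_le_exp h).1 hn
  have h2 : (4:ℝ)^(9*n) = Real.exp (9 * Real.log 4 * n) := by
    rw [← Real.exp_log (show (0:ℝ) < 4^(9*n) by positivity), Real.log_pow]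
    congr 1; push_cast; ring
  unfold Lam
  rw [h2, div_le_iff₀ (Real.exp_pos _), ← Real.exp_add]
  have h3 : (35.01152 - 9 * Real.log 4) * (n:ℝ) + 9 * Real.log 4 * n = 35.01152 * n := by ring
  rw [h3]
  have := xx_pos
  nlinarith

lemma sk_pos (k : ℕ) : 0 < sk k := by
  unfold sk
  have := s17_gt
  split_ifs <;> positivity

lemma sk_le (k : ℕ) : sk k ≤ 1 := by
  unfold sk
  have := s17_gt
  split_ifs
  · exact le_rfl
  · rw [div_le_one (by linarith)]; linarith

noncomputable def al : ℝ := Real.sqrt 17 * LL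

lemma approx (τ : ℝ) (hτ : τ < tau) : ∃ K : ℝ, 1 ≤ K ∧ ∀ᶠ n : ℕ in atTop, ∀ A B C : ℤ,
    ¬(A = 0 ∧ B = 0 ∧ C = 0) → ∃ q p r : ℤ, A * r + B * p + C * q ≠ 0 ∧
      |(q:ℝ)| ≤ K * Real.exp (sig * n) ∧ |(p:ℝ) - q * al| ≤ K * Real.exp (-τ * n) ∧
      |(r:ℝ) - q * al^2| ≤ K * Real.exp (-τ * n) := by
  obtain ⟨K1, hK1⟩ := Q_bound
  obtain ⟨K2, hK20, hK2⟩ := f_bound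
  set M : ℝ := 4 / (tau-τ)^2 * Real.exp (tau-τ) with hM
  have hM0 : 0 ≤ M := by positivity
  set K3 := K2 * M with hK3
  have hK30 : 0 ≤ K3 := by positivity
  refine ⟨1 + |K1| + (34 + 34 * |LL|) * K3, ?_, ?_⟩
  · have : 0 ≤ (34 + 34 * |LL|) * K3 := by positivity
    linarith [abs_nonneg K1]
  filter_upwards [Lam_le] with n hL A B C hABC
  have s1 := s17_sq
  have s2 := s17_gt
  have s3 := s17_lt
  have hns : ¬((C:ℝ) = 0 ∧ -Real.sqrt 17 * (B:ℝ) = 0 ∧ 34 * (A:ℝ) = 0) := by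
    rintro ⟨h1, h2, h3⟩
    apply hABC
    refine ⟨?_, ?_, ?_⟩
    · have : (A:ℝ) = 0 := by linarith
      exact_mod_cast this
    · have : (B:ℝ) = 0 := by
        rcases mul_eq_zero.1 h2 with h | h
        · linarith
        · exact h
      exact_mod_cast this
    · exact_mod_cast h1
  obtain ⟨k, hk⟩ := nonsing n _ _ _ hns
  obtain ⟨q, p, r, hq, hp, hr⟩ := int_forms n k
  have hk2 : (k:ℕ) ≤ 2 := by omega
  obtain ⟨hf1, hf2⟩ := hK2 n k hk2
  have hQ := hK1 n k hk2
  have hLp := Lam_pos n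
  set t := sk k * Lam n with ht
  have ht0 : 0 < t := mul_pos (sk_pos k) hLp
  have htle : t ≤ Real.exp ((35.01152 - 9 * Real.log 4) * n) := by
    refine le_trans ?_ hL
    have := sk_le k
    nlinarith
  have hbd : ∀ x : ℝ, |x| ≤ K2*(((n:ℝ)+1)^2*Real.exp (n*lamr)) →
      t * |x| ≤ K3 * Real.exp (-τ * n) := by
    intro x hx
    have h1 := poly_exp (tau-τ) (by linarith) n
    calc t * |x| ≤ Real.exp ((35.01152 - 9 * Real.log 4) * n) *
          (K2*((M * Real.exp ((tau-τ) * n))*Real.exp (n*lamr))) := by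
          refine mul_le_mul htle (hx.trans ?_) (abs_nonneg _) (Real.exp_pos _).le
          gcongr
      _ = K3 * (Real.exp ((35.01152 - 9 * Real.log 4) * n) * Real.exp ((tau-τ) * n) *
            Real.exp (n*lamr)) := by rw [hK3]; ring
      _ = K3 * Real.exp (-τ * n) := by
          rw [← Real.exp_add, ← Real.exp_add]; congr 2; rw [tau]; ring
  have b1 := hbd _ hf1
  have b2 := hbd _ hf2
  have e1 : (p:ℝ) - q * al = -(Real.sqrt 17 * (t * f1 (fR n k))) := by
    rw [hp, hq, al, f1]; ring
  have e2 : (r:ℝ) - q * al^2 = 34 * (t * f2 (fR n k)) - 34 * LL * (t * f1 (fR n k)) := by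
    have : Real.sqrt 17 ^ 2 = 17 := by rw [sq]; exact s1
    rw [hr, hq, al, f1, f2, mul_pow, this]; ring
  refine ⟨q, p, r, ?_, ?_, ?_, ?_⟩
  · intro h0
    have h0' : (A:ℝ) * r + B * p + C * q = 0 := by exact_mod_cast h0
    rw [hq, hp, hr] at h0'
    apply hk
    have : t * ((C:ℝ) * Sm (fR n k) + -Real.sqrt 17 * (B:ℝ) * Sm (derivative (fR n k))
      + 34 * (A:ℝ) * Sm (hasseDeriv 2 (fR n k))) = 0 := by rw [← h0']; ring
    exact (mul_eq_zero.1 this).resolve_left ht0.ne'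
  · have hpow : EQ^n = Real.exp (Real.log EQ * n) := by
      rw [mul_comm, Real.exp_nat_mul, Real.exp_log EQ_pos]
    rw [hq, abs_mul, abs_of_pos ht0]
    have hE : 0 ≤ Real.exp (sig * n) := (Real.exp_pos _).le
    have h2 : Real.exp ((35.01152 - 9 * Real.log 4) * n) * EQ^n = Real.exp (sig * n) := by
      rw [hpow, ← Real.exp_add, sig]; congr 1; ring
    have hP : 0 ≤ EQ^n := pow_nonneg EQ_pos.le n
    calc t * |Sm (fR n k)| ≤ Real.exp ((35.01152 - 9 * Real.log 4) * n) * (|K1| * EQ^n) := by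
          refine mul_le_mul htle (hQ.trans ?_) (abs_nonneg _) (Real.exp_pos _).le
          exact mul_le_mul_of_nonneg_right (le_abs_self _) hP
      _ = |K1| * Real.exp (sig * n) := by rw [← h2]; ring
      _ ≤ _ := by
          refine mul_le_mul_of_nonneg_right ?_ hE
          have : 0 ≤ (34 + 34 * |LL|) * K3 := by positivity
          linarith
  · rw [e1, abs_neg, abs_mul, abs_of_pos (show 0 < Real.sqrt 17 by linarith), abs_mul,
      abs_of_pos ht0]
    have hE : 0 ≤ Real.exp (-τ * n) := (Real.exp_pos _).le
    calc Real.sqrt 17 * (t * |f1 (fR n k)|) ≤ 34 * (K3 * Real.exp (-τ * n)) := by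
          refine mul_le_mul (by linarith) b1 (by positivity) (by norm_num)
      _ = (34 * K3) * Real.exp (-τ * n) := by ring
      _ ≤ _ := by
          refine mul_le_mul_of_nonneg_right ?_ hE
          have : 0 ≤ 34 * |LL| * K3 := by positivity
          linarith [abs_nonneg K1]
  · rw [e2]
    have hE : 0 ≤ Real.exp (-τ * n) := (Real.exp_pos _).le
    calc |34 * (t * f2 (fR n k)) - 34 * LL * (t * f1 (fR n k))|
        ≤ |34 * (t * f2 (fR n k))| + |34 * LL * (t * f1 (fR n k))| := abs_sub _ _
      _ = 34 * (t * |f2 (fR n k)|) + 34 * |LL| * (t * |f1 (fR n k)|) := by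
          simp only [abs_mul, abs_of_pos ht0]; norm_num
      _ ≤ 34 * (K3 * Real.exp (-τ * n)) + 34 * |LL| * (K3 * Real.exp (-τ * n)) := by
          gcongr
      _ = ((34 + 34 * |LL|) * K3) * Real.exp (-τ * n) := by ring
      _ ≤ _ := by
          refine mul_le_mul_of_nonneg_right ?_ hE
          linarith [abs_nonneg K1]

end NQ

namespace NQ
open Finset Filter Topology Polynomial

lemma coeff_le_height (P : ℤ[X]) (i : ℕ) : (P.coeff i).natAbs ≤ polyHeight P := by
  by_cases h : P.coeff i = 0
  · simp [h]
  · exact Finset.le_sup (f := fun i => (P.coeff i).natAbs) (mem_support_iff.2 h)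

lemma height_pos (P : ℤ[X]) (h : P ≠ 0) : 1 ≤ polyHeight P := by
  refine le_trans ?_ (coeff_le_height P P.natDegree)
  exact Int.natAbs_pos.2 (leadingCoeff_ne_zero.2 h)

lemma height_bound (κ : ℝ) (hκ : κ > 10.9057) : ∃ N : ℝ, ∀ (H : ℝ) (A B C : ℤ) (β : ℝ), 1 ≤ H →
    |(A:ℝ)| ≤ H → |(B:ℝ)| ≤ H → ¬(A = 0 ∧ B = 0 ∧ C = 0) → A * β^2 + B * β + C = 0 →
    |al - β| < H ^ (-κ) → H ≤ N := by
  obtain ⟨h1, h2, h3⟩ := rates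
  obtain ⟨τ, hτ1, hτ2⟩ := exists_between (show sig / 9.9057 < tau by
    rw [div_lt_iff₀ (by norm_num)]; linarith)
  have hτ0 : 0 < τ := lt_trans (by positivity) hτ1
  have hst : sig / τ ≤ 9.9057 := by
    rw [div_lt_iff₀ (by norm_num)] at hτ1
    rw [div_le_iff₀ hτ0]; linarith
  obtain ⟨K, hK1, hK⟩ := approx τ hτ2
  obtain ⟨n0, hn0⟩ := eventually_atTop.1 hK
  set c := 2 * |al| + 2 with hc
  have hc0 : 0 < c := by positivity
  set c1 := Real.exp (sig * (1 + n0)) * (4*K) ^ (9.9057:ℝ) with hc1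
  have hc10 : 0 < c1 := by positivity
  set D := 2 * (K * c1 * c) with hD
  have hD0 : 0 < D := by positivity
  refine ⟨D ^ (1/(κ - 10.9057)), ?_⟩
  intro H A B C β hH hA hB hABC hroot hβ
  have hH0 : 0 < H := by linarith
  have hKH : 1 ≤ 4 * K * H := by nlinarith
  have hlog : 0 ≤ Real.log (4*K*H) := Real.log_nonneg hKH
  set n : ℕ := ⌈Real.log (4*K*H) / τ⌉₊ + n0 with hn
  have hnl : Real.log (4*K*H) / τ ≤ n := by
    rw [hn]; push_cast
    have := Nat.le_ceil (Real.log (4*K*H) / τ)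
    have : (0:ℝ) ≤ n0 := by positivity
    linarith
  have hnu : (n:ℝ) ≤ Real.log (4*K*H) / τ + (1 + n0) := by
    rw [hn]; push_cast
    have := Nat.ceil_lt_add_one (show 0 ≤ Real.log (4*K*H) / τ by positivity)
    linarith
  obtain ⟨q, p, r, hZ, hq, hp, hr⟩ := hn0 n (by omega) A B C hABC
  have hexp1 : Real.exp (-τ * n) ≤ 1 / (4*K*H) := by
    rw [div_le_iff₀ hτ0] at hnl
    rw [← Real.exp_log (show 0 < 1 / (4*K*H) by positivity), Real.log_div one_ne_zero (by positivity),
      Real.log_one]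
    apply Real.exp_le_exp.2
    linarith
  have hexp2 : Real.exp (sig * n) ≤ c1 * H ^ (9.9057:ℝ) := by
    calc Real.exp (sig * n) ≤ Real.exp (sig * (Real.log (4*K*H) / τ + (1 + n0))) := by gcongr
      _ = Real.exp (sig * (1 + n0)) * (4*K*H) ^ (sig/τ) := by
          rw [Real.rpow_def_of_pos (by positivity), ← Real.exp_add]; congr 1; ring
      _ ≤ Real.exp (sig * (1 + n0)) * (4*K*H) ^ (9.9057:ℝ) := by
          gcongr
      _ = c1 * H ^ (9.9057:ℝ) := by
          rw [Real.mul_rpow (by positivity) hH0.le]; ring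
  have hβ1 : |al - β| ≤ 1 := hβ.le.trans (Real.rpow_le_one_of_one_le_of_nonpos hH (by linarith))
  have hPal : |(A:ℝ) * al^2 + B * al + C| ≤ H ^ (-κ) * (H * c) := by
    have e : (A:ℝ) * al^2 + B * al + C = (al - β) * (A * (2 * al - (al - β)) + B) := by
      linear_combination hroot
    rw [e, abs_mul]
    refine mul_le_mul hβ.le ?_ (abs_nonneg _) (by positivity)
    calc |(A:ℝ) * (2 * al - (al - β)) + B| ≤ |(A:ℝ) * (2 * al - (al - β))| + |(B:ℝ)| := abs_add_le _ _
      _ = |(A:ℝ)| * |2 * al - (al - β)| + |(B:ℝ)| := by rw [abs_mul]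
      _ ≤ H * (2 * |al| + 1) + H := by
          gcongr
          calc |2 * al - (al - β)| ≤ |2 * al| + |al - β| := abs_sub _ _
            _ ≤ 2 * |al| + 1 := by rw [abs_mul]; norm_num; linarith
      _ = H * c := by rw [hc]; ring
  have hZ1 : (1:ℝ) ≤ |(A:ℝ) * r + B * p + C * q| := by
    have := Int.one_le_abs hZ
    exact_mod_cast this
  have hZe : (A:ℝ) * r + B * p + C * q = q * (A * al^2 + B * al + C) + A * (r - q * al^2)
      + B * (p - q * al) := by ring
  have hZ2 : |(A:ℝ) * r + B * p + C * q| ≤ K * (c1 * H ^ (9.9057:ℝ)) * (H ^ (-κ) * (H * c))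
      + H * (K * (1/(4*K*H))) + H * (K * (1/(4*K*H))) := by
    rw [hZe]
    refine (abs_add_three _ _ _).trans ?_
    rw [abs_mul, abs_mul, abs_mul]
    have hKnn : 0 ≤ K := by linarith
    have g1 := hq.trans (mul_le_mul_of_nonneg_left hexp2 hKnn)
    have g2 := hp.trans (mul_le_mul_of_nonneg_left hexp1 hKnn)
    have g3 := hr.trans (mul_le_mul_of_nonneg_left hexp1 hKnn)
    gcongr
  have e1 : H * (K * (1/(4*K*H))) = 1/4 := by
    have : K ≠ 0 := by linarith
    field_simp
  have e2 : H ^ (9.9057:ℝ) * (H ^ (-κ) * H) = (H ^ (κ - 10.9057))⁻¹ := by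
    nth_rewrite 3 [← Real.rpow_one H]
    rw [← Real.rpow_add hH0, ← Real.rpow_add hH0, ← Real.rpow_neg hH0.le]
    congr 1; norm_num; ring
  have e3 : K * (c1 * H ^ (9.9057:ℝ)) * (H ^ (-κ) * (H * c)) = K * c1 * c * (H ^ (κ - 10.9057))⁻¹ := by
    rw [← e2]; ring
  rw [e1, e3] at hZ2
  have hfin : H ^ (κ - 10.9057) ≤ D := by
    have hp0 : 0 < H ^ (κ - 10.9057) := by positivity
    have : 1/2 ≤ K * c1 * c * (H ^ (κ - 10.9057))⁻¹ := by linarith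
    rw [← div_eq_mul_inv, le_div_iff₀ hp0] at this
    linarith
  have hk0 : 0 < κ - 10.9057 := by linarith
  calc H = (H ^ (κ - 10.9057)) ^ (1/(κ - 10.9057)) := by
        rw [← Real.rpow_mul hH0.le, mul_one_div_cancel hk0.ne', Real.rpow_one]
    _ ≤ _ := by gcongr

end NQ

theorem non_quadraticity_measure_alpha_10 :
    ∀ κ : ℝ, κ > 10.9057 →
      {β : ℝ | ∃ P : Polynomial ℤ, Irreducible P ∧ P.natDegree ≤ 2 ∧
          Polynomial.aeval β P = 0 ∧
          |Real.sqrt 17 * Real.log ((Real.sqrt 17 - 1) / (Real.sqrt 17 + 1)) - β| <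
            ((polyHeight P : ℕ) : ℝ) ^ (-κ)}.Finite := by
  intro κ hκ
  obtain ⟨N, hN⟩ := NQ.height_bound κ hκ
  refine (Polynomial.bUnion_roots_finite (Int.castRingHom ℝ) 2
    (Set.finite_Icc (-(⌊N⌋₊:ℤ)) (⌊N⌋₊:ℤ))).subset ?_
  rintro β ⟨P, hirr, hdeg, hroot, hlt⟩
  have hP := hirr.ne_zero
  have hev : (P.coeff 2 : ℝ) * β^2 + P.coeff 1 * β + P.coeff 0 = 0 := by
    rw [Polynomial.aeval_eq_sum_range' (show P.natDegree < 3 by omega)] at hroot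
    simp [Finset.sum_range_succ] at hroot
    linarith
  have hco : ∀ i, |(P.coeff i : ℝ)| ≤ (polyHeight P : ℝ) := by
    intro i
    have := NQ.coeff_le_height P i
    rw [← Int.cast_abs, Int.abs_eq_natAbs]
    exact_mod_cast this
  have hne : ¬(P.coeff 2 = 0 ∧ P.coeff 1 = 0 ∧ P.coeff 0 = 0) := by
    rintro ⟨h2, h1, h0⟩
    apply hP
    ext i
    rcases lt_or_ge 2 i with h | h
    · simpa using Polynomial.coeff_eq_zero_of_natDegree_lt (lt_of_le_of_lt hdeg h)
    · interval_cases i <;> simp [h0, h1, h2]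
  have hH := hN (polyHeight P) (P.coeff 2) (P.coeff 1) (P.coeff 0) β
    (by exact_mod_cast NQ.height_pos P hP) (hco 2) (hco 1) hne hev hlt
  have hH' : polyHeight P ≤ ⌊N⌋₊ := Nat.le_floor hH
  simp only [Set.mem_iUnion]
  refine ⟨P, ⟨hdeg, ?_⟩, ?_⟩
  · intro i
    have := NQ.coeff_le_height P i
    rw [Set.mem_Icc]
    omega
  · have hinj : Function.Injective (Int.castRingHom ℝ) := Int.cast_injective
    have h0 : P.map (Int.castRingHom ℝ) ≠ 0 := (Polynomial.map_ne_zero_iff hinj).2 hP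
    simp only [Finset.mem_coe, Multiset.mem_toFinset]
    rw [Polynomial.mem_roots h0, Polynomial.IsRoot.def, Polynomial.eval_map]
    simpa [Polynomial.aeval_def] using hroot
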